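/- Let H be a complex Hilbert space, let A, B ∈ B(H) be positive operators with A ≤_u B, let g : [0,∞) → [0,∞) be an operator monotone function, let f : [0,∞) → ℝ be an increasing operator convex function, and let r > 0 be a real number. Then f(g(A)^r) ≤_u f(g(B)^r), where functions and real powers of positive operators are taken via the continuous functional calculus. -/

import Mathlib

set_option linter.all false

section F1
open Filter Topology ComplexOrder InnerProductSpace
open scoped ContinuousLinearMap

namespace Leu

section basic
variable {H : Type*} [NormedAddCommGroup H] [InnerProductSpace ℂ H] [CompleteSpace H]
variable {H2 : Type*} [NormedAddCommGroup H2] [InnerProductSpace ℂ H2] [CompleteSpace H2]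

theorem dense_of_orth {E : Type*} [AddCommGroup E] [Module ℂ E] (T : E →ₗ[ℂ] H)
    (h : ∀ z : H, (∀ x, ⟪T x, z⟫_ℂ = 0) → z = 0) : DenseRange T := by
  have : (LinearMap.range T).topologicalClosure = ⊤ := by
    rw [Submodule.topologicalClosure_eq_top_iff, Submodule.eq_bot_iff]
    intro z hz
    exact h z fun x => hz _ ⟨x, rfl⟩
  have h2 := Submodule.dense_iff_topologicalClosure_eq_top.2 this
  rwa [LinearMap.coe_range] at h2

theorem exists_unitary_of_dense {E : Type*} [AddCommGroup E] [Module ℂ E]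
    (T1 : E →ₗ[ℂ] H) (T2 : E →ₗ[ℂ] H2)
    (h : ∀ x, ‖T1 x‖ = ‖T2 x‖) (d1 : DenseRange T1) (d2 : DenseRange T2) :
    ∃ U : H ≃ₗᵢ[ℂ] H2, ∀ x, U (T1 x) = T2 x :=
  ⟨LinearEquiv.extendOfIsometry (LinearEquiv.refl ℂ E) T1 T2 d1 d2 (fun x => (h x).symm),
    fun x => LinearEquiv.extendOfIsometry_eq _ _ _ d1 d2 _ x⟩

/-- `‖X x‖ ≤ ‖Y U x‖` for some unitary `U`. -/
def SqDom (X Y : H →L[ℂ] H) : Prop := ∃ U : H ≃ₗᵢ[ℂ] H, ∀ x, ‖X x‖ ≤ ‖Y (U x)‖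

theorem SqDom.trans {X Y Z : H →L[ℂ] H} (h1 : SqDom X Y) (h2 : SqDom Y Z) : SqDom X Z := by
  obtain ⟨U, hU⟩ := h1
  obtain ⟨V, hV⟩ := h2
  exact ⟨U.trans V, fun x => (hU x).trans (hV _)⟩

theorem inner_apply_self_nonneg {X : H →L[ℂ] H} (hX : 0 ≤ X) (x : H) : 0 ≤ ⟪X x, x⟫_ℂ := 
  ((ContinuousLinearMap.nonneg_iff_isPositive X).1 hX).inner_nonneg_left x

theorem sa_symm {X : H →L[ℂ] H} (hX : IsSelfAdjoint X) (x y : H) :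
    ⟪X x, y⟫_ℂ = ⟪x, X y⟫_ℂ := by
  rw [← ContinuousLinearMap.adjoint_inner_right, ← ContinuousLinearMap.star_eq_adjoint, hX.star_eq]

theorem le_iff_re {X Y : H →L[ℂ] H} (hX : IsSelfAdjoint X) (hY : IsSelfAdjoint Y) :
    X ≤ Y ↔ ∀ x, (⟪X x, x⟫_ℂ).re ≤ (⟪Y x, x⟫_ℂ).re := by
  rw [ContinuousLinearMap.le_def, ContinuousLinearMap.isPositive_def]
  constructor
  · intro h x
    have := h.2 x
    simp [ContinuousLinearMap.reApplyInnerSelf, inner_sub_left] at this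
    exact this
  · intro h
    refine ⟨((ContinuousLinearMap.isSelfAdjoint_iff_isSymmetric).1 (hY.sub hX)), fun x => ?_⟩
    simpa [ContinuousLinearMap.reApplyInnerSelf, inner_sub_left] using h x

theorem norm_sqrt_apply {X : H →L[ℂ] H} (hX : 0 ≤ X) (x : H) :
    ‖CFC.sqrt X x‖ ^ 2 = (⟪X x, x⟫_ℂ).re := by
  have h1 : IsSelfAdjoint (CFC.sqrt X) := (CFC.sqrt_nonneg X).isSelfAdjoint
  have h2 : CFC.sqrt X * CFC.sqrt X = X := CFC.sqrt_mul_sqrt_self X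
  conv_rhs => rw [← h2]
  rw [ContinuousLinearMap.mul_apply, sa_symm h1, inner_self_eq_norm_sq_to_K]
  norm_cast

theorem norm_sqrt_star_mul {R : H →L[ℂ] H} (x : H) :
    ‖CFC.sqrt (star R * R) x‖ = ‖R x‖ := by
  have h := norm_sqrt_apply (star_mul_self_nonneg R) x
  rw [ContinuousLinearMap.mul_apply, ContinuousLinearMap.star_eq_adjoint,
    ContinuousLinearMap.adjoint_inner_left, inner_self_eq_norm_sq_to_K] at h
  norm_cast at h
  exact (sq_eq_sq₀ (norm_nonneg _) (norm_nonneg _)).1 h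

theorem apply_eq_zero_iff_inner {X : H →L[ℂ] H} (hX : 0 ≤ X) (x : H) :
    X x = 0 ↔ ⟪X x, x⟫_ℂ = 0 := by
  constructor
  · intro h; simp [h]
  · intro h
    have h1 := norm_sqrt_apply hX x
    rw [h] at h1
    have h3 : CFC.sqrt X x = 0 := by simpa using h1
    have h2 : CFC.sqrt X * CFC.sqrt X = X := CFC.sqrt_mul_sqrt_self X
    rw [← h2, ContinuousLinearMap.mul_apply, h3, map_zero]

theorem ker_le_of_le {X Y : H →L[ℂ] H} (hX : 0 ≤ X) (hXY : X ≤ Y) {x : H} (h : Y x = 0) :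
    X x = 0 := by
  have h1 := (le_iff_re hX.isSelfAdjoint (hX.trans hXY).isSelfAdjoint).1 hXY x
  have h2 := inner_apply_self_nonneg hX x
  rw [apply_eq_zero_iff_inner hX]
  rw [h] at h1
  rw [Complex.nonneg_iff] at h2
  apply Complex.ext
  · simp at h1 ⊢; linarith [h2.1]
  · exact h2.2.symm

theorem sqrt_apply_eq_zero {X : H →L[ℂ] H} (hX : 0 ≤ X) {x : H} : CFC.sqrt X x = 0 ↔ X x = 0 := by
  constructor
  · intro h
    rw [← CFC.sqrt_mul_sqrt_self X, ContinuousLinearMap.mul_apply, h, map_zero]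
  · intro h
    have := norm_sqrt_apply hX x
    rw [h] at this
    simpa using this

/-- Polar decomposition lemma. -/
theorem sqDom_of_ker_equiv {X Y : H →L[ℂ] H} (R : H →L[ℂ] H)
    (φ : (LinearMap.ker (star R).toLinearMap) ≃ₗᵢ[ℂ] LinearMap.ker R.toLinearMap)
    (hX : ∀ x, ‖X x‖ ≤ ‖star R x‖) (hY : ∀ x, ‖R x‖ ≤ ‖Y x‖) : SqDom X Y := by
  set A := CFC.sqrt (star (star R) * star R) with hA
  have hA0 : 0 ≤ A := CFC.sqrt_nonneg _
  have hAs : IsSelfAdjoint A := hA0.isSelfAdjoint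
  have hAn : ∀ x, ‖A x‖ = ‖star R x‖ := norm_sqrt_star_mul
  have hAA : A * A = R * star R := by
    rw [hA, CFC.sqrt_mul_sqrt_self _ (star_mul_self_nonneg _), star_star]
  let T1 : (H × LinearMap.ker (star R).toLinearMap) →ₗ[ℂ] H :=
    LinearMap.coprod A.toLinearMap (Submodule.subtype _)
  let T2 : (H × LinearMap.ker (star R).toLinearMap) →ₗ[ℂ] H :=
    LinearMap.coprod (star R).toLinearMap ((Submodule.subtype _).comp φ.toLinearMap)
  have e1 : ∀ x (k : LinearMap.ker (star R).toLinearMap), T1 (x, k) = A x + (k : H) := by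
    intro x k; rfl
  have e2 : ∀ x (k : LinearMap.ker (star R).toLinearMap), T2 (x, k) = star R x + (φ k : H) := by
    intro x k; rfl
  have kA : ∀ k : LinearMap.ker (star R).toLinearMap, A k = 0 := by
    intro k
    rw [← norm_eq_zero, hAn, norm_eq_zero]; exact k.2
  have o1 : ∀ x (k : LinearMap.ker (star R).toLinearMap), ⟪A x, (k : H)⟫_ℂ = 0 := by
    intro x k; rw [sa_symm hAs, kA]; simp
  have o2 : ∀ x (k : LinearMap.ker R.toLinearMap), ⟪star R x, (k : H)⟫_ℂ = 0 := by
    intro x k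
    rw [ContinuousLinearMap.star_eq_adjoint, ContinuousLinearMap.adjoint_inner_left]
    have : R k = 0 := k.2
    simp [this]
  have hn : ∀ x, ‖T1 x‖ = ‖T2 x‖ := by
    rintro ⟨x, k⟩
    have a1 := norm_add_sq_eq_norm_sq_add_norm_sq_of_inner_eq_zero (A x) (k : H) (o1 x k)
    have a2 := norm_add_sq_eq_norm_sq_add_norm_sq_of_inner_eq_zero (star R x) (φ k : H) (o2 x _)
    have a3 : ‖(φ k : H)‖ = ‖(k : H)‖ := by
      rw [Submodule.norm_coe, φ.norm_map, Submodule.norm_coe]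
    rw [e1, e2]
    rw [hAn] at a1
    rw [a3] at a2
    nlinarith [norm_nonneg (A x + (k : H)), norm_nonneg (star R x + (φ k : H))]
  have d1 : DenseRange T1 := by
    apply dense_of_orth
    intro z hz
    have h1 : A z = 0 := by
      have := hz (A z, 0)
      rw [e1] at this
      simp only [ZeroMemClass.coe_zero, add_zero] at this
      rw [sa_symm hAs] at this
      exact inner_self_eq_zero.1 this
    have h2 : z ∈ LinearMap.ker (star R).toLinearMap := by
      have : star R z = 0 := by rw [← norm_eq_zero, ← hAn, h1, norm_zero]
      exact this
    have := hz (0, ⟨z, h2⟩)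
    rw [e1] at this
    simpa using this
  have d2 : DenseRange T2 := by
    apply dense_of_orth
    intro z hz
    have h1 : R z = 0 := by
      have := hz (R z, 0)
      rw [e2] at this
      simp only [map_zero, ZeroMemClass.coe_zero, add_zero] at this
      rw [ContinuousLinearMap.star_eq_adjoint, ContinuousLinearMap.adjoint_inner_left] at this
      exact inner_self_eq_zero.1 this
    have := hz (0, φ.symm ⟨z, h1⟩)
    rw [e2] at this
    simpa using this
  obtain ⟨U, hU⟩ := exists_unitary_of_dense T1 T2 hn d1 d2
  refine ⟨U, fun x => ?_⟩
  have key : (fun x => R (U x)) = A := by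
    apply DenseRange.equalizer d1 (by fun_prop) (by fun_prop)
    ext ⟨x, k⟩
    simp only [Function.comp]
    rw [hU, e1, e2, map_add, map_add, kA]
    have h2 : R (φ k) = 0 := (φ k).2
    rw [h2, ← ContinuousLinearMap.mul_apply, ← hAA]
    rfl
  calc ‖X x‖ ≤ ‖star R x‖ := hX x
    _ = ‖A x‖ := (hAn x).symm
    _ = ‖R (U x)‖ := by rw [← congrFun key x]
    _ ≤ _ := hY _

end basic
end Leu
end F1

section F2
open Filter Topology ComplexOrder InnerProductSpace
open scoped ContinuousLinearMap

namespace Leu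

section kernels
variable {H : Type*} [NormedAddCommGroup H] [InnerProductSpace ℂ H] [CompleteSpace H]
variable {H2 : Type*} [NormedAddCommGroup H2] [InnerProductSpace ℂ H2] [CompleteSpace H2]

theorem equiv_of_hilbertBasis {ι κ : Type*} (b : HilbertBasis ι ℂ H) (c : HilbertBasis κ ℂ H2)
    (e : ι ≃ κ) : Nonempty (H ≃ₗᵢ[ℂ] H2) := by
  have ho : Orthonormal ℂ (c ∘ e) := c.orthonormal.comp _ e.injective
  have hs : ⊤ ≤ (Submodule.span ℂ (Set.range (c ∘ e))).topologicalClosure := by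
    rw [e.surjective.range_comp, c.dense_span]
  exact ⟨b.repr.trans (HilbertBasis.mk ho hs).repr.symm⟩

theorem countable_of_orthonormal [TopologicalSpace.SeparableSpace H] {ι : Type*} {v : ι → H}
    (hv : Orthonormal ℂ v) : Countable ι := by
  have h := Set.PairwiseDisjoint.countable_of_isOpen (a := (Set.univ : Set ι))
    (s := fun i => Metric.ball (v i) (1/2)) ?_ (fun i _ => Metric.isOpen_ball)
    (fun i _ => ⟨v i, Metric.mem_ball_self (by norm_num)⟩)
  · exact Set.countable_univ_iff.1 h
  · intro i _ j _ hij
    apply Metric.ball_disjoint_ball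
    have h1 : ‖v i - v j‖ * ‖v i - v j‖ = 2 := by
      rw [norm_sub_mul_self (𝕜 := ℂ), hv.1 i, hv.1 j, hv.2 hij]; norm_num
    rw [dist_eq_norm]
    nlinarith [norm_nonneg (v i - v j)]

theorem hilbertBasis_infinite {ι : Type*} (b : HilbertBasis ι ℂ H)
    (h : ¬ FiniteDimensional ℂ H) : Infinite ι := by
  by_contra hi
  rw [not_infinite_iff_finite] at hi
  have := Fintype.ofFinite ι
  exact h (b.toOrthonormalBasis.toBasis.finiteDimensional_of_finite)

theorem equiv_of_infinite [TopologicalSpace.SeparableSpace H] [TopologicalSpace.SeparableSpace H2]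
    (h1 : ¬ FiniteDimensional ℂ H) (h2 : ¬ FiniteDimensional ℂ H2) : Nonempty (H ≃ₗᵢ[ℂ] H2) := by
  obtain ⟨w, b, hb⟩ := exists_hilbertBasis ℂ H
  obtain ⟨w', b', hb'⟩ := exists_hilbertBasis ℂ H2
  have := hilbertBasis_infinite b h1
  have := hilbertBasis_infinite b' h2
  have := countable_of_orthonormal b.orthonormal
  have := countable_of_orthonormal b'.orthonormal
  obtain ⟨e⟩ := nonempty_equiv_of_countable (α := w) (β := w')
  exact equiv_of_hilbertBasis b b' e

instance ker_complete (R : H →L[ℂ] H) : CompleteSpace (LinearMap.ker R.toLinearMap) :=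
  (ContinuousLinearMap.isClosed_ker R).completeSpace_coe

theorem sq_sandwich_left {X Y : H →L[ℂ] H} (hX : 0 ≤ X) (hXY : X ≤ Y) (x : H) :
    ‖(CFC.sqrt X) (CFC.sqrt Y x)‖ ≤ ‖Y x‖ := by
  have hY := hX.trans hXY
  have h1 := norm_sqrt_apply hX (CFC.sqrt Y x)
  have h2 := norm_sqrt_apply hY (CFC.sqrt Y x)
  have h3 := (le_iff_re hX.isSelfAdjoint hY.isSelfAdjoint).1 hXY (CFC.sqrt Y x)
  rw [← ContinuousLinearMap.mul_apply (CFC.sqrt Y), CFC.sqrt_mul_sqrt_self Y] at h2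
  apply le_of_sq_le_sq _ (norm_nonneg _)
  rw [h1, h2]; exact h3

theorem sq_sandwich_right {X Y : H →L[ℂ] H} (hX : 0 ≤ X) (hXY : X ≤ Y) (x : H) :
    ‖X x‖ ≤ ‖(CFC.sqrt Y) (CFC.sqrt X x)‖ := by
  have hY := hX.trans hXY
  have h1 := norm_sqrt_apply hX (CFC.sqrt X x)
  have h2 := norm_sqrt_apply hY (CFC.sqrt X x)
  have h3 := (le_iff_re hX.isSelfAdjoint hY.isSelfAdjoint).1 hXY (CFC.sqrt X x)
  rw [← ContinuousLinearMap.mul_apply (CFC.sqrt X), CFC.sqrt_mul_sqrt_self X] at h1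
  apply le_of_sq_le_sq _ (norm_nonneg _)
  rw [h1, h2]; exact h3

/-- Intermediate version with an isometry `V`. -/
theorem sqDom_of_isometry [TopologicalSpace.SeparableSpace H] {X Y Z : H →L[ℂ] H} (hX : 0 ≤ X)
    (hXZ : X ≤ Z) (V : H →L[ℂ] H) (hV : star V * V = 1)
    (hVY : ∀ x, ‖Z (star V x)‖ ≤ ‖Y x‖)
    (hker : ¬ FiniteDimensional ℂ (LinearMap.ker Z.toLinearMap)) : SqDom X Y := by
  have hZ := hX.trans hXZ
  have sX : IsSelfAdjoint (CFC.sqrt X) := (CFC.sqrt_nonneg X).isSelfAdjoint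
  have sZ : IsSelfAdjoint (CFC.sqrt Z) := (CFC.sqrt_nonneg Z).isSelfAdjoint
  set R := CFC.sqrt X * CFC.sqrt Z * star V with hR
  have hRs : star R = V * (CFC.sqrt Z * CFC.sqrt X) := by
    simp [hR, mul_assoc, sX.star_eq, sZ.star_eq]
  have hVn : ∀ x, ‖V x‖ = ‖x‖ := by
    intro x
    have h : ⟪V x, V x⟫_ℂ = ⟪x, x⟫_ℂ := by
      rw [← ContinuousLinearMap.adjoint_inner_left, ← ContinuousLinearMap.star_eq_adjoint,
        ← ContinuousLinearMap.mul_apply, hV]; rfl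
    rw [inner_self_eq_norm_sq_to_K, inner_self_eq_norm_sq_to_K] at h
    norm_cast at h
    exact (sq_eq_sq₀ (norm_nonneg _) (norm_nonneg _)).1 h
  have k1 : ¬ FiniteDimensional ℂ (LinearMap.ker R.toLinearMap) := by
    intro hf
    apply hker
    let j : LinearMap.ker Z.toLinearMap →ₗ[ℂ] LinearMap.ker R.toLinearMap :=
      LinearMap.restrict V.toLinearMap (by
        intro x hx
        have hx' : Z x = 0 := hx
        have : star V (V x) = x := by rw [← ContinuousLinearMap.mul_apply, hV]; rfl
        show R (V x) = 0
        simp only [hR, ContinuousLinearMap.mul_apply, this]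
        rw [(sqrt_apply_eq_zero hZ).2 hx', map_zero])
    have hj : Function.Injective j := by
      rw [injective_iff_map_eq_zero]
      intro x hx
      have h1 : V x = 0 := congrArg Subtype.val hx
      have h2 := hVn x
      rw [h1, norm_zero] at h2
      exact Subtype.ext (norm_eq_zero.1 h2.symm)
    exact FiniteDimensional.of_injective j hj
  have k2 : ¬ FiniteDimensional ℂ (LinearMap.ker (star R).toLinearMap) := by
    intro hf
    apply hker
    have hle : LinearMap.ker Z.toLinearMap ≤ LinearMap.ker (star R).toLinearMap := by
      intro x hx
      have hx' : Z x = 0 := hx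
      show star R x = 0
      rw [hRs]
      simp only [ContinuousLinearMap.mul_apply]
      rw [(sqrt_apply_eq_zero hX).2 (ker_le_of_le hX hXZ hx'), map_zero, map_zero]
    exact Submodule.finiteDimensional_of_le hle
  obtain ⟨φ⟩ := equiv_of_infinite k2 k1
  refine sqDom_of_ker_equiv R φ ?_ ?_
  · intro x
    rw [hRs]
    simp only [ContinuousLinearMap.mul_apply, hVn]
    exact sq_sandwich_right hX hXZ x
  · intro x
    simp only [hR, ContinuousLinearMap.mul_apply]
    exact (sq_sandwich_left hX hXZ _).trans (hVY x)

theorem sqDom_of_infinite_ker [TopologicalSpace.SeparableSpace H] {X Y : H →L[ℂ] H} (hX : 0 ≤ X)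
    (hXY : X ≤ Y) (hker : ¬ FiniteDimensional ℂ (LinearMap.ker Y.toLinearMap)) : SqDom X Y :=
  sqDom_of_isometry hX hXY 1 (by simp) (by simp) hker

theorem sqDom_of_ker_eq {X Y : H →L[ℂ] H} (hX : 0 ≤ X)
    (hXY : X ≤ Y) (hker : ∀ x, X x = 0 → Y x = 0) : SqDom X Y := by
  have hY := hX.trans hXY
  have sX : IsSelfAdjoint (CFC.sqrt X) := (CFC.sqrt_nonneg X).isSelfAdjoint
  have sY : IsSelfAdjoint (CFC.sqrt Y) := (CFC.sqrt_nonneg Y).isSelfAdjoint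
  set R := CFC.sqrt X * CFC.sqrt Y with hR
  have hRs : star R = CFC.sqrt Y * CFC.sqrt X := by
    simp [hR, sX.star_eq, sY.star_eq]
  have iff : ∀ x, X x = 0 ↔ Y x = 0 := fun x => ⟨hker x, ker_le_of_le hX hXY⟩
  have gen : ∀ (A B : H →L[ℂ] H), 0 ≤ A → 0 ≤ B → (∀ x, A x = 0 ↔ B x = 0) → ∀ x,
      CFC.sqrt A (CFC.sqrt B x) = 0 → A x = 0 := by
    intro A B hA hB h x hx
    have h2 : B (CFC.sqrt B x) = 0 := (h _).1 ((sqrt_apply_eq_zero hA).1 hx)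
    have h3 := (sqrt_apply_eq_zero hB).2 h2
    rw [← ContinuousLinearMap.mul_apply, CFC.sqrt_mul_sqrt_self B] at h3
    exact (h x).2 h3
  have e : LinearMap.ker (star R).toLinearMap = LinearMap.ker R.toLinearMap := by
    ext x
    have a1 : star R x = 0 ↔ X x = 0 := by
      rw [hRs]
      simp only [ContinuousLinearMap.mul_apply]
      constructor
      · intro h; exact (iff x).2 (gen Y X hY hX (fun x => (iff x).symm) x h)
      · intro h; rw [(sqrt_apply_eq_zero hX).2 h, map_zero]
    have a2 : R x = 0 ↔ X x = 0 := by
      rw [hR]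
      simp only [ContinuousLinearMap.mul_apply]
      constructor
      · intro h; exact gen X Y hX hY iff x h
      · intro h; rw [(sqrt_apply_eq_zero hY).2 ((iff x).1 h), map_zero]
    exact a1.trans a2.symm
  refine sqDom_of_ker_equiv R (LinearIsometryEquiv.ofEq _ _ e) ?_ ?_
  · intro x
    rw [hRs]; exact sq_sandwich_right hX hXY x
  · intro x
    exact sq_sandwich_left hX hXY x

end kernels
end Leu
end F2

section F3
open Filter Topology ComplexOrder InnerProductSpace
open scoped ContinuousLinearMap
namespace Leu
section P3
variable {H : Type*} [NormedAddCommGroup H] [InnerProductSpace ℂ H] [CompleteSpace H]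

theorem spec_Icc {S : H →L[ℂ] H} (hS : 0 ≤ S) {R : ℝ} (hR : ‖S‖ ≤ R) {x : ℝ}
    (hx : x ∈ spectrum ℝ S) : x ∈ Set.Icc 0 R := by
  refine ⟨spectrum_nonneg_of_nonneg hS hx, ?_⟩
  have : Nontrivial (H →L[ℂ] H) := by
    by_contra h
    rw [not_nontrivial_iff_subsingleton] at h
    rw [spectrum.of_subsingleton] at hx
    exact hx
  have := spectrum.norm_le_norm_of_mem hx
  exact (le_abs_self x).trans (this.trans hR)

theorem spec_abs {S : H →L[ℂ] H} {R : ℝ} (hR : ‖S‖ ≤ R) {x : ℝ}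
    (hx : x ∈ spectrum ℝ S) : x ∈ Set.Icc (-R) R := by
  have : Nontrivial (H →L[ℂ] H) := by
    by_contra h
    rw [not_nontrivial_iff_subsingleton] at h
    rw [spectrum.of_subsingleton] at hx
    exact hx
  have := spectrum.norm_le_norm_of_mem hx
  exact abs_le.1 (this.trans hR)

theorem cfc_near {S : H →L[ℂ] H} (hS : IsSelfAdjoint S) {a b : ℝ}
    (hs : spectrum ℝ S ⊆ Set.Icc a b) {f : ℝ → ℝ} (hf : ContinuousOn f (Set.Icc a b))
    {g : ℝ → ℝ} (hg : ContinuousOn g (Set.Icc a b)) {ε : ℝ} (hε : 0 ≤ ε)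
    (h : ∀ x ∈ Set.Icc a b, |f x - g x| ≤ ε) : ‖cfc f S - cfc g S‖ ≤ ε := by
  rw [← cfc_sub f g S (hf.mono hs) (hg.mono hs)]
  exact norm_cfc_le hε fun x hx => h x (hs hx)

theorem intertw {Y S T : H →L[ℂ] H} (hY : IsSelfAdjoint Y) (hS : IsSelfAdjoint S)
    (h : Y * T = T * S) {a b : ℝ} (hy : spectrum ℝ Y ⊆ Set.Icc a b)
    (hs : spectrum ℝ S ⊆ Set.Icc a b) {f : ℝ → ℝ} (hf : ContinuousOn f (Set.Icc a b)) :
    cfc f Y * T = T * cfc f S := by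
  have hp : ∀ p : Polynomial ℝ, cfc p.eval Y * T = T * cfc p.eval S := by
    intro p
    rw [cfc_polynomial p Y, cfc_polynomial p S]
    induction p using Polynomial.induction_on' with
    | add p q hp hq => simp [add_mul, mul_add, hp, hq]
    | monomial n c =>
      simp only [Polynomial.aeval_monomial]
      have : Y ^ n * T = T * S ^ n := by
        induction n with
        | zero => simp
        | succ n ih => rw [pow_succ, pow_succ, mul_assoc, h, ← mul_assoc, ih, mul_assoc]
      rw [mul_assoc, this, ← mul_assoc, ← mul_assoc, Algebra.commutes]
  rw [← sub_eq_zero, ← norm_le_zero_iff]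
  refine le_of_forall_pos_le_add fun ε hε => ?_
  set δ := ε / (2 * (‖T‖ + 1)) with hδ
  have hδ0 : 0 < δ := by positivity
  obtain ⟨p, hpp⟩ := exists_polynomial_near_of_continuousOn a b f hf δ hδ0
  have h1 := cfc_near hY hy hf (g := p.eval) p.continuous.continuousOn hδ0.le
    (fun x hx => by rw [abs_sub_comm]; exact (hpp x hx).le)
  have h2 := cfc_near hS hs hf (g := p.eval) p.continuous.continuousOn hδ0.le
    (fun x hx => by rw [abs_sub_comm]; exact (hpp x hx).le)
  have e : cfc f Y * T - T * cfc f S = (cfc f Y - cfc p.eval Y) * T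
      - T * (cfc f S - cfc p.eval S) := by
    rw [sub_mul, mul_sub, hp]; abel
  rw [e]
  calc _ ≤ ‖(cfc f Y - cfc p.eval Y) * T‖ + ‖T * (cfc f S - cfc p.eval S)‖ := norm_sub_le _ _
    _ ≤ δ * ‖T‖ + ‖T‖ * δ := add_le_add
        ((norm_mul_le _ _).trans (by gcongr)) ((norm_mul_le _ _).trans (by gcongr))
    _ ≤ 0 + ε := by
        rw [hδ, zero_add]
        have : 0 ≤ ‖T‖ := norm_nonneg _
        field_simp
        nlinarith

/-- strong convergence of products -/
theorem st_mul {ι : Type*} {l : Filter ι} {A B : ι → H →L[ℂ] H} {A0 B0 : H →L[ℂ] H} {R : ℝ}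
    (hR : ∀ i, ‖A i‖ ≤ R) (hA : ∀ x, Tendsto (fun i => A i x) l (𝓝 (A0 x)))
    (hB : ∀ x, Tendsto (fun i => B i x) l (𝓝 (B0 x))) (x : H) :
    Tendsto (fun i => A i (B i x)) l (𝓝 (A0 (B0 x))) := by
  have h1 : Tendsto (fun i => A i (B i x - B0 x)) l (𝓝 0) := by
    have h2 : Tendsto (fun i => R * ‖B i x - B0 x‖) l (𝓝 0) := by
      have := (tendsto_iff_norm_sub_tendsto_zero.1 (hB x)).const_mul R
      simpa using this
    refine squeeze_zero_norm (fun i => ?_) h2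
    exact ((A i).le_opNorm _).trans (mul_le_mul_of_nonneg_right (hR i) (norm_nonneg _))
  have := h1.add (hA (B0 x))
  simpa using this

theorem st_pow {ι : Type*} {l : Filter ι} {A : ι → H →L[ℂ] H} {A0 : H →L[ℂ] H} {R : ℝ}
    (hR : ∀ i, ‖A i‖ ≤ R) (hA : ∀ x, Tendsto (fun i => A i x) l (𝓝 (A0 x))) (n : ℕ) (x : H) :
    Tendsto (fun i => (A i ^ n) x) l (𝓝 ((A0 ^ n) x)) := by
  induction n generalizing x with
  | zero => simpa using tendsto_const_nhds
  | succ n ih =>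
    simp only [pow_succ']
    exact st_mul hR hA ih x

theorem st_cfc {ι : Type*} {l : Filter ι} {A : ι → H →L[ℂ] H} {A0 : H →L[ℂ] H} {R : ℝ}
    (hsa : ∀ i, IsSelfAdjoint (A i)) (hsa0 : IsSelfAdjoint A0)
    (hR : ∀ i, ‖A i‖ ≤ R) (hA : ∀ x, Tendsto (fun i => A i x) l (𝓝 (A0 x)))
    {a b : ℝ} (hs : ∀ i, spectrum ℝ (A i) ⊆ Set.Icc a b) (hs0 : spectrum ℝ A0 ⊆ Set.Icc a b)
    {f : ℝ → ℝ} (hf : ContinuousOn f (Set.Icc a b)) (x : H) :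
    Tendsto (fun i => cfc f (A i) x) l (𝓝 (cfc f A0 x)) := by
  have hp : ∀ p : Polynomial ℝ, Tendsto (fun i => cfc p.eval (A i) x) l
      (𝓝 (cfc p.eval A0 x)) := by
    intro p
    have e : ∀ B : H →L[ℂ] H, IsSelfAdjoint B → cfc p.eval B x
        = ∑ k ∈ Finset.range (p.natDegree + 1), p.coeff k • ((B ^ k) x) := by
      intro B hB
      rw [cfc_polynomial p B, Polynomial.aeval_eq_sum_range]
      simp
    rw [e A0 hsa0]
    simp_rw [fun i => e (A i) (hsa i)]
    exact tendsto_finset_sum _ fun k _ => (st_pow hR hA k x).const_smul _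
  rw [Metric.tendsto_nhds]
  intro ε hε
  set δ := ε / (4 * (‖x‖ + 1)) with hδ
  have hδ0 : 0 < δ := by positivity
  obtain ⟨p, hpp⟩ := exists_polynomial_near_of_continuousOn a b f hf δ hδ0
  have key : ∀ B : H →L[ℂ] H, IsSelfAdjoint B → spectrum ℝ B ⊆ Set.Icc a b →
      ‖cfc f B x - cfc p.eval B x‖ ≤ ε / 4 := by
    intro B hB hsB
    have h1 := cfc_near hB hsB hf (g := p.eval) p.continuous.continuousOn hδ0.le
      (fun x hx => by rw [abs_sub_comm]; exact (hpp x hx).le)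
    calc _ = ‖(cfc f B - cfc p.eval B) x‖ := by simp
      _ ≤ δ * ‖x‖ := (ContinuousLinearMap.le_opNorm _ _).trans (by gcongr)
      _ ≤ _ := by
        rw [hδ]
        have : 0 ≤ ‖x‖ := norm_nonneg _
        field_simp
        nlinarith
  have h3 := (Metric.tendsto_nhds.1 (hp p)) (ε / 4) (by positivity)
  filter_upwards [h3] with i hi
  rw [dist_eq_norm] at hi ⊢
  have k1 := key (A i) (hsa i) (hs i)
  have k2 := key A0 hsa0 hs0
  rw [norm_sub_rev] at k2
  calc ‖cfc f (A i) x - cfc f A0 x‖ = ‖(cfc f (A i) x - cfc p.eval (A i) x)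
      + ((cfc p.eval (A i) x - cfc p.eval A0 x) + (cfc p.eval A0 x - cfc f A0 x))‖ := by
        congr 1; abel
    _ ≤ ε/4 + (ε/4 + ε/4) := (norm_add_le _ _).trans
        (add_le_add k1 ((norm_add_le _ _).trans (add_le_add hi.le k2)))
    _ < ε := by linarith

end P3
end Leu
end F3

section F4
open Filter Topology ComplexOrder InnerProductSpace
open scoped ContinuousLinearMap
namespace Leu
section P4
variable {H : Type*} [NormedAddCommGroup H] [InnerProductSpace ℂ H] [CompleteSpace H]

theorem norm_sub_le_of_ge {a : H →L[ℂ] H} {c k : ℝ} (hsa : IsSelfAdjoint a)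
    (hc : algebraMap ℝ (H →L[ℂ] H) c ≤ a)
    (hk : ‖a‖ ≤ k) (hck : c ≤ k) : ‖algebraMap ℝ (H →L[ℂ] H) k - a‖ ≤ k - c := by
  have e : algebraMap ℝ (H →L[ℂ] H) k - a = cfc (fun x => k - x) a := by
    rw [cfc_sub _ _ a, cfc_const k a, cfc_id' ℝ a]
  rw [e]
  refine norm_cfc_le (by linarith) fun x hx => ?_
  have h1 := (algebraMap_le_iff_le_spectrum (a := a) hsa).1 hc x hx
  have h2 := (spec_abs hk hx).2
  rw [Real.norm_eq_abs, abs_of_nonneg (by linarith)]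
  linarith

noncomputable def sT (a b : H →L[ℂ] H) (k : ℝ) : (H →L[ℂ] H) →L[ℂ] (H →L[ℂ] H) :=
  ((1 / (2 * k) : ℝ) : ℂ) • (ContinuousLinearMap.mul ℂ (H →L[ℂ] H)
      (algebraMap ℝ (H →L[ℂ] H) k - a)
    + (ContinuousLinearMap.mul ℂ (H →L[ℂ] H)).flip (algebraMap ℝ (H →L[ℂ] H) k - b))

theorem sT_apply (a b : H →L[ℂ] H) (k : ℝ) (N : H →L[ℂ] H) :
    sT a b k N = ((1 / (2 * k) : ℝ) : ℂ) • ((algebraMap ℝ (H →L[ℂ] H) k - a) * N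
      + N * (algebraMap ℝ (H →L[ℂ] H) k - b)) := by
  simp [sT, sub_mul, mul_sub]

theorem sT_norm {a b : H →L[ℂ] H} {c k : ℝ} (hk0 : 0 < k) (hck : c ≤ k)
    (hsa : IsSelfAdjoint a) (hsb : IsSelfAdjoint b)
    (hca : algebraMap ℝ (H →L[ℂ] H) c ≤ a) (hcb : algebraMap ℝ (H →L[ℂ] H) c ≤ b)
    (hka : ‖a‖ ≤ k) (hkb : ‖b‖ ≤ k) : ‖sT a b k‖ ≤ (k - c) / k := by
  refine ContinuousLinearMap.opNorm_le_bound _ (div_nonneg (by linarith) hk0.le) fun N => ?_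
  rw [sT_apply, norm_smul, Complex.norm_real, Real.norm_eq_abs, abs_of_pos (by positivity)]
  have h1 := norm_sub_le_of_ge hsa hca hka hck
  have h2 := norm_sub_le_of_ge hsb hcb hkb hck
  calc _ ≤ 1 / (2 * k) * ((k - c) * ‖N‖ + ‖N‖ * (k - c)) := by
        gcongr
        exact (norm_add_le _ _).trans (add_le_add ((norm_mul_le _ _).trans (by gcongr))
          ((norm_mul_le _ _).trans (by gcongr)))
    _ = _ := by field_simp; ring

theorem sT_eq {a b : H →L[ℂ] H} {k : ℝ} (hk0 : 0 < k) (N : H →L[ℂ] H) :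
    (1 - sT a b k) N = ((1 / (2 * k) : ℝ) : ℂ) • (a * N + N * b) := by
  have hk : (k : ℂ) ≠ 0 := by exact_mod_cast hk0.ne'
  rw [ContinuousLinearMap.sub_apply, sT_apply, ContinuousLinearMap.one_apply, Algebra.algebraMap_eq_smul_one,
    sub_mul, mul_sub, smul_mul_assoc, one_mul, mul_smul_comm, mul_one, ← Complex.coe_smul k N]
  have : N = ((1 / (2 * k) : ℝ) : ℂ) • ((k : ℂ) • N + (k : ℂ) • N) := by
    rw [← add_smul, smul_smul]
    push_cast
    rw [show (1 / (2 * (k:ℂ)) * (k + k)) = 1 by field_simp; ring, one_smul]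
  nth_rewrite 1 [this]
  rw [← smul_sub]
  congr 1
  abel

theorem sylv {a b : H →L[ℂ] H} {c : ℝ} (hc : 0 < c)
    (hsa : IsSelfAdjoint a) (hsb : IsSelfAdjoint b)
    (hca : algebraMap ℝ (H →L[ℂ] H) c ≤ a) (hcb : algebraMap ℝ (H →L[ℂ] H) c ≤ b) :
    (∀ Q, ∃ N, a * N + N * b = Q) ∧ (∀ N, a * N + N * b = 0 → N = 0) := by
  set k := ‖a‖ + ‖b‖ + c with hk
  have hk0 : 0 < k := by positivity
  have hu : IsUnit (1 - sT a b k) := by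
    apply isUnit_one_sub_of_norm_lt_one
    refine (sT_norm (c := c) hk0 ?_ hsa hsb hca hcb ?_ ?_).trans_lt ?_
    · have := norm_nonneg a; have := norm_nonneg b; linarith
    · have := norm_nonneg b; linarith
    · have := norm_nonneg a; linarith
    · rw [div_lt_one hk0]; linarith
  have hk2 : ((1 / (2 * k) : ℝ) : ℂ) ≠ 0 := by
    have : (1 / (2 * k) : ℝ) ≠ 0 := by positivity
    exact_mod_cast this
  obtain ⟨u, hu⟩ := hu
  constructor
  · intro Q
    refine ⟨(u⁻¹).1 (((1 / (2 * k) : ℝ) : ℂ) • Q), ?_⟩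
    have h1 := sT_eq (a := a) (b := b) hk0 ((u⁻¹).1 (((1 / (2 * k) : ℝ) : ℂ) • Q))
    rw [← hu, ← ContinuousLinearMap.mul_apply, Units.mul_inv, ContinuousLinearMap.one_apply] at h1
    exact (smul_right_injective _ hk2 h1).symm
  · intro N hN
    have h1 := sT_eq (a := a) (b := b) hk0 N
    rw [hN, smul_zero, ← hu] at h1
    have h2 : (u⁻¹).1 (u.1 N) = N := by
      rw [← ContinuousLinearMap.mul_apply, Units.inv_mul, ContinuousLinearMap.one_apply]
    rw [← h2, h1, map_zero]

noncomputable def res (A : H →L[ℂ] H) (x : ℝ) : H →L[ℂ] H :=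
  Ring.inverse (algebraMap ℝ (H →L[ℂ] H) x + A)

noncomputable def gam (A : H →L[ℂ] H) (v : H) (x : ℝ) : ℝ := (⟪v, res A x v⟫_ℂ).re

theorem isUnit_add {A : H →L[ℂ] H} {c x : ℝ} (hsa : IsSelfAdjoint A)
    (hc : algebraMap ℝ (H →L[ℂ] H) c ≤ A) (hx : 0 < x + c) :
    IsUnit (algebraMap ℝ (H →L[ℂ] H) x + A) := by
  have h : (-x) ∉ spectrum ℝ A := by
    intro h
    have := (algebraMap_le_iff_le_spectrum (a := A) hsa).1 hc _ h
    linarith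
  rw [spectrum.notMem_iff] at h
  have := h.neg
  simpa [map_neg, sub_eq_add_neg, add_comm] using this

theorem res_mul {A : H →L[ℂ] H} {c x : ℝ} (hsa : IsSelfAdjoint A)
    (hc : algebraMap ℝ (H →L[ℂ] H) c ≤ A) (hx : 0 < x + c) :
    res A x * (algebraMap ℝ (H →L[ℂ] H) x + A) = 1 :=
  Ring.inverse_mul_cancel _ (isUnit_add hsa hc hx)

theorem mul_res {A : H →L[ℂ] H} {c x : ℝ} (hsa : IsSelfAdjoint A)
    (hc : algebraMap ℝ (H →L[ℂ] H) c ≤ A) (hx : 0 < x + c) :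
    (algebraMap ℝ (H →L[ℂ] H) x + A) * res A x = 1 :=
  Ring.mul_inverse_cancel _ (isUnit_add hsa hc hx)

theorem res_sa {A : H →L[ℂ] H} {x : ℝ} (hsa : IsSelfAdjoint A) : IsSelfAdjoint (res A x) := by
  have h : IsSelfAdjoint (algebraMap ℝ (H →L[ℂ] H) x + A) :=
    (IsSelfAdjoint.algebraMap _ (IsSelfAdjoint.all x)).add hsa
  unfold IsSelfAdjoint res
  rw [← Ring.inverse_star, h.star_eq]

theorem res_cont {A : H →L[ℂ] H} {c : ℝ} (hsa : IsSelfAdjoint A)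
    (hc : algebraMap ℝ (H →L[ℂ] H) c ≤ A) : ContinuousOn (res A) (Set.Ioi (-c)) := by
  intro x hx
  have hx' : 0 < x + c := by have : -c < x := hx; linarith
  obtain ⟨u, hu⟩ := isUnit_add hsa hc hx'
  have h1 := NormedRing.inverse_continuousAt u
  rw [hu] at h1
  have h2 : ContinuousAt (fun x => algebraMap ℝ (H →L[ℂ] H) x + A) x :=
    ((continuous_algebraMap ℝ (H →L[ℂ] H)).add continuous_const).continuousAt
  have h3 : ContinuousAt (res A) x := Filter.Tendsto.comp h1 h2
  exact h3.continuousWithinAt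

theorem gam_cont {A : H →L[ℂ] H} {c : ℝ} (hsa : IsSelfAdjoint A)
    (hc : algebraMap ℝ (H →L[ℂ] H) c ≤ A) (v : H) : ContinuousOn (gam A v) (Set.Ioi (-c)) := by
  have h1 := res_cont hsa hc
  have h2 : Continuous (fun B : H →L[ℂ] H => (⟪v, B v⟫_ℂ).re) := by fun_prop
  exact h2.comp_continuousOn h1

theorem gam_coe {A : H →L[ℂ] H} (hsa : IsSelfAdjoint A) (v : H) (x : ℝ) :
    ((gam A v x : ℝ) : ℂ) = ⟪v, res A x v⟫_ℂ := by
  have h := sa_symm (res_sa (x := x) hsa) v v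
  unfold gam
  apply Complex.ext
  · simp
  · have h2 : (⟪v, res A x v⟫_ℂ) = starRingEnd ℂ ⟪v, res A x v⟫_ℂ := by
      rw [inner_conj_symm, h]
    have h3 := congrArg Complex.im h2
    simp only [Complex.conj_im] at h3
    simp only [Complex.ofReal_im]
    linarith

noncomputable def Wop (S : H →L[ℂ] H) (k : ℝ) (z : ℂ) : H →L[ℂ] H :=
  ((1 / (2 * k) : ℝ) : ℂ) • (((k : ℂ) - z) • 1 + (algebraMap ℝ (H →L[ℂ] H) k - S))

theorem sylv_pow {S : H →L[ℂ] H} (hS : IsSelfAdjoint S) (k : ℝ) (v : H) (n : ℕ) :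
    ∀ ℓ w : H, ((sT S S k) ^ n) (rankOne ℂ ℓ w) v =
      cfc (fun z : ℂ => ⟪w, (Wop S k z ^ n) v⟫_ℂ) S ℓ := by
  have hb : IsSelfAdjoint (algebraMap ℝ (H →L[ℂ] H) k - S) :=
    (IsSelfAdjoint.algebraMap _ (IsSelfAdjoint.all k)).sub hS
  have hn : IsStarNormal S := hS.isStarNormal
  have hcont : ∀ (n : ℕ) (w : H), Continuous (fun z : ℂ => ⟪w, (Wop S k z ^ n) v⟫_ℂ) := by
    intro n w
    unfold Wop
    fun_prop
  induction n with
  | zero =>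
    intro ℓ w
    simp only [pow_zero, ContinuousLinearMap.one_apply, rankOne_apply]
    rw [cfc_const _ S, Algebra.algebraMap_eq_smul_one]
    simp
  | succ n ih =>
    intro ℓ w
    set b := algebraMap ℝ (H →L[ℂ] H) k - S with hbd
    have e1 : sT S S k (rankOne ℂ ℓ w) = ((1 / (2 * k) : ℝ) : ℂ) •
        (rankOne ℂ (b ℓ) w + rankOne ℂ ℓ (b w)) := by
      rw [sT_apply, ← hbd]
      congr 2
      · ext x; simp
      · ext x; simp [sa_symm hb]
    rw [pow_succ, ContinuousLinearMap.mul_apply, e1, map_smul, map_add]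
    rw [ContinuousLinearMap.smul_apply, ContinuousLinearMap.add_apply, ih, ih]
    have e2 : (fun z : ℂ => ⟪w, (Wop S k z ^ (n+1)) v⟫_ℂ) = fun z : ℂ =>
        ((1 / (2 * k) : ℝ) : ℂ) • (⟪w, (Wop S k z ^ n) v⟫_ℂ * ((k : ℂ) - z)
          + ⟪b w, (Wop S k z ^ n) v⟫_ℂ) := by
      funext z
      rw [pow_succ', ContinuousLinearMap.mul_apply]
      generalize (Wop S k z ^ n) v = u
      unfold Wop
      rw [← hbd]
      simp only [ContinuousLinearMap.smul_apply, ContinuousLinearMap.add_apply,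
        ContinuousLinearMap.one_apply, inner_smul_right, inner_add_right, sa_symm hb, smul_eq_mul]
      ring
    have c1 := (hcont n w).continuousOn (s := spectrum ℂ S)
    have c2 := (hcont n (b w)).continuousOn (s := spectrum ℂ S)
    have c3 : ContinuousOn (fun z : ℂ => (k : ℂ) - z) (spectrum ℂ S) := by fun_prop
    have c13 : ContinuousOn (fun z : ℂ => ⟪w, (Wop S k z ^ n) v⟫_ℂ * ((k : ℂ) - z))
      (spectrum ℂ S) := c1.mul c3
    have c4 : ContinuousOn (fun z : ℂ => ⟪w, (Wop S k z ^ n) v⟫_ℂ * ((k : ℂ) - z)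
      + ⟪b w, (Wop S k z ^ n) v⟫_ℂ) (spectrum ℂ S) := c13.add c2
    rw [e2, cfc_smul _ _ S c4, cfc_add S _ _ c13 c2, cfc_mul _ _ S c1 c3]
    have e3 : cfc (fun z : ℂ => (k : ℂ) - z) S = b := by
      rw [cfc_sub _ _ S, cfc_const _ S, cfc_id' ℂ S, hbd]
      congr 1
    rw [e3]
    simp

end P4
end Leu
end F4

section F5
open Filter Topology ComplexOrder InnerProductSpace
open scoped ContinuousLinearMap
namespace Leu
section P5
variable {H : Type*} [NormedAddCommGroup H] [InnerProductSpace ℂ H] [CompleteSpace H]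

theorem gam_near {S : H →L[ℂ] H} {c k : ℝ} (hc : 0 < c) (hS : IsSelfAdjoint S)
    (hcS : algebraMap ℝ (H →L[ℂ] H) c ≤ S) (hk : ‖S‖ ≤ k) (hck : c ≤ k) (v : H) (n : ℕ) {x : ℝ}
    (hx : x ∈ spectrum ℝ S) :
    ‖((gam S v x : ℝ) : ℂ) - ((1 / (2 * k) : ℝ) : ℂ) *
      ∑ i ∈ Finset.range n, ⟪v, (Wop S k x ^ i) v⟫_ℂ‖
      ≤ ((k - c) / k) ^ n * (‖v‖ ^ 2 / (2 * c)) := by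
  have hk0 : 0 < k := by linarith
  have hkc : (k : ℂ) ≠ 0 := by exact_mod_cast hk0.ne'
  set ρ := (k - c) / k with hρ
  have hρ0 : 0 ≤ ρ := div_nonneg (by linarith) hk0.le
  have hxc : c ≤ x := (algebraMap_le_iff_le_spectrum (a := S) hS).1 hcS x hx
  have hxk : x ≤ k := (spec_abs hk hx).2
  set W := Wop S k x with hW
  set R := res S x with hR
  have hWn : ‖W‖ ≤ ρ := by
    rw [hW, Wop, norm_smul, Complex.norm_real, Real.norm_eq_abs, abs_of_pos (by positivity)]
    have h1 := norm_sub_le_of_ge hS hcS hk hck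
    have h2 : ‖((k : ℂ) - x) • (1 : H →L[ℂ] H)‖ ≤ k - c := by
      rw [norm_smul, ← Complex.ofReal_sub, Complex.norm_real, Real.norm_eq_abs,
        abs_of_nonneg (by linarith)]
      calc _ ≤ (k - x) * 1 := by
            refine mul_le_mul_of_nonneg_left ContinuousLinearMap.norm_id_le (by linarith)
        _ ≤ _ := by linarith
    calc _ ≤ 1 / (2 * k) * ((k - c) + (k - c)) := by
          gcongr
          exact (norm_add_le _ _).trans (add_le_add h2 h1)
      _ = ρ := by rw [hρ]; field_simp; ring
  have h1W : 1 - W = ((1 / (2 * k) : ℝ) : ℂ) • (algebraMap ℝ (H →L[ℂ] H) x + S) := by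
    rw [hW, Wop, Algebra.algebraMap_eq_smul_one, Algebra.algebraMap_eq_smul_one,
      ← Complex.coe_smul, ← Complex.coe_smul]
    have : (1 : H →L[ℂ] H) = ((1 / (2 * k) : ℝ) : ℂ) • ((2 * (k : ℂ)) • (1 : H →L[ℂ] H)) := by
      rw [smul_smul]; push_cast
      rw [show (1 / (2 * (k:ℂ)) * (2 * k)) = 1 by field_simp, one_smul]
    nth_rewrite 1 [this]
    rw [← smul_sub]
    congr 1
    module
  have h1R : (1 - W) * R = ((1 / (2 * k) : ℝ) : ℂ) • (1 : H →L[ℂ] H) := by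
    rw [h1W, smul_mul_assoc, hR, mul_res hS hcS (by linarith)]
  have hRn : ‖R‖ ≤ 1 / (2 * c) := by
    have e : R = ((1 / (2 * k) : ℝ) : ℂ) • (1 : H →L[ℂ] H) + W * R := by
      rw [← h1R]; noncomm_ring
    have h3 : ‖R‖ ≤ 1 / (2 * k) + ρ * ‖R‖ := by
      calc ‖R‖ = ‖((1 / (2 * k) : ℝ) : ℂ) • (1 : H →L[ℂ] H) + W * R‖ := by rw [← e]
        _ ≤ _ := by
          refine (norm_add_le _ _).trans (add_le_add ?_ ((norm_mul_le _ _).trans (by gcongr)))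
          rw [norm_smul, Complex.norm_real, Real.norm_eq_abs, abs_of_pos (by positivity)]
          calc _ ≤ 1 / (2 * k) * 1 := by gcongr; exact ContinuousLinearMap.norm_id_le
            _ = _ := by ring
    have h4 : ‖R‖ * (1 - ρ) ≤ 1 / (2 * k) := by linarith
    have h5 : 1 - ρ = c / k := by rw [hρ]; field_simp; ring
    rw [h5] at h4
    rw [le_div_iff₀ (by positivity)]
    have h6 : ‖R‖ * (c / k) * (2 * k) ≤ 1 / (2 * k) * (2 * k) := by gcongr
    have h7 : ‖R‖ * (c / k) * (2 * k) = ‖R‖ * (2 * c) := by field_simp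
    have h8 : 1 / (2 * k) * (2 * k) = 1 := by field_simp
    linarith
  have hgeom := geom_sum_mul_neg W n
  have e2 : ((1 / (2 * k) : ℝ) : ℂ) • ∑ i ∈ Finset.range n, W ^ i = R - W ^ n * R := by
    calc _ = (∑ i ∈ Finset.range n, W ^ i) * ((1 - W) * R) := by
          rw [h1R, mul_smul_comm, mul_one]
      _ = _ := by rw [← mul_assoc, hgeom, sub_mul, one_mul]
  have e3 : ((1 / (2 * k) : ℝ) : ℂ) * ∑ i ∈ Finset.range n, ⟪v, (W ^ i) v⟫_ℂ
      = ⟪v, R v⟫_ℂ - ⟪v, (W ^ n * R) v⟫_ℂ := by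
    rw [← inner_sum, ← inner_smul_right, ← inner_sub_right]
    congr 1
    have := congrArg (fun T : H →L[ℂ] H => T v) e2
    simpa using this
  rw [e3, gam_coe hS, ← hR, sub_sub_cancel]
  calc _ ≤ ‖v‖ * ‖(W ^ n * R) v‖ := norm_inner_le_norm _ _
    _ ≤ ‖v‖ * ((ρ ^ n * (1 / (2 * c))) * ‖v‖) := by
        gcongr
        refine (ContinuousLinearMap.le_opNorm _ _).trans ?_
        gcongr
        refine (norm_mul_le _ _).trans ?_
        gcongr
        by_cases hn : n = 0
        · subst hn; simp; exact ContinuousLinearMap.norm_id_le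
        · exact (norm_pow_le' W (Nat.pos_of_ne_zero hn)).trans (by gcongr)
    _ = _ := by ring

theorem sylv_formula {S M : H →L[ℂ] H} {c : ℝ} (hc : 0 < c) (hS : IsSelfAdjoint S)
    (hcS : algebraMap ℝ (H →L[ℂ] H) c ≤ S) {v ℓ : H}
    (hM : S * M + M * S = rankOne ℂ ℓ v) : M v = cfc (gam S v) S ℓ := by
  set k := ‖S‖ + c with hk
  have hkS : ‖S‖ ≤ k := by linarith
  have hck : c ≤ k := by have := norm_nonneg S; linarith
  have hk0 : 0 < k := by linarith
  have hn : IsStarNormal S := hS.isStarNormal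
  set ρ := (k - c) / k with hρ
  have hρ0 : 0 ≤ ρ := div_nonneg (by linarith) hk0.le
  have hρ1 : ρ < 1 := by rw [hρ, div_lt_one hk0]; linarith
  set T := sT S S k with hT
  have hTn : ‖T‖ ≤ ρ := sT_norm hk0 hck hS hS hcS hcS hkS hkS
  set κ : ℂ := ((1 / (2 * k) : ℝ) : ℂ) with hκ
  have h1 : (1 - T) M = κ • rankOne ℂ ℓ v := by rw [sT_eq hk0, hM]
  have hgam : ContinuousOn (fun z : ℂ => ((gam S v z.re : ℝ) : ℂ)) (spectrum ℂ S) := by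
    refine Complex.continuous_ofReal.comp_continuousOn ((gam_cont hS hcS v).comp
      Complex.continuous_re.continuousOn ?_)
    intro z hz
    have hz2 := hS.mem_spectrum_eq_re hz
    rw [hz2] at hz
    have hz3 : z.re ∈ spectrum ℝ S := (spectrum.algebraMap_mem_iff ℂ).1 hz
    have := (algebraMap_le_iff_le_spectrum (a := S) hS).1 hcS _ hz3
    simp only [Set.mem_Ioi]; linarith
  have hcontp : ∀ n, Continuous (fun z : ℂ => κ * ∑ i ∈ Finset.range n, ⟪v, (Wop S k z ^ i) v⟫_ℂ) := by
    intro n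
    unfold Wop
    fun_prop
  have key : ∀ n : ℕ, ‖M v - cfc (gam S v) S ℓ‖ ≤
      ρ ^ n * (‖M‖ * ‖v‖ + ‖v‖ ^ 2 / (2 * c) * ‖ℓ‖) := by
    intro n
    have e1 : M v = cfc (fun z : ℂ => κ * ∑ i ∈ Finset.range n, ⟪v, (Wop S k z ^ i) v⟫_ℂ) S ℓ
        + ((T ^ n) M) v := by
      have h2 := congrArg (fun A : (H →L[ℂ] H) →L[ℂ] (H →L[ℂ] H) => A M v) (geom_sum_mul_neg T n)
      simp only [ContinuousLinearMap.mul_apply, h1, ContinuousLinearMap.sub_apply,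
        ContinuousLinearMap.one_apply, map_smul, ContinuousLinearMap.smul_apply] at h2
      rw [eq_comm, sub_eq_iff_eq_add] at h2
      rw [h2]
      congr 1
      have hc1 : ∀ i ∈ Finset.range n, ContinuousOn (fun z : ℂ => ⟪v, (Wop S k z ^ i) v⟫_ℂ)
          (spectrum ℂ S) := by
        intro i _
        unfold Wop
        fun_prop
      have hc2 : ContinuousOn (fun z : ℂ => ∑ i ∈ Finset.range n, ⟪v, (Wop S k z ^ i) v⟫_ℂ)
          (spectrum ℂ S) := continuousOn_finset_sum _ hc1
      rw [cfc_const_mul κ _ S hc2, ContinuousLinearMap.smul_apply]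
      congr 1
      have := cfc_sum (fun i => fun z : ℂ => ⟪v, (Wop S k z ^ i) v⟫_ℂ) S (Finset.range n) hc1
      have e5 : (fun z : ℂ => ∑ i ∈ Finset.range n, ⟪v, (Wop S k z ^ i) v⟫_ℂ) =
        ∑ i ∈ Finset.range n, (fun z : ℂ => ⟪v, (Wop S k z ^ i) v⟫_ℂ) := by
        funext z; simp
      rw [e5, this]
      simp only [ContinuousLinearMap.sum_apply]
      exact Finset.sum_congr rfl fun i _ => sylv_pow hS k v i ℓ v
    have e2 : cfc (gam S v) S = cfc (fun z : ℂ => ((gam S v z.re : ℝ) : ℂ)) S :=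
      cfc_real_eq_complex _ hS
    have h3 : ‖cfc (fun z : ℂ => κ * ∑ i ∈ Finset.range n, ⟪v, (Wop S k z ^ i) v⟫_ℂ) S
        - cfc (gam S v) S‖ ≤ ρ ^ n * (‖v‖ ^ 2 / (2 * c)) := by
      rw [e2, ← cfc_sub _ _ S (hcontp n).continuousOn hgam]
      refine norm_cfc_le (by positivity) fun z hz => ?_
      have hz2 := hS.mem_spectrum_eq_re hz
      have hz3 : z.re ∈ spectrum ℝ S := by
        rw [hz2] at hz
        exact (spectrum.algebraMap_mem_iff ℂ).1 hz
      rw [norm_sub_rev]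
      have := gam_near hc hS hcS hkS hck v n hz3
      rw [← hz2] at this
      exact this
    have h4 : ‖((T ^ n) M) v‖ ≤ ρ ^ n * (‖M‖ * ‖v‖) := by
      calc _ ≤ ‖(T ^ n) M‖ * ‖v‖ := ContinuousLinearMap.le_opNorm _ _
        _ ≤ (ρ ^ n * ‖M‖) * ‖v‖ := by
          gcongr
          refine (ContinuousLinearMap.le_opNorm _ _).trans ?_
          gcongr
          by_cases hn : n = 0
          · subst hn; simp; exact ContinuousLinearMap.norm_id_le
          · exact (norm_pow_le' T (Nat.pos_of_ne_zero hn)).trans (by gcongr)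
        _ = _ := by ring
    calc _ = ‖(cfc (fun z : ℂ => κ * ∑ i ∈ Finset.range n, ⟪v, (Wop S k z ^ i) v⟫_ℂ) S
        - cfc (gam S v) S) ℓ + ((T ^ n) M) v‖ := by
          rw [e1, ContinuousLinearMap.sub_apply]; congr 1; abel
      _ ≤ (ρ ^ n * (‖v‖ ^ 2 / (2 * c))) * ‖ℓ‖ + ρ ^ n * (‖M‖ * ‖v‖) :=
          (norm_add_le _ _).trans (add_le_add ((ContinuousLinearMap.le_opNorm _ _).trans
            (by gcongr)) h4)
      _ = _ := by ring
  have hlim : Tendsto (fun n : ℕ => ρ ^ n * (‖M‖ * ‖v‖ + ‖v‖ ^ 2 / (2 * c) * ‖ℓ‖)) atTop (𝓝 0) := by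
    simpa using (tendsto_pow_atTop_nhds_zero_of_lt_one hρ0 hρ1).mul_const
      (‖M‖ * ‖v‖ + ‖v‖ ^ 2 / (2 * c) * ‖ℓ‖)
  have := ge_of_tendsto' hlim key
  rw [← sub_eq_zero, ← norm_le_zero_iff]
  exact this

end P5
end Leu
end F5

section F6
open Filter Topology ComplexOrder InnerProductSpace
open scoped ContinuousLinearMap
namespace Leu
section P6
variable {H : Type*} [NormedAddCommGroup H] [InnerProductSpace ℂ H] [CompleteSpace H]

theorem spec_ge {A : H →L[ℂ] H} {c : ℝ} (hA : IsSelfAdjoint A)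
    (hc : algebraMap ℝ (H →L[ℂ] H) c ≤ A) {x : ℝ} (hx : x ∈ spectrum ℝ A) : c ≤ x :=
  (algebraMap_le_iff_le_spectrum (a := A) hA).1 hc x hx

theorem gam_rel {Y S : H →L[ℂ] H} {c ε x : ℝ} {v : H} (hY : IsSelfAdjoint Y) (hS : IsSelfAdjoint S)
    (hcY : algebraMap ℝ (H →L[ℂ] H) c ≤ Y) (hcS : algebraMap ℝ (H →L[ℂ] H) c ≤ S)
    (hYS : Y = S + (ε : ℂ) • rankOne ℂ v v) (hx : 0 < x + c) :
    (1 - ε * gam Y v x) * (1 + ε * gam S v x) = 1 := by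
  have e : res S x - res Y x = res Y x * (Y - S) * res S x := by
    have h1 := res_mul hY hcY hx
    have h2 := mul_res hS hcS hx
    calc res S x - res Y x = (res Y x * (algebraMap ℝ (H →L[ℂ] H) x + Y)) * res S x
          - res Y x * ((algebraMap ℝ (H →L[ℂ] H) x + S) * res S x) := by rw [h1, h2]; simp
      _ = _ := by noncomm_ring
  have e2 : Y - S = (ε : ℂ) • rankOne ℂ v v := by rw [hYS]; simp
  rw [e2] at e
  have e3 := congrArg (fun T : H →L[ℂ] H => ⟪v, T v⟫_ℂ) e
  simp only [ContinuousLinearMap.sub_apply, ContinuousLinearMap.mul_apply,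
    ContinuousLinearMap.smul_apply, rankOne_apply, map_smul, inner_sub_right, inner_smul_right,
    ← gam_coe hY, ← gam_coe hS] at e3
  have e4 : gam S v x - gam Y v x = ε * (gam S v x * gam Y v x) := by exact_mod_cast e3
  linear_combination ε * e4

theorem gam_nonneg {A : H →L[ℂ] H} {c x : ℝ} (hA : IsSelfAdjoint A)
    (hc : algebraMap ℝ (H →L[ℂ] H) c ≤ A) (hx : 0 < x + c) (v : H) : 0 ≤ gam A v x := by
  have h1 := mul_res hA hc hx
  have h2 : 0 ≤ algebraMap ℝ (H →L[ℂ] H) x + A := by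
    have : algebraMap ℝ (H →L[ℂ] H) (x + c) ≤ algebraMap ℝ (H →L[ℂ] H) x + A := by
      rw [map_add]; gcongr
    exact le_trans (algebraMap_nonneg _ hx.le) this
  have h3 := inner_apply_self_nonneg h2 (res A x v)
  rw [← ContinuousLinearMap.mul_apply, h1] at h3
  have h4 := (Complex.nonneg_iff.1 h3).1
  simpa [gam] using h4

theorem rankOne_mul (v w : H) (T : H →L[ℂ] H) :
    rankOne ℂ v w * T = rankOne ℂ v (star T w) := by
  ext x
  simp only [ContinuousLinearMap.mul_apply, rankOne_apply, ContinuousLinearMap.star_eq_adjoint,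
    ContinuousLinearMap.adjoint_inner_left]

theorem mul_rankOne (v w : H) (T : H →L[ℂ] H) :
    T * rankOne ℂ v w = rankOne ℂ (T v) w := by
  ext x
  simp

theorem star_rankOne (v w : H) : star (rankOne ℂ v w : H →L[ℂ] H) = rankOne ℂ w v := by
  rw [ContinuousLinearMap.star_eq_adjoint, adjoint_rankOne]

theorem cauchyA {Y S L : H →L[ℂ] H} {c ε : ℝ} {v : H} (hc : 0 < c) (hY : IsSelfAdjoint Y)
    (hS : IsSelfAdjoint S)
    (hcY : algebraMap ℝ (H →L[ℂ] H) c ≤ Y) (hcS : algebraMap ℝ (H →L[ℂ] H) c ≤ S)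
    (hYS : Y = S + (ε : ℂ) • rankOne ℂ v v) (hL : Y * L + L * S = 1)
    {G : H →L[ℂ] H} (hG : G = cfc (fun x => 2 * x * (1 + ε * gam S v x)) S) :
    G (star L v) = v ∧ L (G v) = v ∧ star (L * G) = L * G := by
  have hgc : ContinuousOn (gam S v) (spectrum ℝ S) :=
    (gam_cont hS hcS v).mono fun x hx => by
      have := spec_ge hS hcS hx
      simp only [Set.mem_Ioi]; linarith
  have hL' : S * star L + star L * Y = 1 := by
    have := congrArg star hL
    simp only [star_add, star_mul, hY.star_eq, hS.star_eq, star_one] at this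
    rw [add_comm]; exact this
  set ℓ := star L v with hℓ
  have h1 : S * star L + star L * S = 1 - (ε : ℂ) • rankOne ℂ ℓ v := by
    rw [hYS, mul_add, mul_smul_comm, mul_rankOne, ← hℓ] at hL'
    rw [← hL']; abel
  obtain ⟨hex, huniq⟩ := sylv hc hS hS hcS hcS
  obtain ⟨M, hM⟩ := hex (rankOne ℂ ℓ v)
  have hMv := sylv_formula hc hS hcS hM
  have hne : ∀ x ∈ spectrum ℝ S, x ≠ 0 := fun x hx => by
    have := spec_ge hS hcS hx; linarith
  have hJc : ContinuousOn (fun x : ℝ => (2 * x)⁻¹) (spectrum ℝ S) :=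
    ContinuousOn.inv₀ (by fun_prop) (fun x hx => by simpa using hne x hx)
  set J := cfc (fun x : ℝ => (2 * x)⁻¹) S with hJ
  have hSJ : (2 : ℝ) • (S * J) = 1 := by
    nth_rewrite 1 [← cfc_id' ℝ S]
    have cx : ContinuousOn (fun x : ℝ => x) (spectrum ℝ S) := continuousOn_id
    have c3 : ContinuousOn (fun x : ℝ => x * (2 * x)⁻¹) (spectrum ℝ S) := cx.mul hJc
    rw [hJ, ← cfc_mul _ _ S cx hJc, ← cfc_smul _ _ S c3]
    have : cfc (fun x : ℝ => (2:ℝ) • (x * (2 * x)⁻¹)) S = cfc (fun x : ℝ => (1:ℝ)) S := by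
      apply cfc_congr
      intro x hx
      have := hne x hx
      simp only [smul_eq_mul]
      field_simp
    rw [this, cfc_const_one ℝ S]
  have hcomm : S * J = J * S := by
    have h := intertw hS hS (T := S) rfl (a := c) (b := ‖S‖) (fun x hx => ⟨spec_ge hS hcS hx, (spec_abs le_rfl hx).2⟩)
      (fun x hx => ⟨spec_ge hS hcS hx, (spec_abs le_rfl hx).2⟩) (f := fun x : ℝ => (2 * x)⁻¹)
      (ContinuousOn.inv₀ (by fun_prop) (fun x hx => by
        have : c ≤ x := hx.1
        have : x ≠ 0 := by linarith
        simpa using this))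
    exact h.symm
  have hSJ1 : S * J + J * S = 1 := by
    rw [← hcomm, ← two_smul ℝ, hSJ]
  have hLJ : star L = J - (ε : ℂ) • M := by
    have := huniq (star L - (J - (ε : ℂ) • M)) (by
      have : S * (star L - (J - (ε : ℂ) • M)) + (star L - (J - (ε : ℂ) • M)) * S
        = (S * star L + star L * S) - (S * J + J * S) + (ε : ℂ) • (S * M + M * S) := by
        simp only [mul_sub, sub_mul, mul_smul_comm, smul_mul_assoc, smul_add]; abel
      rw [this, h1, hSJ1, hM]; abel)
    exact sub_eq_zero.1 this
  have hGe : G = (2 : ℝ) • (S * (1 + ε • cfc (gam S v) S)) := by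
    rw [hG]
    have e1 : cfc (fun x => 2 * x * (1 + ε * gam S v x)) S
        = cfc (fun x => (2:ℝ) • (x * (1 + ε • gam S v x))) S := by
      congr 1; funext x; simp only [smul_eq_mul]; ring
    have c1 : ContinuousOn (fun x => ε • gam S v x) (spectrum ℝ S) := hgc.const_smul ε
    have c2 : ContinuousOn (fun x => 1 + ε • gam S v x) (spectrum ℝ S) := continuousOn_const.add c1
    have cx : ContinuousOn (fun x : ℝ => x) (spectrum ℝ S) := continuousOn_id
    have c3 : ContinuousOn (fun x : ℝ => x * (1 + ε • gam S v x)) (spectrum ℝ S) := cx.mul c2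
    rw [e1, cfc_smul _ _ S c3, cfc_mul _ _ S cx c2,
      cfc_id' ℝ S, cfc_const_add 1 _ S c1, cfc_smul _ _ S hgc, map_one]
  have hGsa : star G = G := by
    rw [hG]; exact (cfc_predicate (fun x => 2 * x * (1 + ε * gam S v x)) S : IsSelfAdjoint _).star_eq
  have hGS : S * G = G * S := by
    have c2 : ContinuousOn (fun x => 2 * x * (1 + ε * gam S v x)) (Set.Icc c ‖S‖) := by
      have := (gam_cont hS hcS v).mono (fun x (hx : x ∈ Set.Icc c ‖S‖) => by
        have := hx.1
        simp only [Set.mem_Ioi]; linarith : Set.Icc c ‖S‖ ⊆ Set.Ioi (-c))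
      fun_prop
    have h := intertw hS hS (T := S) rfl (a := c) (b := ‖S‖)
      (fun x hx => ⟨spec_ge hS hcS hx, (spec_abs le_rfl hx).2⟩)
      (fun x hx => ⟨spec_ge hS hcS hx, (spec_abs le_rfl hx).2⟩) c2
    rw [hG]
    exact h.symm
  have p1 : G ℓ = v := by
    have h5 : ℓ + ε • cfc (gam S v) S ℓ = J v := by
      have := congrArg (fun T : H →L[ℂ] H => T v) hLJ
      simp only [ContinuousLinearMap.sub_apply, ContinuousLinearMap.smul_apply, hMv, ← hℓ] at this
      nth_rewrite 1 [this]
      rw [Complex.coe_smul]; abel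
    have h6 := congrArg (fun T : H →L[ℂ] H => T v) hSJ
    rw [hGe]
    simp only [ContinuousLinearMap.smul_apply, ContinuousLinearMap.mul_apply,
      ContinuousLinearMap.add_apply, ContinuousLinearMap.one_apply] at h6 ⊢
    rw [h5, h6]
  have hTs : star (L * G) v = v := by
    rw [star_mul, hGsa, ContinuousLinearMap.mul_apply, ← hℓ, p1]
  have hT : S * (L * G) + (L * G) * S = G - (ε : ℂ) • rankOne ℂ v v := by
    have h7 : Y * (L * G) + (L * G) * S = G := by
      rw [mul_assoc L G S, ← hGS, ← mul_assoc, ← mul_assoc, ← add_mul, hL, one_mul]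
    rw [hYS, add_mul, smul_mul_assoc, rankOne_mul, hTs] at h7
    rw [eq_sub_iff_add_eq]
    refine Eq.trans ?_ h7
    abel
  have hT2 : S * star (L * G) + star (L * G) * S = G - (ε : ℂ) • rankOne ℂ v v := by
    have := congrArg star hT
    simp only [star_add, star_mul S, star_mul _ S, hS.star_eq, star_sub, hGsa, star_smul, star_rankOne,
      Complex.star_def, Complex.conj_ofReal] at this
    rw [add_comm]; exact this
  have hsaT : star (L * G) = L * G := by
    have := huniq (star (L * G) - L * G) (by
      have : S * (star (L * G) - L * G) + (star (L * G) - L * G) * S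
        = (S * star (L * G) + star (L * G) * S) - (S * (L * G) + (L * G) * S) := by
        simp only [mul_sub, sub_mul]; abel
      rw [this, hT, hT2, sub_self])
    exact sub_eq_zero.1 this
  refine ⟨p1, ?_, hsaT⟩
  rw [← ContinuousLinearMap.mul_apply, ← hsaT, hTs]

end P6
end Leu
end F6

section F7
open Filter Topology ComplexOrder InnerProductSpace
open scoped ContinuousLinearMap
namespace Leu
section P7
variable {H : Type*} [NormedAddCommGroup H] [InnerProductSpace ℂ H] [CompleteSpace H]

theorem cauchyB {Y S L : H →L[ℂ] H} {c ε R : ℝ} {v : H} (hc : 0 < c) (hY : IsSelfAdjoint Y)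
    (hS : IsSelfAdjoint S)
    (hcY : algebraMap ℝ (H →L[ℂ] H) c ≤ Y) (hcS : algebraMap ℝ (H →L[ℂ] H) c ≤ S)
    (hRY : ‖Y‖ ≤ R) (hRS : ‖S‖ ≤ R)
    (hYS : Y = S + (ε : ℂ) • rankOne ℂ v v) (hL : Y * L + L * S = 1) {d1 d2 : ℝ → ℝ}
    (hd1 : ContinuousOn d1 (Set.Icc c R)) (hd2 : ContinuousOn d2 (Set.Icc c R))
    (h1 : ∀ x ∈ Set.Icc c R, d1 x * d1 x = 2 * x * (1 - ε * gam Y v x))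
    (h2 : ∀ x ∈ Set.Icc c R, d2 x * d2 x = 2 * x * (1 + ε * gam S v x))
    (h12 : ∀ x ∈ Set.Icc c R, d1 x * d2 x = 2 * x) :
    (cfc d1 Y * L * cfc d2 S) * star (cfc d1 Y * L * cfc d2 S) = 1 := by
  have sY : spectrum ℝ Y ⊆ Set.Icc c R := fun x hx =>
    ⟨spec_ge hY hcY hx, (spec_abs hRY hx).2⟩
  have sS : spectrum ℝ S ⊆ Set.Icc c R := fun x hx =>
    ⟨spec_ge hS hcS hx, (spec_abs hRS hx).2⟩
  have hL' : S * star L + star L * Y = 1 := by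
    have := congrArg star hL
    simp only [star_add, star_mul, hY.star_eq, hS.star_eq, star_one] at this
    rw [add_comm]; exact this
  have hSY : S = Y + ((-ε : ℝ) : ℂ) • rankOne ℂ v v := by
    rw [hYS]; push_cast; simp
  obtain ⟨-, a2, a3⟩ := cauchyA hc hY hS hcY hcS hYS hL rfl
  obtain ⟨-, b2, b3⟩ := cauchyA hc hS hY hcS hcY hSY hL' rfl
  set D1 := cfc d1 Y with hD1
  set D2 := cfc d2 S with hD2
  have sD1 : star D1 = D1 := (cfc_predicate d1 Y : IsSelfAdjoint _).star_eq
  have sD2 : star D2 = D2 := (cfc_predicate d2 S : IsSelfAdjoint _).star_eq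
  have g1 : cfc (fun x => 2 * x * (1 + (-ε) * gam Y v x)) Y = D1 * D1 := by
    rw [hD1, ← cfc_mul d1 d1 Y (hd1.mono sY) (hd1.mono sY)]
    apply cfc_congr
    intro x hx
    simp only [h1 x (sY hx)]; ring
  have g2 : cfc (fun x => 2 * x * (1 + ε * gam S v x)) S = D2 * D2 := by
    rw [hD2, ← cfc_mul d2 d2 S (hd2.mono sS) (hd2.mono sS)]
    apply cfc_congr
    intro x hx
    simp only [h2 x (sS hx)]
  rw [g2] at a2 a3
  rw [g1] at b2 b3
  set G1 := D1 * D1 with hG1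
  set G2 := D2 * D2 with hG2
  have sG1 : star G1 = G1 := by rw [hG1, star_mul, sD1]
  have sG2 : star G2 = G2 := by rw [hG2, star_mul, sD2]
  have a3' : G2 * star L = L * G2 := by rw [← a3, star_mul, sG2]
  have cY1 : D1 * Y = Y * D1 := intertw hY hY rfl sY sY hd1
  have cS2 : D2 * S = S * D2 := intertw hS hS rfl sS sS hd2
  have cYG : Y * G1 = G1 * Y := by rw [hG1, ← mul_assoc, ← cY1, mul_assoc, ← cY1, mul_assoc]
  have cSG : S * G2 = G2 * S := by rw [hG2, ← mul_assoc, ← cS2, mul_assoc, ← cS2, mul_assoc]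
  set V := D1 * L * D2 with hV
  set F := L * G2 * star L * G1 with hF
  have hYF : Y * F = F * Y := by
    have e1 : Y * L = 1 - L * S := by rw [← hL]; abel
    have e2 : S * star L = 1 - star L * Y := by rw [← hL']; abel
    calc Y * F = (Y * L) * G2 * star L * G1 := by rw [hF]; noncomm_ring
      _ = G2 * star L * G1 - L * (S * G2) * star L * G1 := by rw [e1]; noncomm_ring
      _ = G2 * star L * G1 - L * G2 * (S * star L) * G1 := by rw [cSG]; noncomm_ring
      _ = G2 * star L * G1 - L * G2 * G1 + L * G2 * star L * (Y * G1) := by rw [e2]; noncomm_ring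
      _ = F * Y := by rw [a3', cYG, hF]; noncomm_ring
  have hFv : F v = v := by
    rw [hF]
    simp only [ContinuousLinearMap.mul_apply] at a2 b2 ⊢
    rw [b2, a2]
  have hFV : F = V * star V := by
    have hu : IsUnit D1 := by
      rw [hD1, isUnit_cfc_iff d1 Y (hd1.mono sY)]
      intro x hx h0
      have := h12 x (sY hx)
      rw [h0] at this
      have := (sY hx).1
      linarith
    have e : D1 * F = F * D1 := intertw hY hY hYF sY sY hd1
    apply hu.mul_right_cancel
    rw [← e, hF, hV, hG1, hG2]
    simp only [star_mul, sD1, sD2, mul_assoc]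
  have sF : star F = F := by rw [hFV, star_mul, star_star]
  set E := F - 1 with hE
  have sE : star E = E := by rw [hE, star_sub, sF, star_one]
  have hEv : E v = 0 := by rw [hE]; simp [hFv]
  have hEr : E * rankOne ℂ v v = 0 := by rw [mul_rankOne, hEv]; simp
  have hrE : rankOne ℂ v v * E = 0 := by rw [rankOne_mul, sE, hEv]; simp
  have hYE : Y * E = E * Y := by rw [hE, mul_sub, sub_mul, hYF]; simp
  have hEY : E * Y = E * S := by rw [hYS, mul_add, mul_smul_comm, hEr]; simp
  have hYE' : Y * E = S * E := by rw [hYS, add_mul, smul_mul_assoc, hrE]; simp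
  have hSE : S * E = E * S := by rw [← hYE', hYE, hEY]
  have hEL : E * L = L * E := by
    have := (sylv hc hY hS hcY hcS).2 (E * L - L * E) (by
      calc Y * (E * L - L * E) + (E * L - L * E) * S
          = (Y * E) * L - Y * L * E + E * L * S - L * (E * S) := by noncomm_ring
        _ = E * (Y * L + L * S) - (Y * L + L * S) * E := by rw [hYE, ← hSE]; noncomm_ring
        _ = 0 := by rw [hL]; simp)
    exact sub_eq_zero.1 this
  have k1 : S * (E * L) + E * L * S = E := by
    calc S * (E * L) + E * L * S = (S * E) * L + E * L * S := by noncomm_ring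
      _ = E * S * L + E * L * S := by rw [hSE]
      _ = E * (Y * L + L * S) := by rw [← hEY]; noncomm_ring
      _ = E := by rw [hL, mul_one]
  have k2 : (2:ℂ) • (E * L * S) = E := by
    have := (sylv hc hS hS hcS hcS).2 ((2:ℂ) • (E * L * S) - E) (by
      calc S * ((2:ℂ) • (E * L * S) - E) + ((2:ℂ) • (E * L * S) - E) * S
          = (2:ℂ) • ((S * (E * L) + E * L * S) * S) - S * E - E * S := by
            simp only [mul_sub, sub_mul, mul_smul_comm, smul_mul_assoc, add_mul, smul_add, mul_assoc]
            abel
        _ = 0 := by rw [k1, hSE, two_smul]; abel)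
    exact sub_eq_zero.1 this
  have k3 : S * (E * L) = E * L * S := by
    have : S * (E * L) + E * L * S = (2:ℂ) • (E * L * S) := by rw [k1, k2]
    rw [two_smul] at this
    exact add_right_cancel this
  have k4 : D1 * E = E * cfc d1 S := intertw hY hS (by rw [hYE, hEY]) sY sS hd1
  have k5 : cfc d1 S * (E * L) = E * L * cfc d1 S := intertw hS hS k3 sS sS hd1
  have k6 : cfc d1 S * D2 = (2:ℂ) • S := by
    rw [hD2, ← cfc_mul d1 d2 S (hd1.mono sS) (hd2.mono sS)]
    have : cfc (fun x => d1 x * d2 x) S = cfc (fun x : ℝ => (2:ℝ) • x) S :=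
      cfc_congr fun x hx => by simp only [h12 x (sS hx), smul_eq_mul]
    have cx : ContinuousOn (fun x : ℝ => x) (spectrum ℝ S) := continuousOn_id
    rw [this, cfc_smul _ _ S cx, cfc_id' ℝ S, two_smul, two_smul]
  have k7 : D1 * E = E * D1 := intertw hY hY hYE sY sY hd1
  have k8 : D2 * E = E * D2 := intertw hS hS hSE sS sS hd2
  have k9 : cfc d1 S * E = E * cfc d1 S := intertw hS hS hSE sS sS hd1
  have hEV : E * V = E := by
    calc E * V = (E * D1) * L * D2 := by rw [hV]; noncomm_ring
      _ = cfc d1 S * (E * L) * D2 := by rw [← k7, k4, ← k9]; noncomm_ring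
      _ = E * L * (cfc d1 S * D2) := by rw [k5]; noncomm_ring
      _ = E := by rw [k6, mul_smul_comm, k2]
  have hVE : V * E = E := by
    calc V * E = D1 * L * (D2 * E) := by rw [hV]; noncomm_ring
      _ = D1 * (L * E) * D2 := by rw [k8]; noncomm_ring
      _ = (D1 * E) * L * D2 := by rw [← hEL]; noncomm_ring
      _ = E * V := by rw [k7, hV]; noncomm_ring
      _ = E := hEV
  have hEVs : E * star V = E := by
    have := congrArg star hVE
    rwa [star_mul, sE] at this
  have hEE : star E * E = 0 := by
    rw [sE]
    have : E * F = E := by rw [hFV, ← mul_assoc, hEV, hEVs]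
    have h : E * F = E + E * E := by
      rw [show F = 1 + E by rw [hE]; abel, mul_add, mul_one]
    rw [this] at h
    exact left_eq_add.1 h
  have hE0 : E = 0 := CStarRing.star_mul_self_eq_zero_iff E |>.1 hEE
  rw [← hFV]
  exact sub_eq_zero.1 (hE ▸ hE0)

end P7
end Leu
end F7

section F8
open Filter Topology ComplexOrder InnerProductSpace
open scoped ContinuousLinearMap
namespace Leu
section P8
variable {H : Type*} [NormedAddCommGroup H] [InnerProductSpace ℂ H] [CompleteSpace H]

theorem m2 {Y S : H →L[ℂ] H} {c R : ℝ} {v : H} (hc : 0 < c) (hY : IsSelfAdjoint Y)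
    (hS : IsSelfAdjoint S)
    (hcY : algebraMap ℝ (H →L[ℂ] H) c ≤ Y) (hcS : algebraMap ℝ (H →L[ℂ] H) c ≤ S)
    (hRY : ‖Y‖ ≤ R) (hRS : ‖S‖ ≤ R)
    (hYS : Y = S + rankOne ℂ v v) {d1 d2 : ℝ → ℝ}
    (hd1 : ContinuousOn d1 (Set.Icc c R)) (hd2 : ContinuousOn d2 (Set.Icc c R))
    (h1 : ∀ x ∈ Set.Icc c R, d1 x * d1 x = 2 * x * (1 - gam Y v x))
    (h2 : ∀ x ∈ Set.Icc c R, d2 x * d2 x = 2 * x * (1 + gam S v x))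
    (h12 : ∀ x ∈ Set.Icc c R, d1 x * d2 x = 2 * x) {Z : H →L[ℂ] H} (hZ : Z = cfc d1 Y * cfc d2 S) :
    ∃ P : H →L[ℂ] H, 0 ≤ P ∧ P * P = star Z * Z ∧ S * S ≤ (P - S) * (P - S) ∧
      P * (P - S) * P = star Z * Y * Z := by
  obtain ⟨L, hL⟩ := (sylv hc hY hS hcY hcS).1 1
  have hL' : S * star L + star L * Y = 1 := by
    have := congrArg star hL
    simp only [star_add, star_mul, hY.star_eq, hS.star_eq, star_one] at this
    rw [add_comm]; exact this
  have hYS1 : Y = S + ((1:ℝ):ℂ) • rankOne ℂ v v := by simpa using hYS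
  have hSY1 : S = Y + ((-1:ℝ):ℂ) • rankOne ℂ v v := by rw [hYS]; simp
  have u1 := cauchyB hc hY hS hcY hcS hRY hRS hYS1 hL hd1 hd2 (by simpa using h1) (by simpa using h2) h12
  have u2 := cauchyB hc hS hY hcS hcY hRS hRY hSY1 hL' hd2 hd1
    (by simpa using h2) (fun x hx => by rw [h1 x hx]; ring)
    (fun x hx => by rw [mul_comm]; exact h12 x hx)
  obtain ⟨-, a2, -⟩ := cauchyA hc hY hS hcY hcS hYS1 hL rfl
  have sY : spectrum ℝ Y ⊆ Set.Icc c R := fun x hx =>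
    ⟨spec_ge hY hcY hx, (spec_abs hRY hx).2⟩
  have sS : spectrum ℝ S ⊆ Set.Icc c R := fun x hx =>
    ⟨spec_ge hS hcS hx, (spec_abs hRS hx).2⟩
  have g2 : cfc (fun x => 2 * x * (1 + (1:ℝ) * gam S v x)) S = cfc d2 S * cfc d2 S := by
    rw [← cfc_mul d2 d2 S (hd2.mono sS) (hd2.mono sS)]
    apply cfc_congr
    intro x hx
    simp only [h2 x (sS hx)]; ring
  rw [g2] at a2
  have cY1 : cfc d1 Y * Y = Y * cfc d1 Y := intertw hY hY rfl sY sY hd1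
  have cS2 : cfc d2 S * S = S * cfc d2 S := intertw hS hS rfl sS sS hd2
  have sD1 : star (cfc d1 Y) = cfc d1 Y := (cfc_predicate d1 Y : IsSelfAdjoint _).star_eq
  have sD2 : star (cfc d2 S) = cfc d2 S := (cfc_predicate d2 S : IsSelfAdjoint _).star_eq
  set D1 := cfc d1 Y
  set D2 := cfc d2 S
  set V := D1 * L * D2 with hV
  have hVs : D2 * star L * D1 = star V := by
    rw [hV]; simp only [star_mul, sD1, sD2, mul_assoc]
  rw [hVs, star_star] at u2
  have hYV : Y * V + V * S = Z := by
    calc Y * V + V * S = (Y * D1) * L * D2 + D1 * L * (D2 * S) := by rw [hV]; noncomm_ring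
      _ = D1 * (Y * L + L * S) * D2 := by rw [← cY1, cS2]; noncomm_ring
      _ = Z := by rw [hL, hZ, mul_one]
  have hVv : V (D2 v) = D1 v := by
    rw [hV]
    simp only [ContinuousLinearMap.mul_apply] at a2 ⊢
    rw [a2]
  have hVv' : star V (D1 v) = D2 v := by
    rw [← hVv, ← ContinuousLinearMap.mul_apply, u2, ContinuousLinearMap.one_apply]
  have hY2 : Y * Y * V = V * S * S + rankOne ℂ (D1 v) (D2 v) := by
    have e : Y * Z - Z * S = rankOne ℂ (D1 v) (D2 v) := by
      calc Y * Z - Z * S = (Y * D1) * D2 - D1 * (D2 * S) := by rw [hZ]; noncomm_ring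
        _ = D1 * (Y - S) * D2 := by rw [← cY1, cS2]; noncomm_ring
        _ = D1 * rankOne ℂ v v * D2 := by rw [hYS]; simp
        _ = _ := by rw [mul_rankOne, rankOne_mul, sD2]
    rw [← e, ← hYV]; noncomm_ring
  have hP : star V * Z = star V * Y * V + S := by
    rw [← hYV, mul_add, ← mul_assoc, ← mul_assoc (star V) V S, u2, one_mul]
  have hS0 : 0 ≤ S := le_trans (algebraMap_nonneg _ hc.le) hcS
  have hY0 : 0 ≤ Y := le_trans (algebraMap_nonneg _ hc.le) hcY
  have hP0 : 0 ≤ star V * Y * V + S := add_nonneg (star_left_conjugate_nonneg hY0 V) hS0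
  have hPsa : star (star V * Z) = star V * Z := by
    rw [hP]; exact (IsSelfAdjoint.of_nonneg hP0).star_eq
  have hPS : star V * Z - S = star V * Y * V := by rw [hP]; abel
  refine ⟨star V * Z, hP ▸ hP0, ?_, ?_, ?_⟩
  · nth_rewrite 1 [← hPsa]
    rw [star_mul, star_star]
    calc star Z * V * (star V * Z) = star Z * (V * star V) * Z := by noncomm_ring
      _ = _ := by rw [u1, mul_one]
  · rw [hPS]
    have : star V * Y * V * (star V * Y * V) = S * S + rankOne ℂ (D2 v) (D2 v) := by
      calc star V * Y * V * (star V * Y * V) = star V * Y * (V * star V) * Y * V := by noncomm_ring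
        _ = star V * (Y * Y * V) := by rw [u1]; noncomm_ring
        _ = (star V * V) * S * S + star V * rankOne ℂ (D1 v) (D2 v) := by rw [hY2]; noncomm_ring
        _ = _ := by rw [u2, mul_rankOne, hVv', one_mul]
    rw [this]
    refine le_add_of_nonneg_right ?_
    rw [ContinuousLinearMap.nonneg_iff_isPositive]
    exact isPositive_rankOne_self _
  · rw [hPS]
    nth_rewrite 1 [← hPsa]
    rw [star_mul, star_star]
    calc star Z * V * (star V * Y * V) * (star V * Z)
        = star Z * (V * star V) * Y * (V * star V) * Z := by noncomm_ring
      _ = _ := by rw [u1]; noncomm_ring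

noncomputable def chi (Y : H →L[ℂ] H) (e : H) (x : ℝ) : ℝ := ‖e‖ ^ 2 - x * gam Y e x

theorem res_eq_cfc {Y : H →L[ℂ] H} (hY : 0 ≤ Y) {x : ℝ} (hx : 0 < x) :
    res Y x = cfc (fun y : ℝ => (x + y)⁻¹) Y := by
  have hsa := IsSelfAdjoint.of_nonneg hY
  have h0 : algebraMap ℝ (H →L[ℂ] H) 0 ≤ Y := by simpa using hY
  have h1 := res_mul hsa h0 (x := x) (by linarith)
  have hp : ∀ y ∈ spectrum ℝ Y, x + y ≠ 0 := fun y hy => by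
    have := spectrum_nonneg_of_nonneg hY hy; linarith
  have c1 : ContinuousOn (fun y : ℝ => x + y) (spectrum ℝ Y) := by fun_prop
  have c2 : ContinuousOn (fun y : ℝ => (x + y)⁻¹) (spectrum ℝ Y) := c1.inv₀ hp
  have cx : ContinuousOn (fun x : ℝ => x) (spectrum ℝ Y) := continuousOn_id
  have h2 : (algebraMap ℝ (H →L[ℂ] H) x + Y) * cfc (fun y : ℝ => (x + y)⁻¹) Y = 1 := by
    have : algebraMap ℝ (H →L[ℂ] H) x + Y = cfc (fun y : ℝ => x + y) Y := by
      rw [cfc_const_add x _ Y cx, cfc_id' ℝ Y]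
    rw [this, ← cfc_mul _ _ Y c1 c2, ← cfc_const_one ℝ Y]
    exact cfc_congr fun y hy => by simp [mul_inv_cancel₀ (hp y hy)]
  calc res Y x = res Y x * ((algebraMap ℝ (H →L[ℂ] H) x + Y) * cfc (fun y : ℝ => (x + y)⁻¹) Y) := by
        rw [h2, mul_one]
    _ = _ := by rw [← mul_assoc, h1, one_mul]

theorem chi_eq {Y : H →L[ℂ] H} (hY : 0 ≤ Y) (e : H) {x : ℝ} (hx : 0 < x) :
    chi Y e x = (⟪e, cfc (fun y : ℝ => y / (x + y)) Y e⟫_ℂ).re := by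
  have hsa := IsSelfAdjoint.of_nonneg hY
  have hp : ∀ y ∈ spectrum ℝ Y, x + y ≠ 0 := fun y hy => by
    have := spectrum_nonneg_of_nonneg hY hy; linarith
  have c1 : ContinuousOn (fun y : ℝ => x + y) (spectrum ℝ Y) := by fun_prop
  have c2 : ContinuousOn (fun y : ℝ => (x + y)⁻¹) (spectrum ℝ Y) := c1.inv₀ hp
  have c3 : ContinuousOn (fun y : ℝ => x • (x + y)⁻¹) (spectrum ℝ Y) := c2.const_smul x
  have c4 : ContinuousOn (fun y : ℝ => (1:ℝ)) (spectrum ℝ Y) := continuousOn_const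
  have : cfc (fun y : ℝ => y / (x + y)) Y = 1 - x • res Y x := by
    rw [res_eq_cfc hY hx, ← cfc_smul _ _ Y c2, ← cfc_const_one ℝ Y, ← cfc_sub _ _ Y c4 c3]
    exact cfc_congr fun y hy => by
      have := hp y hy
      simp only [smul_eq_mul]; field_simp; ring
  rw [this]
  unfold chi gam
  simp only [ContinuousLinearMap.sub_apply, ContinuousLinearMap.one_apply,
    ContinuousLinearMap.smul_apply, inner_sub_right, Complex.sub_re]
  congr 1
  · rw [inner_self_eq_norm_sq_to_K]; norm_cast
  · rw [← Complex.coe_smul, inner_smul_right]; simp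

theorem cfc_inner_mono {Y : H →L[ℂ] H} {a b : ℝ → ℝ} (ha : ContinuousOn a (spectrum ℝ Y))
    (hb : ContinuousOn b (spectrum ℝ Y)) (h : ∀ y ∈ spectrum ℝ Y, a y ≤ b y) (e : H) :
    (⟪e, cfc a Y e⟫_ℂ).re ≤ (⟪e, cfc b Y e⟫_ℂ).re := by
  have h1 := (le_iff_re (cfc_predicate a Y : IsSelfAdjoint _) (cfc_predicate b Y : IsSelfAdjoint _)).1 (cfc_mono h ha hb) e
  rw [← inner_conj_symm, Complex.conj_re, ← inner_conj_symm e, Complex.conj_re]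
  exact h1

theorem div_cont {Y : H →L[ℂ] H} (hY : 0 ≤ Y) {x : ℝ} (hx : 0 < x) :
    ContinuousOn (fun y : ℝ => y / (x + y)) (spectrum ℝ Y) :=
  ContinuousOn.div (by fun_prop) (by fun_prop) fun y hy => by
    have := spectrum_nonneg_of_nonneg hY hy; linarith

theorem gam_nn {Y : H →L[ℂ] H} (hY : 0 ≤ Y) (e : H) {x : ℝ} (hx : 0 < x) : 0 ≤ gam Y e x :=
  gam_nonneg (c := 0) (IsSelfAdjoint.of_nonneg hY) (by simpa using hY) (by linarith) e

theorem chi_le {Y : H →L[ℂ] H} (hY : 0 ≤ Y) (e : H) {x : ℝ} (hx : 0 ≤ x) :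
    chi Y e x ≤ ‖e‖ ^ 2 := by
  unfold chi
  rcases hx.eq_or_lt with rfl | hx
  · simp
  · have := mul_nonneg hx.le (gam_nn hY e hx); linarith

theorem chi_zero (Y : H →L[ℂ] H) (e : H) : chi Y e 0 = ‖e‖ ^ 2 := by simp [chi]

theorem chi_anti {Y : H →L[ℂ] H} (hY : 0 ≤ Y) (e : H) {x x' : ℝ} (hx : 0 ≤ x) (h : x ≤ x') :
    chi Y e x' ≤ chi Y e x := by
  rcases hx.eq_or_lt with rfl | hx
  · rw [chi_zero]; exact chi_le hY e h
  · have hx' : 0 < x' := by linarith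
    rw [chi_eq hY e hx, chi_eq hY e hx']
    refine cfc_inner_mono (div_cont hY hx') (div_cont hY hx) (fun y hy => ?_) e
    have := spectrum_nonneg_of_nonneg hY hy
    gcongr

theorem xchi_eq {Y : H →L[ℂ] H} (hY : 0 ≤ Y) (e : H) {x : ℝ} (hx : 0 < x) :
    x * chi Y e x = (⟪e, cfc (fun y : ℝ => x * (y / (x + y))) Y e⟫_ℂ).re := by
  rw [chi_eq hY e hx, cfc_const_mul _ _ Y (div_cont hY hx), ContinuousLinearMap.smul_apply,
    ← Complex.coe_smul, inner_smul_right]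
  simp

theorem xchi_mono {Y : H →L[ℂ] H} (hY : 0 ≤ Y) (e : H) {x x' : ℝ} (hx : 0 ≤ x) (h : x ≤ x') :
    x * chi Y e x ≤ x' * chi Y e x' := by
  have key : ∀ x x' : ℝ, 0 < x → x ≤ x' → x * chi Y e x ≤ x' * chi Y e x' := by
    intro x x' hx h
    have hx' : 0 < x' := by linarith
    rw [xchi_eq hY e hx, xchi_eq hY e hx']
    refine cfc_inner_mono ((div_cont hY hx).const_smul x) ((div_cont hY hx').const_smul x') (fun y hy => ?_) e
    have := spectrum_nonneg_of_nonneg hY hy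
    change x * (y / (x + y)) ≤ x' * (y / (x' + y))
    rw [← mul_div_assoc, ← mul_div_assoc, div_le_div_iff₀ (by linarith) (by linarith)]
    nlinarith [mul_nonneg (mul_nonneg this this) (sub_nonneg.2 h)]
  rcases hx.eq_or_lt with rfl | hx
  · rcases h.eq_or_lt with rfl | h
    · simp
    · rw [zero_mul]
      refine mul_nonneg h.le ?_
      rw [chi_eq hY e h]
      have h0 := cfc_inner_mono (a := fun _ => 0) continuousOn_const (div_cont hY h) (fun y hy => by
        have := spectrum_nonneg_of_nonneg hY hy
        positivity) e
      rw [cfc_const_zero] at h0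
      simpa using h0
  · exact key x x' hx h

theorem chi_ge {Y : H →L[ℂ] H} (hY : 0 ≤ Y) {e : H} (he : (⟪e, Y e⟫_ℂ).re = 1) {x R : ℝ}
    (hx : 0 ≤ x) (hR : ‖Y‖ ≤ R) : 1 ≤ (x + R) * chi Y e x := by
  rcases hx.eq_or_lt with rfl | hx
  · rw [chi_zero, zero_add, ← he]
    have h1 : (⟪e, Y e⟫_ℂ).re ≤ ‖e‖ * ‖Y e‖ := (Complex.re_le_norm _).trans (norm_inner_le_norm _ _)
    have h2 := Y.le_opNorm e
    have h3 := norm_nonneg e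
    nlinarith [mul_le_mul_of_nonneg_left h2 h3, mul_le_mul_of_nonneg_right hR (mul_nonneg h3 h3)]
  · have hRx : 0 < x + R := by have := norm_nonneg Y; linarith
    have hsa := IsSelfAdjoint.of_nonneg hY
    have c2 : ContinuousOn (fun y : ℝ => y) (spectrum ℝ Y) := continuousOn_id
    have h := cfc_inner_mono (Y := Y) (a := fun y => y) (b := fun y => (x + R) * (y / (x + y))) c2
      ((div_cont hY hx).const_smul (x + R)) (fun y hy => by
        have h1 := spec_Icc hY hR hy
        have h2 := h1.1
        have h3 := h1.2
        rw [← mul_div_assoc, le_div_iff₀ (by linarith)]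
        nlinarith) e
    rw [cfc_id' ℝ Y, he, cfc_const_mul _ _ Y (div_cont hY hx), ContinuousLinearMap.smul_apply,
      ← Complex.coe_smul, inner_smul_right] at h
    rw [chi_eq hY e hx]
    simpa using h

theorem gam_chi {Y : H →L[ℂ] H} (hY : 0 ≤ Y) {e : H} (he : (⟪e, Y e⟫_ℂ).re = 1) {x : ℝ}
    (hx : 0 < x) : gam Y (Y e) x = 1 - x * chi Y e x := by
  have hsa := IsSelfAdjoint.of_nonneg hY
  rw [chi_eq hY e hx, ← he, gam]
  have h0 : algebraMap ℝ (H →L[ℂ] H) 0 ≤ Y := by simpa using hY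
  have h1 := res_mul hsa h0 (x := x) (by linarith)
  have h2 := mul_res hsa h0 (x := x) (by linarith)
  have cx : ContinuousOn (fun x : ℝ => x) (spectrum ℝ Y) := continuousOn_id
  have hp : ∀ y ∈ spectrum ℝ Y, x + y ≠ 0 := fun y hy => by
    have := spectrum_nonneg_of_nonneg hY hy; linarith
  have c1 : ContinuousOn (fun y : ℝ => x + y) (spectrum ℝ Y) := by fun_prop
  have c2 : ContinuousOn (fun y : ℝ => (x + y)⁻¹) (spectrum ℝ Y) := c1.inv₀ hp
  have h3 : cfc (fun y : ℝ => y / (x + y)) Y = res Y x * Y := by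
    rw [res_eq_cfc hY hx]
    nth_rewrite 3 [← cfc_id' ℝ Y]
    rw [← cfc_mul _ _ Y c2 cx]
    exact cfc_congr fun y hy => div_eq_inv_mul _ _
  have h4 : Y * res Y x * Y = Y - x • (res Y x * Y) := by
    have : Y * res Y x = 1 - x • res Y x := by
      rw [← h2, add_mul, Algebra.algebraMap_eq_smul_one, smul_mul_assoc, one_mul]; abel
    rw [this, sub_mul, one_mul, smul_mul_assoc]
  rw [h3, sa_symm hsa]
  have h5 : Y (res Y x (Y e)) = Y e - x • ((res Y x * Y) e) := by
    have := congrArg (fun T : H →L[ℂ] H => T e) h4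
    simpa using this
  rw [h5, inner_sub_right, ← Complex.coe_smul, inner_smul_right]
  simp

theorem chi_cont {Y : H →L[ℂ] H} (hY : 0 ≤ Y) {e : H} (hk : ∀ k, Y k = 0 → ⟪k, e⟫_ℂ = 0) :
    ContinuousOn (chi Y e) (Set.Ici 0) := by
  have hsa := IsSelfAdjoint.of_nonneg hY
  have h0 : algebraMap ℝ (H →L[ℂ] H) 0 ≤ Y := by simpa using hY
  have hg := gam_cont hsa h0 e
  intro x hx
  rcases (show (0:ℝ) ≤ x from hx).eq_or_lt with rfl | hx
  · have hcl : e ∈ closure (Set.range Y) := by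
      have h1 : (Y.toLinearMap.range)ᗮ = Y.toLinearMap.ker := by
        ext k
        rw [Submodule.mem_orthogonal, LinearMap.mem_ker]
        constructor
        · intro h
          have := h (Y (Y k)) ⟨Y k, rfl⟩
          rw [sa_symm hsa] at this
          exact inner_self_eq_zero.1 this
        · rintro h u ⟨w, rfl⟩
          have h' : Y k = 0 := h
          simp [sa_symm hsa, h']
      have h2 : e ∈ (Y.toLinearMap.range)ᗮᗮ := by
        rw [h1, Submodule.mem_orthogonal]
        exact fun u hu => hk u hu
      rw [Submodule.orthogonal_orthogonal_eq_closure] at h2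
      exact h2
    have hb : ∀ x : ℝ, 0 < x → ‖x • res Y x‖ ≤ 1 ∧ ‖res Y x * Y‖ ≤ 1 := by
      intro x hx
      have hp : ∀ y ∈ spectrum ℝ Y, 0 < x + y := fun y hy => by
        have := spectrum_nonneg_of_nonneg hY hy; linarith
      have c1 : ContinuousOn (fun y : ℝ => x + y) (spectrum ℝ Y) := by fun_prop
      have c2 : ContinuousOn (fun y : ℝ => (x + y)⁻¹) (spectrum ℝ Y) := c1.inv₀ fun y hy => (hp y hy).ne'
      have cx : ContinuousOn (fun x : ℝ => x) (spectrum ℝ Y) := continuousOn_id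
      rw [res_eq_cfc hY hx]
      constructor
      · rw [← cfc_smul _ _ Y c2]
        refine norm_cfc_le zero_le_one fun y hy => ?_
        have := hp y hy
        have h3 := spectrum_nonneg_of_nonneg hY hy
        rw [smul_eq_mul, Real.norm_eq_abs, abs_of_nonneg (by positivity), ← div_eq_mul_inv, div_le_one this]
        linarith
      · nth_rewrite 2 [← cfc_id' ℝ Y]
        rw [← cfc_mul _ _ Y c2 cx]
        refine norm_cfc_le zero_le_one fun y hy => ?_
        have := hp y hy
        have h3 := spectrum_nonneg_of_nonneg hY hy
        rw [Real.norm_eq_abs, abs_of_nonneg (by positivity), ← div_eq_inv_mul, div_le_one this]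
        linarith
    rw [Metric.continuousWithinAt_iff]
    intro ε hε
    have hε' : 0 < ε / (2 * (‖e‖ + 1)) := by positivity
    obtain ⟨_, ⟨ζ, rfl⟩, hζ⟩ := Metric.mem_closure_iff.1 hcl _ hε'
    refine ⟨ε / (2 * (‖e‖ + 1) * (‖ζ‖ + 1)), by positivity, ?_⟩
    intro x hx hxd
    rcases (show (0:ℝ) ≤ x from hx).eq_or_lt with rfl | hx
    · simpa using hε
    have : dist (chi Y e x) (chi Y e 0) = x * gam Y e x := by
      rw [Real.dist_eq, chi_zero, chi]
      rw [show ‖e‖ ^ 2 - x * gam Y e x - ‖e‖ ^ 2 = -(x * gam Y e x) by ring, abs_neg,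
        abs_of_nonneg (mul_nonneg hx.le (gam_nn hY e hx))]
    rw [this]
    rw [Real.dist_eq, sub_zero, abs_of_pos hx] at hxd
    have e1 : x * gam Y e x = (⟪e, (x • res Y x) e⟫_ℂ).re := by
      rw [gam, ContinuousLinearMap.smul_apply, ← Complex.coe_smul, inner_smul_right]; simp
    have e2 : (x • res Y x) e = (x • res Y x) (e - Y ζ) + x • (res Y x * Y) ζ := by
      rw [map_sub]; simp
    obtain ⟨b1, b2⟩ := hb x hx
    have e3 : ‖(x • res Y x) e‖ ≤ ‖e - Y ζ‖ + x * ‖ζ‖ := by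
      rw [e2]
      refine (norm_add_le _ _).trans (add_le_add ?_ ?_)
      · exact ((x • res Y x).le_opNorm _).trans (by nlinarith [norm_nonneg (e - Y ζ)])
      · rw [norm_smul, Real.norm_eq_abs, abs_of_pos hx]
        have := ((res Y x * Y).le_opNorm ζ).trans (by nlinarith [norm_nonneg ζ] : _ ≤ ‖ζ‖)
        gcongr
    have e4 : x * gam Y e x ≤ ‖e‖ * (‖e - Y ζ‖ + x * ‖ζ‖) := by
      rw [e1]
      exact (Complex.re_le_norm _).trans ((norm_inner_le_norm _ _).trans
        (mul_le_mul_of_nonneg_left e3 (norm_nonneg e)))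
    rw [dist_eq_norm, lt_div_iff₀ (by positivity)] at hζ
    rw [lt_div_iff₀ (by positivity)] at hxd
    have n1 := norm_nonneg e
    have n2 := norm_nonneg ζ
    have n3 := norm_nonneg (e - Y ζ)
    nlinarith [mul_nonneg hx.le n1, mul_nonneg hx.le n2, mul_nonneg (mul_nonneg hx.le n1) n2]
  · have : ContinuousAt (chi Y e) x := by
      have : ContinuousAt (gam Y e) x := hg.continuousAt (by simpa using Ioi_mem_nhds hx)
      unfold chi
      fun_prop
    exact this.continuousWithinAt

end P8
end Leu
end F8

section F9
open Filter Topology ComplexOrder InnerProductSpace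
open scoped ContinuousLinearMap
namespace Leu
section P9
variable {H : Type*} [NormedAddCommGroup H] [InnerProductSpace ℂ H] [CompleteSpace H]

theorem cfc_tendsto_joint (A : H →L[ℂ] H) (F : ℝ → ℝ → ℝ) (hF : Continuous (Function.uncurry F)) :
    Tendsto (fun δ => cfc (F δ) A) (𝓝 0) (𝓝 (cfc (F 0) A)) := by
  let G : C(ℝ × ℝ, ℝ) := ⟨Function.uncurry F, hF⟩
  have h1 : Tendsto G.curry (𝓝 0) (𝓝 (G.curry 0)) := G.curry.continuous.tendsto 0
  rw [ContinuousMap.tendsto_iff_forall_isCompact_tendstoUniformlyOn] at h1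
  have h2 := h1 (spectrum ℝ A) (ContinuousFunctionalCalculus.isCompact_spectrum A)
  refine tendsto_cfc_fun (F := F) (f := F 0) h2 (Eventually.of_forall fun δ => ?_)
  exact (hF.comp (Continuous.prodMk_right δ)).continuousOn

theorem st_bdd {A : ℕ → H →L[ℂ] H} {A0 : H →L[ℂ] H}
    (hA : ∀ x, Tendsto (fun i => A i x) atTop (𝓝 (A0 x))) : ∃ C, ∀ i, ‖A i‖ ≤ C := by
  refine banach_steinhaus fun x => ?_
  obtain ⟨C, hC⟩ := (hA x).norm.bddAbove_range
  exact ⟨C, fun i => hC ⟨i, rfl⟩⟩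

theorem cfc_ker {S : H →L[ℂ] H} (hS : IsSelfAdjoint S) {f : ℝ → ℝ}
    (hf : Continuous f) {x : H} (hx : S x = 0) : cfc f S x = f 0 • x := by
  by_cases hx0 : x = 0
  · simp [hx0]
  have h := intertw (Y := S) (S := 0) (T := rankOne ℂ x x) hS (IsSelfAdjoint.zero _)
    (by rw [mul_rankOne, hx]; simp) (a := -‖S‖) (b := ‖S‖) (fun x hx => spec_abs le_rfl hx)
    (fun y hy => spec_abs (by simp) hy) (f := f) hf.continuousOn
  have h2 := congrArg (fun T : H →L[ℂ] H => T x) h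
  rw [cfc_apply_zero] at h2
  simp only [ContinuousLinearMap.mul_apply, rankOne_apply, map_smul,
    Algebra.algebraMap_eq_smul_one, ContinuousLinearMap.smul_apply, ContinuousLinearMap.one_apply] at h2
  have h3 : ⟪x, x⟫_ℂ ≠ 0 := by simpa using hx0
  rw [← Complex.coe_smul, inner_smul_right, mul_smul, smul_comm] at h2
  have := smul_right_injective H h3 h2
  rw [this, Complex.coe_smul]

theorem cfc_shift {A : H →L[ℂ] H} (hA : IsSelfAdjoint A) (δ : ℝ) {f : ℝ → ℝ} (hf : ContinuousOn f (Set.image (fun y => y + δ) (spectrum ℝ A))) :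
    cfc f (A + algebraMap ℝ (H →L[ℂ] H) δ) = cfc (fun y => f (y + δ)) A := by
  have cx : ContinuousOn (fun x : ℝ => x) (spectrum ℝ A) := continuousOn_id
  have c1 : ContinuousOn (fun x : ℝ => x + δ) (spectrum ℝ A) := by fun_prop
  have : A + algebraMap ℝ (H →L[ℂ] H) δ = cfc (fun y => y + δ) A := by
    rw [cfc_add_const δ _ A cx, cfc_id' ℝ A]
  rw [this, ← cfc_comp' f (fun y => y + δ) A hf c1]

theorem gam_shift (A : H →L[ℂ] H) (δ x : ℝ) (v : H) :
    gam (A + algebraMap ℝ (H →L[ℂ] H) δ) v x = gam A v (x + δ) := by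
  unfold gam res
  rw [map_add]
  have : algebraMap ℝ (H →L[ℂ] H) x + (A + algebraMap ℝ (H →L[ℂ] H) δ)
    = algebraMap ℝ (H →L[ℂ] H) x + algebraMap ℝ (H →L[ℂ] H) δ + A := by abel
  rw [this]

theorem polar_limit {Y S Z : H →L[ℂ] H} (hY : IsSelfAdjoint Y) (hS : IsSelfAdjoint S)
    {Yn Sn Zn Pn : ℕ → H →L[ℂ] H}
    (lY : ∀ x, Tendsto (fun n => Yn n x) atTop (𝓝 (Y x)))
    (lS : ∀ x, Tendsto (fun n => Sn n x) atTop (𝓝 (S x)))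
    (lZ : ∀ x, Tendsto (fun n => Zn n x) atTop (𝓝 (Z x)))
    (lZs : ∀ x, Tendsto (fun n => star (Zn n) x) atTop (𝓝 (star Z x)))
    (sSn : ∀ n, IsSelfAdjoint (Sn n))
    (hP0 : ∀ n, 0 ≤ Pn n) (hP2 : ∀ n, Pn n * Pn n = star (Zn n) * Zn n)
    (hPS : ∀ n, Sn n * Sn n ≤ (Pn n - Sn n) * (Pn n - Sn n))
    (hPP : ∀ n, Pn n * (Pn n - Sn n) * Pn n = star (Zn n) * Yn n * Zn n)
    (k1 : ∀ x, Z x = 0 ↔ Y x = 0) (k2 : ∀ x, star Z x = 0 ↔ Y x = 0)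
    (k3 : ∀ x, Y x = 0 → S x = 0) :
    ∃ V : H ≃ₗᵢ[ℂ] H, (∀ x, ‖S x‖ ≤ ‖Y (V x)‖) ∧ (∀ k, Y k = 0 → V k = k) ∧
      ∀ x, Y (V x) + V (S x) = Z x := by
  obtain ⟨C, hC⟩ := st_bdd lZ
  obtain ⟨C', hC'⟩ := st_bdd lZs
  obtain ⟨CY, hCY⟩ := st_bdd lY
  set P := CFC.sqrt (star Z * Z) with hP
  have hPpos : 0 ≤ P := CFC.sqrt_nonneg _
  have hPsa : IsSelfAdjoint P := hPpos.isSelfAdjoint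
  have lP : ∀ x, Tendsto (fun n => Pn n x) atTop (𝓝 (P x)) := by
    intro x
    have e : ∀ n, Pn n = cfc Real.sqrt (star (Zn n) * Zn n) := by
      intro n
      rw [← cfcₙ_eq_cfc, ← CFC.sqrt_eq_real_sqrt _ (star_mul_self_nonneg _), eq_comm,
        CFC.sqrt_eq_iff _ _ (star_mul_self_nonneg _) (hP0 n)]
      exact hP2 n
    have e0 : P = cfc Real.sqrt (star Z * Z) := by
      rw [← cfcₙ_eq_cfc]; exact CFC.sqrt_eq_real_sqrt _ (star_mul_self_nonneg _)
    simp only [e, e0]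
    have hK : ∀ n, ‖star (Zn n) * Zn n‖ ≤ C' * C + ‖star Z * Z‖ := by
      intro n
      have h1 := (norm_mul_le (star (Zn n)) (Zn n)).trans (mul_le_mul (hC' n) (hC n) (norm_nonneg _)
        ((norm_nonneg _).trans (hC' n)))
      have := norm_nonneg (star Z * Z)
      linarith
    have hC0 : 0 ≤ C' * C := mul_nonneg ((norm_nonneg _).trans (hC' 0)) ((norm_nonneg _).trans (hC 0))
    exact st_cfc (fun n => (star_mul_self_nonneg (Zn n)).isSelfAdjoint) (star_mul_self_nonneg Z).isSelfAdjoint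
      hK (fun x => by simpa using st_mul hC' lZs lZ x)
      (a := 0) (b := C' * C + ‖star Z * Z‖)
      (fun n y hy => spec_Icc (star_mul_self_nonneg (Zn n)) (hK n) hy)
      (fun y hy => spec_Icc (star_mul_self_nonneg Z) (by linarith) hy)
      Real.continuous_sqrt.continuousOn x
  obtain ⟨CP, hCP⟩ := st_bdd lP
  have lPS : ∀ x, Tendsto (fun n => (Pn n - Sn n) x) atTop (𝓝 ((P - S) x)) := fun x => by
    simpa using (lP x).sub (lS x)
  obtain ⟨CPS, hCPS⟩ := st_bdd lPS
  have normP : ∀ x, ‖P x‖ = ‖Z x‖ := fun x => norm_sqrt_star_mul x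
  have kP : ∀ x, P x = 0 ↔ Y x = 0 := fun x => by
    rw [← k1, ← norm_eq_zero, normP, norm_eq_zero]
  have h1 : ∀ x, ‖S x‖ ≤ ‖(P - S) x‖ := by
    intro x
    refine le_of_tendsto_of_tendsto (lS x).norm (lPS x).norm (Eventually.of_forall fun n => ?_)
    have sPS : IsSelfAdjoint (Pn n - Sn n) := (hP0 n).isSelfAdjoint.sub (sSn n)
    have sq : ∀ T : H →L[ℂ] H, IsSelfAdjoint T → IsSelfAdjoint (T * T) := fun T hT => by
      unfold IsSelfAdjoint; rw [star_mul, hT.star_eq]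
    have := (le_iff_re (sq _ (sSn n)) (sq _ sPS)).1 (hPS n) x
    rw [ContinuousLinearMap.mul_apply, ContinuousLinearMap.mul_apply, sa_symm (sSn n), sa_symm sPS,
      inner_self_eq_norm_sq_to_K, inner_self_eq_norm_sq_to_K] at this
    norm_cast at this
    exact (sq_le_sq₀ (norm_nonneg _) (norm_nonneg _)).1 this
  have h2 : ∀ x, P ((P - S) (P x)) = star Z (Y (Z x)) := by
    intro x
    have a := st_mul hCP lP (B := fun n => (Pn n - Sn n) * Pn n) (B0 := (P - S) * P) (fun x => by
      simpa only [ContinuousLinearMap.mul_apply] using st_mul hCPS lPS lP x) x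
    have b := st_mul hC' lZs (B := fun n => Yn n * Zn n) (B0 := Y * Z) (fun x => by
      simpa only [ContinuousLinearMap.mul_apply] using st_mul hCY lY lZ x) x
    refine tendsto_nhds_unique a (b.congr fun n => ?_)
    have := congrArg (fun T : H →L[ℂ] H => T x) (hPP n)
    simp only [ContinuousLinearMap.mul_apply] at this ⊢
    exact this.symm
  let K := LinearMap.ker Y.toLinearMap
  let T1 : (H × K) →ₗ[ℂ] H := LinearMap.coprod P.toLinearMap K.subtype
  let T2 : (H × K) →ₗ[ℂ] H := LinearMap.coprod Z.toLinearMap K.subtype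
  have eT1 : ∀ x (k : K), T1 (x, k) = P x + k := fun x k => rfl
  have eT2 : ∀ x (k : K), T2 (x, k) = Z x + k := fun x k => rfl
  have oP : ∀ x (k : K), ⟪P x, (k : H)⟫_ℂ = 0 := fun x k => by
    rw [sa_symm hPsa, (kP k).2 k.2, inner_zero_right]
  have oZ : ∀ x (k : K), ⟪Z x, (k : H)⟫_ℂ = 0 := fun x k => by
    rw [← ContinuousLinearMap.adjoint_inner_right, ← ContinuousLinearMap.star_eq_adjoint,
      (k2 k).2 k.2, inner_zero_right]
  have hn : ∀ p, ‖T1 p‖ = ‖T2 p‖ := by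
    rintro ⟨x, k⟩
    rw [eT1, eT2]
    have a := norm_add_sq_eq_norm_sq_add_norm_sq_of_inner_eq_zero _ _ (oP x k)
    have b := norm_add_sq_eq_norm_sq_add_norm_sq_of_inner_eq_zero _ _ (oZ x k)
    rw [normP] at a
    rw [← mul_self_inj (norm_nonneg _) (norm_nonneg _), a, b]
  have dT1 : DenseRange T1 := dense_of_orth T1 fun z hz => by
    have h3 : P z = 0 := by
      have := hz (P z, 0)
      rw [eT1, ZeroMemClass.coe_zero, add_zero, sa_symm hPsa] at this
      exact inner_self_eq_zero.1 this
    have := hz (0, ⟨z, (kP z).1 h3⟩)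
    rw [eT1, map_zero, zero_add] at this
    exact inner_self_eq_zero.1 this
  have dT2 : DenseRange T2 := dense_of_orth T2 fun z hz => by
    have h3 : star Z z = 0 := by
      have := hz (star Z z, 0)
      rw [eT2, ZeroMemClass.coe_zero, add_zero, ← ContinuousLinearMap.adjoint_inner_right,
        ← ContinuousLinearMap.star_eq_adjoint] at this
      exact inner_self_eq_zero.1 this
    have := hz (0, ⟨z, (k2 z).1 h3⟩)
    rw [eT2, map_zero, zero_add] at this
    exact inner_self_eq_zero.1 this
  obtain ⟨V, hV⟩ := exists_unitary_of_dense T1 T2 hn dT1 dT2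
  have hVP : ∀ x, V (P x) = Z x := fun x => by
    have := hV (x, 0)
    simpa [eT1, eT2] using this
  have hVk : ∀ k, Y k = 0 → V k = k := fun k hk => by
    have := hV (0, ⟨k, hk⟩)
    simpa [eT1, eT2] using this
  have key : ∀ p q, ⟪(P - S) (T1 p), T1 q⟫_ℂ = ⟪Y (V (T1 p)), V (T1 q)⟫_ℂ := by
    have z1 : ∀ k : K, (P - S) (k : H) = 0 := fun k => by
      rw [ContinuousLinearMap.sub_apply, (kP k).2 k.2, k3 k k.2, sub_zero]
    have z2 : ∀ k : K, Y (V k) = 0 := fun k => by rw [hVk k k.2]; exact k.2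
    have sPS : IsSelfAdjoint (P - S) := hPsa.sub hS
    rintro ⟨x, k⟩ ⟨y, l⟩
    rw [eT1, eT1, map_add, map_add, map_add, map_add, z1, z2, add_zero, add_zero, inner_add_right,
      inner_add_right, sa_symm sPS _ (l : H), z1, inner_zero_right, sa_symm hY _ (V l), z2,
      inner_zero_right, hVP, hVP, ← sa_symm hPsa, h2, ContinuousLinearMap.star_eq_adjoint,
      ContinuousLinearMap.adjoint_inner_left]
  have hfin : ∀ z, V ((P - S) z) = Y (V z) := by
    have a1 : ∀ p w, ⟪(P - S) (T1 p), w⟫_ℂ = ⟪Y (V (T1 p)), V w⟫_ℂ := fun p w =>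
      congrFun (DenseRange.equalizer (f := T1) dT1 (g := fun w => ⟪(P - S) (T1 p), w⟫_ℂ)
        (h := fun w => ⟪Y (V (T1 p)), V w⟫_ℂ) (by fun_prop) (by fun_prop) (funext fun q => key p q)) w
    have a2 : ∀ p, V ((P - S) (T1 p)) = Y (V (T1 p)) := fun p => by
      refine ext_inner_right ℂ fun w => ?_
      obtain ⟨w, rfl⟩ := V.surjective w
      rw [V.inner_map_map, a1]
    intro z
    exact congrFun (DenseRange.equalizer (f := T1) dT1 (g := fun w => V ((P - S) w)) (h := fun w => Y (V w))
      (by fun_prop) (by fun_prop) (funext a2)) z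
  refine ⟨V, fun x => ?_, hVk, fun x => ?_⟩
  · rw [← hfin, V.norm_map]; exact h1 x
  · rw [← hfin, ← map_add, ContinuousLinearMap.sub_apply, sub_add_cancel, hVP]

end P9
end Leu
end F9

section F10
open Filter Topology ComplexOrder InnerProductSpace
open scoped ContinuousLinearMap
namespace Leu
section P10
variable {H : Type*} [NormedAddCommGroup H] [InnerProductSpace ℂ H] [CompleteSpace H]

theorem mem_closure_range_of_orth {Y : H →L[ℂ] H} (hsa : IsSelfAdjoint Y) {e : H}
    (hk : ∀ k, Y k = 0 → ⟪k, e⟫_ℂ = 0) : e ∈ closure (Set.range Y) := by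
  have h1 : (Y.toLinearMap.range)ᗮ = Y.toLinearMap.ker := by
    ext k
    rw [Submodule.mem_orthogonal, LinearMap.mem_ker]
    constructor
    · intro h
      have := h (Y (Y k)) ⟨Y k, rfl⟩
      rw [sa_symm hsa] at this
      exact inner_self_eq_zero.1 this
    · rintro h u ⟨w, rfl⟩
      have h' : Y k = 0 := h
      simp [sa_symm hsa, h']
  have h2 : e ∈ (Y.toLinearMap.range)ᗮᗮ := by
    rw [h1, Submodule.mem_orthogonal]
    exact fun u hu => hk u hu
  rw [Submodule.orthogonal_orthogonal_eq_closure] at h2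
  exact h2

theorem st_closure {ι : Type*} {l : Filter ι} {A : ι → H →L[ℂ] H} {A0 : H →L[ℂ] H} {C : ℝ}
    (hC : ∀ i, ‖A i‖ ≤ C) {s : Set H} (hs : ∀ x ∈ s, Tendsto (fun i => A i x) l (𝓝 (A0 x)))
    {x : H} (hx : x ∈ closure s) : Tendsto (fun i => A i x) l (𝓝 (A0 x)) := by
  rw [Metric.tendsto_nhds]
  intro ε hε
  have hCC : 0 < |C| + ‖A0‖ + 1 := by positivity
  obtain ⟨y, hy, hxy⟩ := Metric.mem_closure_iff.1 hx (ε / (2 * (|C| + ‖A0‖ + 1))) (by positivity)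
  filter_upwards [Metric.tendsto_nhds.1 (hs y hy) (ε / 2) (by positivity)] with i hi
  rw [dist_eq_norm] at hi hxy ⊢
  rw [lt_div_iff₀ (by positivity)] at hxy
  have e : A i x - A0 x = A i (x - y) + (A i y - A0 y) - A0 (x - y) := by simp
  have h1 : ‖A i (x - y)‖ ≤ |C| * ‖x - y‖ := ((A i).le_opNorm _).trans
    (mul_le_mul_of_nonneg_right ((hC i).trans (le_abs_self C)) (norm_nonneg _))
  have h2 := A0.le_opNorm (x - y)
  have h3 := norm_sub_le (A i (x - y) + (A i y - A0 y)) (A0 (x - y))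
  have h4 := norm_add_le (A i (x - y)) (A i y - A0 y)
  rw [e]
  nlinarith [norm_nonneg (x - y)]

theorem sub_rank_nonneg {Y : H →L[ℂ] H} (hY : 0 ≤ Y) {e : H} (he : (⟪e, Y e⟫_ℂ).re = 1) :
    0 ≤ Y - rankOne ℂ (Y e) (Y e) := by
  have hsa := hY.isSelfAdjoint
  have hr : IsSelfAdjoint (rankOne ℂ (Y e) (Y e) : H →L[ℂ] H) := star_rankOne _ _
  rw [sub_nonneg, le_iff_re hr hsa]
  intro x
  set T := CFC.sqrt Y
  have hT : IsSelfAdjoint T := (CFC.sqrt_nonneg Y).isSelfAdjoint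
  have hTT : ∀ x, Y x = T (T x) := fun x => by
    rw [← ContinuousLinearMap.mul_apply, CFC.sqrt_mul_sqrt_self Y]
  have h1 : ‖T e‖ ^ 2 = 1 := by
    rw [norm_sqrt_apply hY, ← inner_conj_symm, Complex.conj_re, he]
  have h2 : ‖T x‖ ^ 2 = (⟪Y x, x⟫_ℂ).re := norm_sqrt_apply hY x
  have h3 : ‖T e‖ = 1 := (pow_eq_one_iff_of_nonneg (norm_nonneg _) two_ne_zero).1 h1
  rw [← h2]
  simp only [rankOne_apply, inner_smul_left, hTT e]
  rw [sa_symm hT (T e) x, inner_conj_symm]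
  have h4 : ‖⟪T x, T e⟫_ℂ * ⟪T e, T x⟫_ℂ‖ ≤ ‖T x‖ ^ 2 := by
    have := norm_inner_le_norm (𝕜 := ℂ) (T x) (T e)
    have := norm_inner_le_norm (𝕜 := ℂ) (T e) (T x)
    rw [norm_mul]
    rw [h3] at *
    nlinarith [norm_nonneg (T x), norm_nonneg ⟪T x, T e⟫_ℂ, norm_nonneg ⟪T e, T x⟫_ℂ]
  refine (Complex.re_le_norm _).trans (le_trans (le_of_eq ?_) h4)
  congr 2

theorem st_mdelta {S : H →L[ℂ] H} (hS : 0 ≤ S) {δ : ℕ → ℝ} (hδ : ∀ n, 0 < δ n)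
    (hδ0 : Tendsto δ atTop (𝓝 0)) (x : H) :
    Tendsto (fun n => cfc (fun s : ℝ => √((max s 0 + δ n) / (max s 0 + 2 * δ n))) S x) atTop
      (𝓝 ((1 - (1 - √(1/2)) • (LinearMap.ker S.toLinearMap).starProjection) x)) := by
  have hsa := hS.isSelfAdjoint
  set K := LinearMap.ker S.toLinearMap
  set Q := K.starProjection
  set m : ℕ → ℝ → ℝ := fun n s => √((max s 0 + δ n) / (max s 0 + 2 * δ n)) with hm
  have pos : ∀ n s, 0 < max s 0 + δ n ∧ 0 < max s 0 + 2 * δ n := fun n s => by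
    have := hδ n
    have := le_max_right s 0
    constructor <;> linarith
  have mc : ∀ n, Continuous (m n) := fun n => by
    refine Real.continuous_sqrt.comp (Continuous.div (by fun_prop) (by fun_prop) fun s => (pos n s).2.ne')
  have mle : ∀ n s, m n s ≤ 1 := fun n s => by
    rw [hm]; simp only []
    rw [Real.sqrt_le_one, div_le_one (pos n s).2]
    have := hδ n; linarith
  have m0 : ∀ n s, 0 ≤ m n s := fun n s => Real.sqrt_nonneg _
  have mb : ∀ n, ‖cfc (m n) S‖ ≤ 1 := fun n => norm_cfc_le zero_le_one fun s hs => by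
    rw [Real.norm_eq_abs, abs_of_nonneg (m0 n s)]; exact mle n s
  have hQ : Q x ∈ K := K.starProjection_apply_mem x
  have h1 : ∀ n, cfc (m n) S (Q x) = √(1/2) • Q x := fun n => by
    have hSQ : S (Q x) = 0 := hQ
    rw [cfc_ker hsa (mc n) hSQ]
    congr 1
    rw [hm]; simp only [max_self, zero_add]
    congr 1
    have := (hδ n).ne'
    field_simp
  have h2 : Tendsto (fun n => cfc (m n) S (x - Q x)) atTop (𝓝 ((1 : H →L[ℂ] H) (x - Q x))) := by
    refine st_closure mb ?_ (mem_closure_range_of_orth hsa (e := x - Q x) fun k hk => ?_)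
    · rintro _ ⟨ζ, rfl⟩
      rw [tendsto_iff_norm_sub_tendsto_zero]
      have h3 : Tendsto (fun n => δ n * ‖ζ‖) atTop (𝓝 0) := by simpa using hδ0.mul_const ‖ζ‖
      refine squeeze_zero (fun n => norm_nonneg _) (fun n => ?_) h3
      have cx : ContinuousOn (fun s : ℝ => s) (spectrum ℝ S) := continuousOn_id
      have c1 : ContinuousOn (fun s : ℝ => m n s * s) (spectrum ℝ S) := (mc n).continuousOn.mul cx
      have e : cfc (m n) S * S - S = cfc (fun s => m n s * s - s) S := by
        rw [cfc_sub _ _ S c1 cx, cfc_mul _ _ S (mc n).continuousOn cx, cfc_id' ℝ S]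
      have : ‖cfc (m n) S * S - S‖ ≤ δ n := by
        rw [e]
        refine norm_cfc_le (hδ n).le fun s hs => ?_
        have s0 := spectrum_nonneg_of_nonneg hS hs
        have a1 : m n s * m n s = (max s 0 + δ n) / (max s 0 + 2 * δ n) :=
          Real.mul_self_sqrt (div_pos (pos n s).1 (pos n s).2).le
        rw [max_eq_left s0, eq_div_iff (by have := hδ n; linarith)] at a1
        have a2 := mle n s
        have a3 := m0 n s
        have a4 := hδ n
        rw [Real.norm_eq_abs, abs_le]
        constructor
        · nlinarith [mul_nonneg (mul_nonneg a3 (sub_nonneg.2 a2)) (by linarith : 0 ≤ s + 2 * δ n),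
            mul_nonneg (sub_nonneg.2 a2) a4.le]
        · nlinarith
      have := (cfc (m n) S * S - S).le_of_opNorm_le this ζ
      simpa using this
    · have := K.starProjection_inner_eq_zero x k hk
      rw [← inner_conj_symm, this, map_zero]
  have h3 := h2.add (tendsto_const_nhds (x := √(1/2) • Q x))
  refine Tendsto.congr' ?_ (h3.trans_eq ?_)
  · filter_upwards with n
    rw [← h1 n, ← map_add, sub_add_cancel]
  · congr 1
    simp only [ContinuousLinearMap.one_apply, ContinuousLinearMap.sub_apply,
      ContinuousLinearMap.smul_apply, sub_smul, one_smul]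
    abel

end P10
end Leu
end F10

section F11
open Filter Topology ComplexOrder InnerProductSpace
open scoped ContinuousLinearMap
namespace Leu
section P11
variable {H : Type*} [NormedAddCommGroup H] [InnerProductSpace ℂ H] [CompleteSpace H]

theorem clm_rsmul (T : H →L[ℂ] H) (c : ℝ) (x : H) : T (c • x) = c • T x := by
  rw [← Complex.coe_smul, map_smul, Complex.coe_smul]

theorem chi_pos {Y : H →L[ℂ] H} (hY : 0 ≤ Y) {e : H} (he : (⟪e, Y e⟫_ℂ).re = 1) {x : ℝ}
    (hx : 0 ≤ x) : 0 < chi Y e x := by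
  have h1 := chi_ge hY he hx le_rfl
  by_contra h
  push Not at h
  have : (x + ‖Y‖) * chi Y e x ≤ 0 := mul_nonpos_of_nonneg_of_nonpos (by positivity) h
  linarith

theorem sub_rank_apply_self {Y : H →L[ℂ] H} (hY : 0 ≤ Y) {e : H} (he : (⟪e, Y e⟫_ℂ).re = 1) :
    (Y - rankOne ℂ (Y e) (Y e)) e = 0 := by
  have h := inner_apply_self_nonneg hY e
  have h2 : ⟪Y e, e⟫_ℂ = 1 := by
    apply Complex.ext
    · rw [← inner_conj_symm, Complex.conj_re, he]; simp
    · have := (Complex.nonneg_iff.1 h).2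
      simpa using this.symm
  simp [h2]

set_option maxHeartbeats 1000000 in
theorem onestep {Y S : H →L[ℂ] H} (hY : 0 ≤ Y) {e : H} (he : (⟪e, Y e⟫_ℂ).re = 1)
    (hk : ∀ k, Y k = 0 → ⟪k, e⟫_ℂ = 0) (hS : S = Y - rankOne ℂ (Y e) (Y e)) :
    ∃ (V : H ≃ₗᵢ[ℂ] H) (D2 : H →L[ℂ] H), (∀ x, ‖S x‖ ≤ ‖Y (V x)‖) ∧ (∀ k, Y k = 0 → V k = k) ∧
      (∀ x, Y (V x) + V (S x) = cfc (fun y => √(2 * y * y * chi Y e (max y 0))) Y (D2 x)) ∧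
      D2 * S = cfc (fun s => s * √(2 / chi Y e (max s 0))) S ∧ ‖D2‖ ≤ 4 * √‖Y‖ := by
  have hsaY := hY.isSelfAdjoint
  have hS0 : 0 ≤ S := hS ▸ sub_rank_nonneg hY he
  have hsaS := hS0.isSelfAdjoint
  have hYS : Y = S + rankOne ℂ (Y e) (Y e) := by rw [hS]; abel
  set v := Y e with hv
  have hSY : S ≤ Y := by
    rw [hYS]
    refine le_add_of_nonneg_right ?_
    rw [ContinuousLinearMap.nonneg_iff_isPositive]
    exact isPositive_rankOne_self _
  have hkYS : ∀ x, Y x = 0 → S x = 0 := fun x hx => ker_le_of_le hS0 hSY hx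
  have hnSY : ‖S‖ ≤ ‖Y‖ := CStarAlgebra.norm_le_norm_of_nonneg_of_le hS0 hSY
  set h : ℝ → ℝ := fun x => chi Y e (max x 0) with hh
  have hc : Continuous h :=
    (chi_cont hY hk).comp_continuous (by fun_prop) fun x => le_max_right x 0
  have hp : ∀ x, 0 < h x := fun x => chi_pos hY he (le_max_right x 0)
  have heq : ∀ x, 0 ≤ x → chi Y e x = h x := fun x hx => by rw [hh]; simp [max_eq_left hx]
  let δ : ℕ → ℝ := fun n => 1 / ((n : ℝ) + 1)
  have hδ : ∀ n, 0 < δ n := fun n => by positivity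
  have hδ1 : ∀ n, δ n ≤ 1 := fun n => by
    have : (0:ℝ) ≤ n := Nat.cast_nonneg n
    exact (div_le_one (by positivity)).2 (by linarith)
  have hδ0 : Tendsto δ atTop (𝓝 0) := tendsto_one_div_add_atTop_nhds_zero_nat
  set R := ‖Y‖ + ‖S‖ + 1 with hR
  let F1 : ℝ → ℝ → ℝ := fun δ y => √(2 * (y + δ) * (y + 2 * δ) * h (y + 2 * δ))
  let F2 : ℝ → ℝ → ℝ := fun δ y => √(2 / h (y + 2 * δ))
  have cF1 : Continuous (Function.uncurry F1) := by
    have : Continuous (fun p : ℝ × ℝ => h (p.2 + 2 * p.1)) := hc.comp (by fun_prop)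
    exact Real.continuous_sqrt.comp (by fun_prop)
  have cF2 : Continuous (Function.uncurry F2) := by
    have : Continuous (fun p : ℝ × ℝ => h (p.2 + 2 * p.1)) := hc.comp (by fun_prop)
    exact Real.continuous_sqrt.comp (Continuous.div (by fun_prop) this fun p => (hp _).ne')
  let m : ℕ → ℝ → ℝ := fun n s => √((max s 0 + δ n) / (max s 0 + 2 * δ n))
  let D1n : ℕ → H →L[ℂ] H := fun n => cfc (F1 (δ n)) Y
  let Cn : ℕ → H →L[ℂ] H := fun n => cfc (F2 (δ n)) S
  let Mn : ℕ → H →L[ℂ] H := fun n => cfc (m n) S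
  let D1 := cfc (F1 0) Y
  let C := cfc (F2 0) S
  let Q : H →L[ℂ] H := (LinearMap.ker S.toLinearMap).starProjection
  let M : H →L[ℂ] H := 1 - (1 - √(1/2)) • Q
  have lD1 : ∀ x, Tendsto (fun n => D1n n x) atTop (𝓝 (D1 x)) := fun x => by
    have h1 := (cfc_tendsto_joint Y F1 cF1).comp hδ0
    exact ((ContinuousLinearMap.apply ℂ H x).continuous.tendsto _).comp h1
  have lC : ∀ x, Tendsto (fun n => Cn n x) atTop (𝓝 (C x)) := fun x => by
    have h1 := (cfc_tendsto_joint S F2 cF2).comp hδ0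
    exact ((ContinuousLinearMap.apply ℂ H x).continuous.tendsto _).comp h1
  have lM : ∀ x, Tendsto (fun n => Mn n x) atTop (𝓝 (M x)) := fun x => st_mdelta hS0 hδ hδ0 x
  obtain ⟨b1, hb1⟩ := st_bdd lD1
  obtain ⟨b2, hb2⟩ := st_bdd lC
  obtain ⟨b3, hb3⟩ := st_bdd lM
  have sD1n : ∀ n, star (D1n n) = D1n n := fun n => (cfc_predicate (F1 (δ n)) Y : IsSelfAdjoint _).star_eq
  have sCn : ∀ n, star (Cn n) = Cn n := fun n => (cfc_predicate (F2 (δ n)) S : IsSelfAdjoint _).star_eq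
  have sMn : ∀ n, star (Mn n) = Mn n := fun n => (cfc_predicate (m n) S : IsSelfAdjoint _).star_eq
  have sD1 : star D1 = D1 := (cfc_predicate (F1 0) Y : IsSelfAdjoint _).star_eq
  have sC : star C = C := (cfc_predicate (F2 0) S : IsSelfAdjoint _).star_eq
  have sQ : star Q = Q := isSelfAdjoint_starProjection _
  have sM : star M = M := by
    change star (1 - (1 - √(1/2)) • Q) = _
    rw [star_sub, star_one, star_smul, sQ, star_trivial]
  have Qk : ∀ x, S x = 0 → Q x = x := fun x hx =>
    Submodule.starProjection_eq_self_iff.2 hx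
  have QS : ∀ x, Q (S x) = 0 := fun x => by
    refine (Submodule.starProjection_apply_eq_zero_iff _).2 ?_
    rw [Submodule.mem_orthogonal]
    intro u hu
    have hu' : S u = 0 := hu
    rw [← sa_symm hsaS, hu', inner_zero_left]
  have hs2 : 0 < √(1/2 : ℝ) := Real.sqrt_pos.2 (by norm_num)
  have Mk : ∀ x, S x = 0 → M x = √(1/2) • x := fun x hx => by
    change (1 - (1 - √(1/2)) • Q) x = _
    simp only [ContinuousLinearMap.sub_apply, ContinuousLinearMap.smul_apply,
      ContinuousLinearMap.one_apply, Qk x hx, sub_smul, one_smul]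
    abel
  have MS : M * S = S := by
    ext x
    change (1 - (1 - √(1/2)) • Q) (S x) = _
    simp [QS]
  have SQ : ∀ x, S (Q x) = 0 := fun x => (LinearMap.ker S.toLinearMap).starProjection_apply_mem x
  have Minj : ∀ x, M x = 0 → x = 0 := fun x hx => by
    have e1 : M x = x - (1 - √(1/2)) • Q x := by
      change (1 - (1 - √(1/2)) • Q) x = _
      simp
    rw [e1, sub_eq_zero] at hx
    have hSx : S x = 0 := by rw [hx, clm_rsmul, SQ, smul_zero]
    have : M x = 0 := by rw [e1, sub_eq_zero]; exact hx
    rw [Mk x hSx] at this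
    exact (smul_eq_zero.1 this).resolve_left hs2.ne'
  have cF20 : Continuous (F2 0) := cF2.comp (Continuous.prodMk_right 0)
  have F20pos : ∀ s, 0 < F2 0 s := fun s => Real.sqrt_pos.2 (div_pos two_pos (hp _))
  have uC : IsUnit C := (isUnit_cfc_iff (F2 0) S cF20.continuousOn).2 fun s _ => (F20pos s).ne'
  have Cinj : ∀ x, C x = 0 → x = 0 := fun x hx => by
    obtain ⟨u, hu⟩ := uC
    have : (↑u⁻¹ * C) x = 0 := by rw [ContinuousLinearMap.mul_apply, hx, map_zero]
    rw [← hu, Units.inv_mul] at this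
    simpa using this
  have Ck : ∀ x, S x = 0 → C x = F2 0 0 • x := fun x hx => cfc_ker hsaS cF20 hx
  let c1 : ℝ → ℝ := fun y => √(2 * h y)
  have cc1 : Continuous c1 := by fun_prop
  have cx : ContinuousOn (fun x : ℝ => x) (spectrum ℝ Y) := continuousOn_id
  have cxS : ContinuousOn (fun x : ℝ => x) (spectrum ℝ S) := continuousOn_id
  have D1Y : D1 = cfc c1 Y * Y := by
    have e0 : cfc c1 Y * Y = cfc c1 Y * cfc (fun x : ℝ => x) Y := by rw [cfc_id' ℝ Y]
    rw [e0, ← cfc_mul _ _ Y cc1.continuousOn cx]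
    refine cfc_congr fun y hy => ?_
    have y0 := spectrum_nonneg_of_nonneg hY hy
    change √(2 * (y + 0) * (y + 2 * 0) * h (y + 2 * 0)) = √(2 * h y) * y
    rw [show 2 * (y + 0) * (y + 2 * 0) * h (y + 2 * 0) = (2 * h y) * (y * y) by simp; ring,
      Real.sqrt_mul (by have := hp y; positivity), Real.sqrt_mul_self y0]
  have uc1 : IsUnit (cfc c1 Y) := (isUnit_cfc_iff c1 Y cc1.continuousOn).2 fun s _ =>
    (Real.sqrt_pos.2 (mul_pos two_pos (hp _))).ne'
  have D1k : ∀ x, D1 x = 0 ↔ Y x = 0 := fun x => by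
    rw [D1Y, ContinuousLinearMap.mul_apply]
    constructor
    · intro hx
      obtain ⟨u, hu⟩ := uc1
      have : (↑u⁻¹ * cfc c1 Y) (Y x) = 0 := by rw [ContinuousLinearMap.mul_apply, hx, map_zero]
      rw [← hu, Units.inv_mul] at this
      simpa using this
    · intro hx; rw [hx, map_zero]
  let Zn : ℕ → H →L[ℂ] H := fun n => D1n n * (Mn n * Cn n)
  let Z : H →L[ℂ] H := D1 * (M * C)
  have lMC : ∀ x, Tendsto (fun n => (Mn n * Cn n) x) atTop (𝓝 ((M * C) x)) := fun x =>
    st_mul hb3 lM lC x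
  have lZ : ∀ x, Tendsto (fun n => Zn n x) atTop (𝓝 (Z x)) := fun x =>
    st_mul hb1 lD1 lMC x
  have lZs : ∀ x, Tendsto (fun n => star (Zn n) x) atTop (𝓝 (star Z x)) := fun x => by
    have e1 : ∀ n, star (Zn n) = Cn n * (Mn n * D1n n) := fun n => by
      simp only [Zn, star_mul, sD1n, sCn, sMn, mul_assoc]
    have e2 : star Z = C * (M * D1) := by
      simp only [Z, star_mul, sD1, sC, sM, mul_assoc]
    simp only [e1, e2]
    exact st_mul hb2 lC (B := fun n => Mn n * D1n n) (B0 := M * D1) (fun x => st_mul hb3 lM lD1 x) x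
  have kZ : ∀ x, Z x = 0 ↔ Y x = 0 := fun x => by
    change D1 (M (C x)) = 0 ↔ _
    rw [D1k]
    have sc : ∀ u, Y u = 0 → M (C u) = (√(1/2) * F2 0 0) • u := fun u hu => by
      have hu' := hkYS u hu
      rw [Ck u hu', clm_rsmul, Mk u hu', smul_smul, mul_comm]
    constructor
    · intro hx
      set u := M (C x) with hu
      have hne : √(1/2) * F2 0 0 ≠ 0 := (mul_pos hs2 (F20pos 0)).ne'
      have h1 : M (C ((√(1/2) * F2 0 0)⁻¹ • u)) = u := by
        rw [sc _ (by rw [clm_rsmul, hx, smul_zero]), smul_smul, mul_inv_cancel₀ hne, one_smul]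
      have h2 : M (C ((√(1/2) * F2 0 0)⁻¹ • u - x)) = 0 := by
        rw [map_sub, map_sub, h1, hu, sub_self]
      have h3 := Cinj _ (Minj _ h2)
      rw [← sub_eq_zero.1 h3, clm_rsmul, hx, smul_zero]
    · intro hx
      rw [sc x hx, clm_rsmul, hx, smul_zero]
  have kZs : ∀ x, star Z x = 0 ↔ Y x = 0 := fun x => by
    have e2 : star Z = C * (M * D1) := by
      simp only [Z, star_mul, sD1, sC, sM, mul_assoc]
    rw [e2, ← D1k]
    simp only [ContinuousLinearMap.mul_apply]
    constructor
    · intro hx; exact Minj _ (Cinj _ hx)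
    · intro hx; rw [hx, map_zero, map_zero]
  let Yn : ℕ → H →L[ℂ] H := fun n => Y + algebraMap ℝ (H →L[ℂ] H) (δ n)
  let Sn : ℕ → H →L[ℂ] H := fun n => S + algebraMap ℝ (H →L[ℂ] H) (δ n)
  have lalg : ∀ (A : H →L[ℂ] H) x, Tendsto (fun n => (A + algebraMap ℝ (H →L[ℂ] H) (δ n)) x) atTop (𝓝 (A x)) := by
    intro A x
    have : Tendsto (fun n => A x + δ n • x) atTop (𝓝 (A x + (0:ℝ) • x)) :=
      tendsto_const_nhds.add (hδ0.smul_const x)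
    rw [zero_smul, add_zero] at this
    refine this.congr fun n => ?_
    simp [Algebra.algebraMap_eq_smul_one]
  have salg : ∀ (A : H →L[ℂ] H) n, IsSelfAdjoint A → IsSelfAdjoint (A + algebraMap ℝ (H →L[ℂ] H) (δ n)) :=
    fun A n hA => hA.add (IsSelfAdjoint.algebraMap _ (IsSelfAdjoint.all _))
  have galg : ∀ (A : H →L[ℂ] H) n, 0 ≤ A → algebraMap ℝ (H →L[ℂ] H) (δ n) ≤ A + algebraMap ℝ (H →L[ℂ] H) (δ n) :=
    fun A n hA => le_add_of_nonneg_left hA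
  have nalg : ∀ (A : H →L[ℂ] H) n, ‖A + algebraMap ℝ (H →L[ℂ] H) (δ n)‖ ≤ ‖A‖ + 1 := fun A n => by
    refine (norm_add_le _ _).trans ?_
    gcongr
    rw [Algebra.algebraMap_eq_smul_one, norm_smul, Real.norm_eq_abs, abs_of_pos (hδ n)]
    have h1 : ‖(1 : H →L[ℂ] H)‖ ≤ 1 := ContinuousLinearMap.norm_id_le
    have := hδ1 n
    have := hδ n
    nlinarith [norm_nonneg (1 : H →L[ℂ] H)]
  have main : ∀ n, ∃ P : H →L[ℂ] H, 0 ≤ P ∧ P * P = star (Zn n) * Zn n ∧ Sn n * Sn n ≤ (P - Sn n) * (P - Sn n) ∧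
      P * (P - Sn n) * P = star (Zn n) * Yn n * Zn n := by
    intro n
    let d1 : ℝ → ℝ := fun x => √(2 * x * ((x + δ n) * h (x + δ n)))
    let d2 : ℝ → ℝ := fun x => √(2 * x / ((x + δ n) * h (x + δ n)))
    have δp := hδ n
    have hcs : Continuous fun x => h (x + δ n) := hc.comp (by fun_prop)
    have cd1 : Continuous d1 := by
      exact Real.continuous_sqrt.comp (by fun_prop)
    have cd2 : ContinuousOn d2 (Set.Ici 0) := by
      refine Real.continuous_sqrt.comp_continuousOn (ContinuousOn.div (by fun_prop) (by fun_prop) fun x hx => ?_)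
      have : (0:ℝ) ≤ x := hx
      exact (mul_pos (by linarith) (hp _)).ne'
    have hYSn : Yn n = Sn n + rankOne ℂ v v := by
      change Y + _ = S + _ + _
      nth_rewrite 1 [hYS]; abel
    have gY : ∀ x, 0 < x → gam (Yn n) v x = 1 - (x + δ n) * h (x + δ n) := fun x hx => by
      change gam (Y + _) v x = _
      rw [gam_shift, hv, gam_chi hY he (by linarith), heq _ (by linarith)]
    have rel : ∀ x, 0 < x → (1 - gam (Yn n) v x) * (1 + gam (Sn n) v x) = 1 := fun x hx => by
      have := gam_rel (Y := Yn n) (S := Sn n) (c := δ n) (ε := 1) (x := x) (v := v) (salg Y n hsaY)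
        (salg S n hsaS) (galg Y n hY) (galg S n hS0) (by simpa using hYSn) (by linarith)
      simpa using this
    refine m2 (Y := Yn n) (S := Sn n) (c := δ n) (R := R) (v := v) δp (salg Y n hsaY) (salg S n hsaS)
      (galg Y n hY) (galg S n hS0) ((nalg Y n).trans (by have := norm_nonneg S; linarith))
      ((nalg S n).trans (by have := norm_nonneg Y; linarith)) hYSn (d1 := d1) (d2 := d2)
      cd1.continuousOn (cd2.mono fun x hx => le_trans δp.le hx.1) ?_ ?_ ?_ ?_
    · intro x hx
      have x0 : 0 < x := lt_of_lt_of_le δp hx.1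
      have := hp (x + δ n)
      rw [Real.mul_self_sqrt (by positivity), gY x x0]; ring
    · intro x hx
      have x0 : 0 < x := lt_of_lt_of_le δp hx.1
      have h1 := hp (x + δ n)
      have h2 := rel x x0
      rw [gY x x0] at h2
      have h3 : 0 < (x + δ n) * h (x + δ n) := by positivity
      rw [Real.mul_self_sqrt (by positivity), div_eq_iff h3.ne']
      linear_combination (-2 * x) * h2
    · intro x hx
      have x0 : 0 < x := lt_of_lt_of_le δp hx.1
      have h1 := hp (x + δ n)
      have h3 : 0 < (x + δ n) * h (x + δ n) := by positivity
      change √_ * √_ = _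
      rw [← Real.sqrt_mul (by positivity)]
      rw [show 2 * x * ((x + δ n) * h (x + δ n)) * (2 * x / ((x + δ n) * h (x + δ n))) = (2 * x) * (2 * x) by
        field_simp]
      exact Real.sqrt_mul_self (by positivity)
    · change D1n n * (Mn n * Cn n) = _
      congr 1
      · change _ = cfc d1 (Y + _)
        rw [cfc_shift hsaY _ cd1.continuousOn]
        refine cfc_congr fun y hy => ?_
        change √_ = √_
        congr 1
        rw [show y + δ n + δ n = y + 2 * δ n by ring]; ring
      · change _ = cfc d2 (S + _)
        rw [cfc_shift hsaS _ (cd2.mono ?_)]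
        · have mc : Continuous (m n) := by
            refine Real.continuous_sqrt.comp (Continuous.div (by fun_prop) (by fun_prop) fun s => ?_)
            have := le_max_right s 0
            linarith
          have cF2n : Continuous (F2 (δ n)) := cF2.comp (Continuous.prodMk_right _)
          change cfc (m n) S * cfc (F2 (δ n)) S = _
          rw [← cfc_mul _ _ S mc.continuousOn cF2n.continuousOn]
          refine cfc_congr fun s hs => ?_
          have s0 := spectrum_nonneg_of_nonneg hS0 hs
          change √_ * √_ = √_
          have h1 := hp (s + 2 * δ n)
          rw [max_eq_left s0, ← Real.sqrt_mul (by positivity), show s + δ n + δ n = s + 2 * δ n by ring]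
          congr 1
          field_simp
        · rintro _ ⟨s, hs, rfl⟩
          have s0 := spectrum_nonneg_of_nonneg hS0 hs
          change (0:ℝ) ≤ s + δ n
          linarith
  choose P hP0 hP2 hPS hPP using main
  obtain ⟨V, hV1, hV2, hV3⟩ := polar_limit hsaY hsaS (lalg Y) (lalg S) lZ lZs (fun n => salg S n hsaS)
    hP0 hP2 hPS hPP kZ kZs hkYS
  refine ⟨V, M * C, hV1, hV2, fun x => ?_, ?_, ?_⟩
  · rw [hV3]
    change D1 ((M * C) x) = _
    congr 2
    change cfc (F1 0) Y = _
    congr 1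
    funext y
    simp [F1, hh]
  · have cS : C * S = S * C := intertw hsaS hsaS rfl (fun x hx => spec_abs le_rfl hx)
      (fun x hx => spec_abs le_rfl hx) cF20.continuousOn
    rw [mul_assoc, cS, ← mul_assoc, MS]
    nth_rewrite 1 [← cfc_id' ℝ S]
    rw [← cfc_mul _ _ S cxS cF20.continuousOn]
    congr 1
    funext s
    simp [F2, hh]
  · have nC : ‖C‖ ≤ 2 * √‖Y‖ := by
      refine norm_cfc_le (by positivity) fun s hs => ?_
      have hs2 := spec_Icc hS0 hnSY hs
      have s0 := hs2.1
      have s1 := hs2.2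
      rw [Real.norm_eq_abs, abs_of_pos (F20pos s)]
      change √_ ≤ _
      rw [Real.sqrt_le_left (by positivity), mul_pow, Real.sq_sqrt (norm_nonneg Y), mul_zero, add_zero,
        div_le_iff₀ (hp s)]
      have := chi_ge hY he s0 (le_refl ‖Y‖)
      rw [heq s s0] at this
      nlinarith [hp s]
    have nM : ‖M‖ ≤ 2 := by
      have nQ : ‖Q‖ ≤ 1 := (LinearMap.ker S.toLinearMap).starProjection_norm_le
      have h1 : ‖(1 : H →L[ℂ] H)‖ ≤ 1 := ContinuousLinearMap.norm_id_le
      have h2 : √(1/2 : ℝ) ≤ 1 := Real.sqrt_le_one.2 (by norm_num)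
      change ‖1 - (1 - √(1/2)) • Q‖ ≤ 2
      refine (norm_sub_le _ _).trans ?_
      rw [norm_smul, Real.norm_eq_abs, abs_of_nonneg (by linarith)]
      nlinarith [norm_nonneg Q]
    refine (norm_mul_le _ _).trans ?_
    have := mul_le_mul nM nC (norm_nonneg _) two_pos.le
    linarith

end P11
end Leu
end F11

section F12
open Filter Topology ComplexOrder InnerProductSpace
open scoped ContinuousLinearMap
namespace Leu
section P12
variable {H : Type*} [NormedAddCommGroup H] [InnerProductSpace ℂ H] [CompleteSpace H]

theorem pou (R : ℝ) {h : ℝ} (hh : 0 < h) : ∃ (N : ℕ) (u : ℕ → ℝ → ℝ) (t : ℕ → ℝ),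
    (∀ j, ContinuousOn (u j) (Set.Icc 0 R)) ∧ (∀ j, 0 ≤ R → t j ∈ Set.Icc 0 R) ∧
    (∀ j, ∀ x ∈ Set.Icc 0 R, 0 ≤ u j x) ∧
    (∀ x ∈ Set.Icc 0 R, ∑ j ∈ Finset.range N, u j x = 1) ∧
    (∀ j, ∀ x ∈ Set.Icc 0 R, u j x ≠ 0 → |x - t j| ≤ h) := by
  let w : ℕ → ℝ → ℝ := fun j x => max 0 (h - |x - j * h|)
  let N : ℕ := ⌊R / h⌋₊ + 1
  let W : ℝ → ℝ := fun x => ∑ j ∈ Finset.range N, w j x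
  have w0 : ∀ j x, 0 ≤ w j x := fun j x => le_max_left _ _
  have wc : ∀ j, Continuous (w j) := fun j => by fun_prop
  have Wc : Continuous W := continuous_finset_sum _ fun j _ => wc j
  have Wp : ∀ x ∈ Set.Icc 0 R, 0 < W x := fun x hx => by
    have hx0 := hx.1
    have hj : ⌊x / h⌋₊ ∈ Finset.range N := by
      rw [Finset.mem_range]
      exact Nat.lt_succ_of_le (Nat.floor_le_floor (div_le_div_of_nonneg_right hx.2 hh.le))
    refine lt_of_lt_of_le ?_ (Finset.single_le_sum (fun j _ => w0 j x) hj)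
    refine lt_max_of_lt_right ?_
    have h1 := Nat.floor_le (div_nonneg hx0 hh.le)
    have h2 := Nat.lt_floor_add_one (x / h)
    rw [le_div_iff₀ hh] at h1
    rw [div_lt_iff₀ hh] at h2
    rw [sub_pos, abs_lt]
    constructor <;> linarith
  refine ⟨N, fun j x => w j x / W x, fun j => min (j * h) R, fun j => ?_, fun j hR => ?_, fun j x hx => ?_,
    fun x hx => ?_, fun j x hx hne => ?_⟩
  · exact (wc j).continuousOn.div Wc.continuousOn fun x hx => (Wp x hx).ne'
  · exact ⟨le_min (by positivity) hR, min_le_right _ _⟩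
  · exact div_nonneg (w0 j x) (Wp x hx).le
  · rw [← Finset.sum_div, div_self (Wp x hx).ne']
  · have h1 : w j x ≠ 0 := fun h => hne (by simp [h])
    have h2 : 0 < h - |x - j * h| := by
      by_contra h3
      push Not at h3
      exact h1 (max_eq_left h3)
    have h3 : |x - j * h| < h := by linarith
    rw [abs_lt] at h3
    have := hx.2
    change |x - min ((j:ℝ) * h) R| ≤ h
    rw [abs_le]
    rcases le_total ((j:ℝ) * h) R with h4 | h4
    · rw [min_eq_left h4]; constructor <;> linarith
    · rw [min_eq_right h4]; constructor <;> linarith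

theorem st_equi {S : ℕ → H →L[ℂ] H} {Y : H →L[ℂ] H} {R : ℝ} (hR0 : 0 ≤ R) (hS : ∀ m, 0 ≤ S m) (hY : 0 ≤ Y)
    (hSR : ∀ m, ‖S m‖ ≤ R) (hYR : ‖Y‖ ≤ R) (hlim : ∀ x, Tendsto (fun m => S m x) atTop (𝓝 (Y x)))
    {q : ℕ → ℝ → ℝ} {B : ℝ} (hqc : ∀ m, ContinuousOn (q m) (Set.Icc 0 R))
    (hqB : ∀ m, ∀ x ∈ Set.Icc 0 R, |q m x| ≤ B)
    (hq : ∀ ε, 0 < ε → ∃ h, 0 < h ∧ ∀ m, ∀ x ∈ Set.Icc 0 R, ∀ y ∈ Set.Icc 0 R, |x - y| ≤ h →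
      |q m x - q m y| ≤ ε) (z : H) :
    Tendsto (fun m => cfc (q m) (S m) z - cfc (q m) Y z) atTop (𝓝 0) := by
  rw [Metric.tendsto_nhds]
  intro ε hε
  set ε' := ε / (3 * (‖z‖ + 1)) with hε'
  have hε'p : 0 < ε' := by positivity
  obtain ⟨h, hh, hmod⟩ := hq ε' hε'p
  obtain ⟨N, u, t, uc, ht, u0, u1, ut⟩ := pou R hh
  let p : ℕ → ℝ → ℝ := fun m x => ∑ j ∈ Finset.range N, q m (t j) * u j x
  have pc : ∀ m, ContinuousOn (p m) (Set.Icc 0 R) := fun m =>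
    continuousOn_finset_sum _ fun j _ => continuousOn_const.mul (uc j)
  have pq : ∀ m, ∀ x ∈ Set.Icc 0 R, |q m x - p m x| ≤ ε' := fun m x hx => by
    have e1 : q m x - p m x = ∑ j ∈ Finset.range N, (q m x - q m (t j)) * u j x := by
      simp only [p, sub_mul, Finset.sum_sub_distrib]
      rw [← Finset.mul_sum, u1 x hx, mul_one]
    rw [e1]
    refine (Finset.abs_sum_le_sum_abs _ _).trans ?_
    calc ∑ j ∈ Finset.range N, |(q m x - q m (t j)) * u j x| ≤ ∑ j ∈ Finset.range N, ε' * u j x := by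
          refine Finset.sum_le_sum fun j _ => ?_
          rw [abs_mul, abs_of_nonneg (u0 j x hx)]
          by_cases hu : u j x = 0
          · simp [hu]
          · exact mul_le_mul_of_nonneg_right (hmod m x hx _ (ht j hR0) (ut j x hx hu)) (u0 j x hx)
      _ = ε' := by rw [← Finset.mul_sum, u1 x hx, mul_one]
  have sS : ∀ m, spectrum ℝ (S m) ⊆ Set.Icc 0 R := fun m x hx => spec_Icc (hS m) (hSR m) hx
  have sY : spectrum ℝ Y ⊆ Set.Icc 0 R := fun x hx => spec_Icc hY hYR hx
  have pe : ∀ (T : H →L[ℂ] H), spectrum ℝ T ⊆ Set.Icc 0 R → ∀ m,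
      cfc (p m) T = ∑ j ∈ Finset.range N, q m (t j) • cfc (u j) T := fun T hT m => by
    have e0 : p m = ∑ j ∈ Finset.range N, fun x => q m (t j) * u j x := by
      funext x; simp [p]
    rw [e0]
    rw [cfc_sum (fun j x => q m (t j) * u j x) T (Finset.range N)
      (fun j _ => (continuousOn_const.mul (uc j)).mono hT)]
    exact Finset.sum_congr rfl fun j _ => cfc_const_mul _ (u j) T ((uc j).mono hT)
  have lim : Tendsto (fun m => ∑ j ∈ Finset.range N, B * ‖cfc (u j) (S m) z - cfc (u j) Y z‖) atTop (𝓝 0) := by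
    have : Tendsto (fun m => ∑ j ∈ Finset.range N, B * ‖cfc (u j) (S m) z - cfc (u j) Y z‖) atTop
        (𝓝 (∑ j ∈ Finset.range N, B * 0)) := by
      refine tendsto_finset_sum _ fun j _ => Tendsto.const_mul B ?_
      exact tendsto_iff_norm_sub_tendsto_zero.1 (st_cfc (fun m => (hS m).isSelfAdjoint) hY.isSelfAdjoint hSR hlim
        sS sY (uc j) z)
    simpa using this
  filter_upwards [lim.eventually (gt_mem_nhds (show (0:ℝ) < ε / 3 by positivity))] with m hm
  rw [dist_zero_right]
  have h1 : ‖cfc (q m) (S m) z - cfc (p m) (S m) z‖ ≤ ε' * ‖z‖ := by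
    rw [← ContinuousLinearMap.sub_apply]
    exact ContinuousLinearMap.le_of_opNorm_le _ (cfc_near (hS m).isSelfAdjoint (sS m) (hqc m) (pc m) hε'p.le (pq m)) z
  have h2 : ‖cfc (q m) Y z - cfc (p m) Y z‖ ≤ ε' * ‖z‖ := by
    rw [← ContinuousLinearMap.sub_apply]
    exact ContinuousLinearMap.le_of_opNorm_le _ (cfc_near hY.isSelfAdjoint sY (hqc m) (pc m) hε'p.le (pq m)) z
  have h3 : ‖cfc (p m) (S m) z - cfc (p m) Y z‖ ≤ ∑ j ∈ Finset.range N, B * ‖cfc (u j) (S m) z - cfc (u j) Y z‖ := by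
    rw [pe _ (sS m), pe _ sY, ContinuousLinearMap.sum_apply, ContinuousLinearMap.sum_apply, ← Finset.sum_sub_distrib]
    refine (norm_sum_le _ _).trans (Finset.sum_le_sum fun j _ => ?_)
    rw [ContinuousLinearMap.smul_apply, ContinuousLinearMap.smul_apply, ← smul_sub, norm_smul]
    exact mul_le_mul_of_nonneg_right (hqB m _ (ht j hR0)) (norm_nonneg _)
  have e : cfc (q m) (S m) z - cfc (q m) Y z = (cfc (q m) (S m) z - cfc (p m) (S m) z) +
    (cfc (p m) (S m) z - cfc (p m) Y z) - (cfc (q m) Y z - cfc (p m) Y z) := by abel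
  rw [e]
  have h4 : ε' * ‖z‖ < ε / 3 := by
    rw [hε', div_mul_eq_mul_div, div_lt_div_iff₀ (by positivity) (by norm_num)]
    nlinarith [norm_nonneg z]
  refine (norm_sub_le _ _).trans_lt ?_
  have := norm_add_le (cfc (q m) (S m) z - cfc (p m) (S m) z) (cfc (p m) (S m) z - cfc (p m) Y z)
  linarith

theorem q_mod {Y : H →L[ℂ] H} (hY : 0 ≤ Y) {e : H} (he : (⟪e, Y e⟫_ℂ).re = 1) {s s' : ℝ} (hs : 0 ≤ s)
    (hss : s ≤ s') (hs' : s' ≤ ‖Y‖) :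
    (s' * √(2 / chi Y e s') - s * √(2 / chi Y e s)) ^ 2 ≤ 12 * ‖Y‖ ^ 2 * (s' - s) := by
  have s'0 : 0 ≤ s' := hs.trans hss
  have c := chi_pos hY he hs
  have c' := chi_pos hY he s'0
  set x := chi Y e s
  set x' := chi Y e s'
  have a1 : x' ≤ x := chi_anti hY e hs hss
  have a2 : s * x ≤ s' * x' := xchi_mono hY e hs hss
  have a3 : 2 / x' ≤ 4 * ‖Y‖ := by
    have := chi_ge hY he s'0 (le_refl ‖Y‖)
    rw [div_le_iff₀ c']
    change 1 ≤ (s' + ‖Y‖) * x' at this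
    nlinarith
  have m1 : 2 / x ≤ 2 / x' := div_le_div_of_nonneg_left (by norm_num) c' a1
  have m2 : s * (2 / x') ≤ s' * (2 / x) := by
    rw [mul_div_assoc', mul_div_assoc', div_le_div_iff₀ c' c]; nlinarith
  set p := √(2 / x) with hp
  set p' := √(2 / x') with hp'
  have p0 : 0 ≤ p := Real.sqrt_nonneg _
  have p'0 : 0 ≤ p' := Real.sqrt_nonneg _
  have pp : p ^ 2 = 2 / x := Real.sq_sqrt (by positivity)
  have pp' : p' ^ 2 = 2 / x' := Real.sq_sqrt (by positivity)
  have p1 : p ≤ p' := Real.sqrt_le_sqrt m1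
  rw [← pp, ← pp'] at m2
  rw [← pp'] at a3
  have q1 : s * p ≤ s' * p' := mul_le_mul hss p1 p0 s'0
  have q2 : (s' * p' - s * p) ^ 2 ≤ (s' * p') ^ 2 - (s * p) ^ 2 := by
    nlinarith [mul_nonneg hs p0]
  refine q2.trans ?_
  have h0 : s' * ((s' * p') ^ 2 - (s * p) ^ 2) ≤ s' * (12 * ‖Y‖ ^ 2 * (s' - s)) := by
    have b1 : s' * ((s' * p') ^ 2 - (s * p) ^ 2) ≤ (s' ^ 3 - s ^ 3) * p' ^ 2 := by
      have := mul_le_mul_of_nonneg_left m2 (sq_nonneg s)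
      nlinarith
    have b2 : s' ^ 3 - s ^ 3 ≤ 3 * s' ^ 2 * (s' - s) := by
      have : s' ^ 3 - s ^ 3 = (s' - s) * (s' ^ 2 + s' * s + s ^ 2) := by ring
      rw [this]
      have : s' ^ 2 + s' * s + s ^ 2 ≤ 3 * s' ^ 2 := by nlinarith
      nlinarith [sub_nonneg.2 hss]
    have d0 : 0 ≤ s' - s := sub_nonneg.2 hss
    have y0 : 0 ≤ ‖Y‖ := norm_nonneg Y
    calc _ ≤ (s' ^ 3 - s ^ 3) * p' ^ 2 := b1
      _ ≤ (3 * s' ^ 2 * (s' - s)) * (4 * ‖Y‖) := mul_le_mul b2 a3 (sq_nonneg _) (by positivity)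
      _ = (12 * ‖Y‖ * s' * (s' - s)) * s' := by ring
      _ ≤ (12 * ‖Y‖ * s' * (s' - s)) * ‖Y‖ := mul_le_mul_of_nonneg_left hs' (by positivity)
      _ = _ := by ring
  rcases s'0.eq_or_lt with h | h
  · have : s = 0 := le_antisymm (by rw [h]; exact hss) hs
    rw [← h, this]; simp
  · exact le_of_mul_le_mul_left h0 h

end P12
end Leu
end F12

section F13
open Filter Topology ComplexOrder InnerProductSpace
open scoped ContinuousLinearMap
namespace Leu
section P13
variable {H : Type*} [NormedAddCommGroup H] [InnerProductSpace ℂ H] [CompleteSpace H]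

theorem st_ker_range {ι : Type*} {l : Filter ι} {Y : H →L[ℂ] H} (hsa : IsSelfAdjoint Y) {A : ι → H →L[ℂ] H}
    {A0 : H →L[ℂ] H} {C : ℝ}
    (hC : ∀ i, ‖A i‖ ≤ C) (hr : ∀ x, Tendsto (fun i => A i (Y x)) l (𝓝 (A0 (Y x))))
    (hk : ∀ x, Y x = 0 → Tendsto (fun i => A i x) l (𝓝 (A0 x))) (x : H) :
    Tendsto (fun i => A i x) l (𝓝 (A0 x)) := by
  let K := LinearMap.ker Y.toLinearMap
  let P : H →L[ℂ] H := K.starProjection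
  have h1 : Tendsto (fun i => A i (P x)) l (𝓝 (A0 (P x))) := hk _ (K.starProjection_apply_mem x)
  have h2 : x - P x ∈ closure (Set.range Y) := by
    refine mem_closure_range_of_orth hsa fun k hk => ?_
    have := K.starProjection_inner_eq_zero x k hk
    rw [← inner_conj_symm, this, map_zero]
  have h3 := st_closure hC (s := Set.range Y) (by rintro _ ⟨y, rfl⟩; exact hr y) h2
  have h4 := h3.add h1
  simpa only [← map_add, sub_add_cancel] using h4

theorem norm_v_le {Y : H →L[ℂ] H} (hY : 0 ≤ Y) {e : H} (he : (⟪e, Y e⟫_ℂ).re = 1) :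
    ‖Y e‖ ≤ ‖CFC.sqrt Y‖ := by
  have h1 : Y e = CFC.sqrt Y (CFC.sqrt Y e) := by
    rw [← ContinuousLinearMap.mul_apply, CFC.sqrt_mul_sqrt_self Y]
  have h2 : ‖CFC.sqrt Y e‖ = 1 := by
    have := norm_sqrt_apply hY e
    rw [← inner_conj_symm, Complex.conj_re, he] at this
    nlinarith [norm_nonneg (CFC.sqrt Y e)]
  rw [h1]
  refine ((CFC.sqrt Y).le_opNorm _).trans ?_
  rw [h2, mul_one]

theorem closeness {Y : H →L[ℂ] H} (hY : 0 ≤ Y) {e : ℕ → H} (he : ∀ m, (⟪e m, Y (e m)⟫_ℂ).re = 1)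
    (hk : ∀ m, ∀ k, Y k = 0 → ⟪k, e m⟫_ℂ = 0)
    (hw : ∀ z, Tendsto (fun m => ⟪Y (e m), z⟫_ℂ) atTop (𝓝 0)) :
    ∃ V : ℕ → H ≃ₗᵢ[ℂ] H,
      (∀ m x, ‖(Y - rankOne ℂ (Y (e m)) (Y (e m))) x‖ ≤ ‖Y (V m x)‖) ∧
      ∀ x, Tendsto (fun m => V m x) atTop (𝓝 x) := by
  have hsa := hY.isSelfAdjoint
  let S : ℕ → H →L[ℂ] H := fun m => Y - rankOne ℂ (Y (e m)) (Y (e m))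
  have := fun m => onestep hY (he m) (hk m) (S := S m) rfl
  choose V D2 hV1 hV2 hV3 hV4 hV5 using this
  refine ⟨V, hV1, ?_⟩
  let v : ℕ → H := fun m => Y (e m)
  have nv : ∀ m, ‖v m‖ ≤ ‖CFC.sqrt Y‖ := fun m => norm_v_le hY (he m)
  have hS0 : ∀ m, 0 ≤ S m := fun m => sub_rank_nonneg hY (he m)
  have hSY : ∀ m, S m ≤ Y := fun m => by
    refine sub_le_self _ ?_
    rw [ContinuousLinearMap.nonneg_iff_isPositive]
    exact isPositive_rankOne_self _
  have hSn : ∀ m, ‖S m‖ ≤ ‖Y‖ := fun m => CStarAlgebra.norm_le_norm_of_nonneg_of_le (hS0 m) (hSY m)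
  have lv : ∀ z, Tendsto (fun m => ⟪v m, z⟫_ℂ • v m) atTop (𝓝 0) := fun z => by
    rw [tendsto_zero_iff_norm_tendsto_zero]
    have h1 : Tendsto (fun m => ‖⟪v m, z⟫_ℂ‖ * ‖CFC.sqrt Y‖) atTop (𝓝 0) := by
      have := (hw z).norm.mul_const ‖CFC.sqrt Y‖
      simpa using this
    refine squeeze_zero (fun _ => norm_nonneg _) (fun m => ?_) h1
    rw [norm_smul]
    exact mul_le_mul_of_nonneg_left (nv m) (norm_nonneg _)
  have Sx : ∀ m x, S m x = Y x - ⟪v m, x⟫_ℂ • v m := fun m x => by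
    simp [S, v]
  have lS : ∀ x, Tendsto (fun m => S m x) atTop (𝓝 (Y x)) := fun x => by
    have := (tendsto_const_nhds (x := Y x)).sub (lv x)
    simpa [Sx] using this
  let q : ℕ → ℝ → ℝ := fun m s => s * √(2 / chi Y (e m) (max s 0))
  let d : ℕ → ℝ → ℝ := fun m y => √(2 * y * y * chi Y (e m) (max y 0))
  have cc : ∀ m, Continuous fun s => chi Y (e m) (max s 0) := fun m =>
    (chi_cont hY (hk m)).comp_continuous (by fun_prop) fun x => le_max_right x 0
  have cp : ∀ m s, 0 < chi Y (e m) (max s 0) := fun m s => chi_pos hY (he m) (le_max_right s 0)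
  have qc : ∀ m, Continuous (q m) := fun m =>
    continuous_id.mul (Real.continuous_sqrt.comp (Continuous.div continuous_const (cc m) fun s => (cp m s).ne'))
  have dc : ∀ m, Continuous (d m) := fun m => by
    have := cc m
    exact Real.continuous_sqrt.comp (by fun_prop)
  have nD1 : ∀ m, ‖cfc (d m) Y‖ ≤ √(2 * ‖Y‖) := fun m => by
    refine norm_cfc_le (by positivity) fun y hy => ?_
    have hy' := spec_Icc hY le_rfl hy
    have y0 := hy'.1
    have y1 := hy'.2
    rw [Real.norm_eq_abs, abs_of_nonneg (Real.sqrt_nonneg _)]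
    refine Real.sqrt_le_sqrt ?_
    rw [max_eq_left y0]
    rcases y0.eq_or_lt with h | h
    · rw [← h]; simp
    · have h1 := gam_chi hY (he m) h
      have h2 := gam_nn hY (Y (e m)) h
      have h3 : y * chi Y (e m) y ≤ 1 := by linarith
      calc 2 * y * y * chi Y (e m) y = 2 * y * (y * chi Y (e m) y) := by ring
        _ ≤ 2 * y * 1 := mul_le_mul_of_nonneg_left h3 (by positivity)
        _ ≤ 2 * ‖Y‖ := by linarith
  have dq : ∀ m, cfc (d m) Y * cfc (q m) Y = (Y + Y) * Y := fun m => by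
    have c2 : ContinuousOn (fun x : ℝ => x + x) (spectrum ℝ Y) := by fun_prop
    have c1 : ContinuousOn (fun x : ℝ => x) (spectrum ℝ Y) := by fun_prop
    have e1 : (Y + Y) * Y = cfc (fun x : ℝ => (x + x) * x) Y := by
      rw [cfc_mul (fun x : ℝ => x + x) (fun x : ℝ => x) Y c2 c1, cfc_add (a := Y) (fun x : ℝ => x) (fun x : ℝ => x) c1 c1, cfc_id' ℝ Y]
    rw [e1, ← cfc_mul (d m) (q m) Y (dc m).continuousOn (qc m).continuousOn]
    refine cfc_congr fun y hy => ?_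
    have y0 := spectrum_nonneg_of_nonneg hY hy
    have hp := cp m y
    set x := chi Y (e m) (max y 0) with hx
    change √(2 * y * y * x) * (y * √(2 / x)) = (y + y) * y
    rw [show √(2 * y * y * x) * (y * √(2 / x)) = y * (√(2 * y * y * x) * √(2 / x)) by ring,
      ← Real.sqrt_mul (by positivity), show 2 * y * y * x * (2 / x) = (2 * y) * (2 * y) by field_simp,
      Real.sqrt_mul_self (by positivity)]
    ring
  have hq : ∀ ε, 0 < ε → ∃ h, 0 < h ∧ ∀ m, ∀ x ∈ Set.Icc 0 ‖Y‖, ∀ y ∈ Set.Icc 0 ‖Y‖, |x - y| ≤ h →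
      |q m x - q m y| ≤ ε := by
    intro ε hε
    refine ⟨ε ^ 2 / (12 * ‖Y‖ ^ 2 + 1), by positivity, ?_⟩
    have key : ∀ m, ∀ x y : ℝ, 0 ≤ x → x ≤ y → y ≤ ‖Y‖ → y - x ≤ ε ^ 2 / (12 * ‖Y‖ ^ 2 + 1) →
        |q m y - q m x| ≤ ε := by
      intro m x y x0 xy yR h
      have h1 := q_mod hY (he m) x0 xy yR
      rw [le_div_iff₀ (by positivity)] at h
      have e1 : q m y = y * √(2 / chi Y (e m) y) := by simp [q, max_eq_left (x0.trans xy)]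
      have e2 : q m x = x * √(2 / chi Y (e m) x) := by simp [q, max_eq_left x0]
      rw [e1, e2]
      refine abs_le_of_sq_le_sq ?_ hε.le
      have : 0 ≤ y - x := sub_nonneg.2 xy
      nlinarith
    intro m x hx y hy hxy
    rcases le_total x y with h | h
    · rw [abs_sub_comm] at hxy ⊢
      exact key m x y hx.1 h hy.2 ((le_abs_self _).trans hxy)
    · exact key m y x hy.1 h hx.2 ((le_abs_self _).trans hxy)
  have hqB : ∀ m, ∀ x ∈ Set.Icc 0 ‖Y‖, |q m x| ≤ √(12 * ‖Y‖ ^ 2 * ‖Y‖) := fun m x hx => by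
    have h1 := q_mod hY (he m) le_rfl hx.1 hx.2
    have e1 : q m x = x * √(2 / chi Y (e m) x) := by simp [q, max_eq_left hx.1]
    have x1 := hx.2
    refine Real.abs_le_sqrt ?_
    rw [e1]
    simp only [zero_mul, sub_zero] at h1
    refine h1.trans (mul_le_mul_of_nonneg_left x1 (by positivity))
  have lq : ∀ z, Tendsto (fun m => cfc (q m) (S m) z - cfc (q m) Y z) atTop (𝓝 0) := fun z =>
    st_equi (norm_nonneg Y) hS0 hY hSn le_rfl lS (fun m => (qc m).continuousOn) hqB hq z
  have bdd0 : ∀ (T : ℕ → H →L[ℂ] H) (C : ℝ), (∀ m, ‖T m‖ ≤ C) → ∀ x : ℕ → H, Tendsto x atTop (𝓝 0) →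
      Tendsto (fun m => T m (x m)) atTop (𝓝 0) := by
    intro T C hT x hx
    rw [tendsto_zero_iff_norm_tendsto_zero]
    have h1 : Tendsto (fun m => C * ‖x m‖) atTop (𝓝 0) := by
      have := hx.norm.const_mul C
      simpa using this
    exact squeeze_zero (fun _ => norm_nonneg _) (fun m => (T m).le_of_opNorm_le (hT m) _) h1
  let A : ℕ → H →L[ℂ] H := fun m => cfc (d m) Y * D2 m
  have nA : ∀ m, ‖A m‖ ≤ √(2 * ‖Y‖) * (4 * √‖Y‖) := fun m =>
    (norm_mul_le _ _).trans (mul_le_mul (nD1 m) (hV5 m) (norm_nonneg _) (Real.sqrt_nonneg _))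
  have Ae : ∀ m x, A m x = Y (V m x) + V m (S m x) := fun m x => (hV3 m x).symm
  have lA : ∀ x, Tendsto (fun m => A m x) atTop (𝓝 ((Y + Y) x)) := by
    refine st_ker_range hsa nA (fun z => ?_) fun x hx => ?_
    · have e1 : ∀ m, A m (Y z) = (Y + Y) (Y z) + (cfc (d m) Y (cfc (q m) (S m) z - cfc (q m) Y z) +
          A m (⟪v m, z⟫_ℂ • v m)) := fun m => by
        have h1 : Y z = S m z + ⟪v m, z⟫_ℂ • v m := by rw [Sx]; abel
        have h2 : A m (S m z) = cfc (d m) Y (cfc (q m) (S m) z) := by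
          change cfc (d m) Y (D2 m (S m z)) = _
          rw [← ContinuousLinearMap.mul_apply (D2 m), hV4]
        have h3 : cfc (d m) Y (cfc (q m) Y z) = (Y + Y) (Y z) := by
          rw [← ContinuousLinearMap.mul_apply, dq]; rfl
        have h4 : A m (Y z) = A m (S m z) + A m (⟪v m, z⟫_ℂ • v m) := by
          rw [← map_add, ← h1]
        rw [h4, h2, ← h3, map_sub]; abel
      simp only [e1]
      have := (bdd0 _ _ nD1 _ (lq z)).add (bdd0 _ _ nA _ (lv z))
      simpa using (tendsto_const_nhds (x := (Y + Y) (Y z))).add this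
    · have e1 : ∀ m, A m x = (Y + Y) x := fun m => by
        rw [Ae, hV2 m x hx, hx, ker_le_of_le (hS0 m) (hSY m) hx]; simp [hx]
      simp only [e1]
      exact tendsto_const_nhds
  have lZ : ∀ x, Tendsto (fun m => Y (V m x) + V m (Y x)) atTop (𝓝 (Y x + Y x)) := fun x => by
    have h1 : Tendsto (fun m => V m (Y x - S m x)) atTop (𝓝 0) := by
      rw [tendsto_zero_iff_norm_tendsto_zero]
      have h2 := (tendsto_const_nhds (x := Y x)).sub (lS x)
      rw [sub_self, tendsto_zero_iff_norm_tendsto_zero] at h2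
      refine h2.congr fun m => ?_
      rw [LinearIsometryEquiv.norm_map]
    have h3 := (lA x).add h1
    rw [add_zero] at h3
    refine h3.congr fun m => ?_
    rw [Ae, map_sub]; abel
  have lK : ∀ x, Tendsto (fun m => Y (V m x - x) + (V m (Y x) - Y x)) atTop (𝓝 0) := fun x => by
    have := (lZ x).sub (tendsto_const_nhds (x := Y x + Y x))
    rw [sub_self] at this
    refine this.congr fun m => ?_
    rw [map_sub]; abel
  have lI : ∀ x, Tendsto (fun m => (⟪Y (V m x - x), V m x - x⟫_ℂ).re) atTop (𝓝 0) := fun x => by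
    have h1 : Tendsto (fun m => (⟪Y (V m x - x) + (V m (Y x) - Y x), V m x - x⟫_ℂ).re) atTop (𝓝 0) := by
      have h2 : Tendsto (fun m => ‖Y (V m x - x) + (V m (Y x) - Y x)‖ * (2 * ‖x‖)) atTop (𝓝 0) := by
        have := (lK x).norm.mul_const (2 * ‖x‖)
        simpa using this
      refine squeeze_zero_norm (fun m => ?_) h2
      refine (Complex.abs_re_le_norm _).trans ((norm_inner_le_norm _ _).trans ?_)
      refine mul_le_mul_of_nonneg_left ?_ (norm_nonneg _)
      refine (norm_sub_le _ _).trans ?_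
      rw [LinearIsometryEquiv.norm_map]; linarith
    have h3 : Tendsto (fun m => (⟪Y (V m x) + V m (Y x), x⟫_ℂ).re) atTop (𝓝 ((⟪Y x + Y x, x⟫_ℂ).re)) := by
      have h4 : Continuous fun y : H => (⟪y, x⟫_ℂ).re := by fun_prop
      exact (h4.tendsto _).comp (lZ x)
    have h5 := (h1.add h3).sub (tendsto_const_nhds (x := (⟪Y x + Y x, x⟫_ℂ).re))
    rw [zero_add, sub_self] at h5
    refine h5.congr fun m => ?_
    have e1 : ⟪V m (Y x), V m x⟫_ℂ = ⟪Y x, x⟫_ℂ := LinearIsometryEquiv.inner_map_map _ _ _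
    have e2 : (⟪Y (V m x), x⟫_ℂ).re = (⟪Y x, V m x⟫_ℂ).re := by
      rw [sa_symm hsa, ← inner_conj_symm, Complex.conj_re]
    simp only [inner_add_left, inner_sub_left, inner_sub_right, e1, Complex.add_re, Complex.sub_re, e2]
    ring
  have lY : ∀ x, Tendsto (fun m => Y (V m x - x)) atTop (𝓝 0) := fun x => by
    have h1 : Tendsto (fun m => CFC.sqrt Y (V m x - x)) atTop (𝓝 0) := by
      rw [tendsto_zero_iff_norm_tendsto_zero]
      have h2 := (Real.continuous_sqrt.tendsto 0).comp (lI x)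
      rw [Real.sqrt_zero] at h2
      refine h2.congr fun m => ?_
      change √((⟪Y (V m x - x), V m x - x⟫_ℂ).re) = _
      rw [← norm_sqrt_apply hY, Real.sqrt_sq (norm_nonneg _)]
    have h2 := bdd0 (fun _ => CFC.sqrt Y) ‖CFC.sqrt Y‖ (fun _ => le_rfl) _ h1
    refine h2.congr fun m => ?_
    rw [← ContinuousLinearMap.mul_apply, CFC.sqrt_mul_sqrt_self Y]
  have lVY : ∀ x, Tendsto (fun m => V m (Y x)) atTop (𝓝 (Y x)) := fun x => by
    have h1 := ((lK x).sub (lY x)).add (tendsto_const_nhds (x := Y x))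
    rw [sub_zero, zero_add] at h1
    refine h1.congr fun m => ?_
    abel
  have fin := st_ker_range hsa (A := fun m => (V m).toLinearIsometry.toContinuousLinearMap)
    (A0 := ContinuousLinearMap.id ℂ H) (C := 1) (l := atTop)
    (fun m => LinearIsometry.norm_toContinuousLinearMap_le _) (fun x => lVY x) (fun x hx => by
      have : ∀ m, (V m).toLinearIsometry.toContinuousLinearMap x = x := fun m => hV2 m x hx
      simp only [this]
      exact tendsto_const_nhds)
  exact fin

end P13
end Leu
end F13

section F14
open Filter Topology ComplexOrder InnerProductSpace
open scoped ContinuousLinearMap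
namespace Leu
section P14
variable {H : Type*} [NormedAddCommGroup H] [InnerProductSpace ℂ H] [CompleteSpace H]

abbrev kr (Y : H →L[ℂ] H) : Submodule ℂ H := LinearMap.ker Y.toLinearMap

theorem mem_kr {Y : H →L[ℂ] H} {x : H} : x ∈ kr Y ↔ Y x = 0 := Iff.rfl

theorem inner_shift {T : H →L[ℂ] H} (hT : IsSelfAdjoint T) {e : H} (he : T e = 0) (x : H) (c : ℂ) :
    ⟪T (x - c • e), x - c • e⟫_ℂ = ⟪T x, x⟫_ℂ := by
  have h1 : T (x - c • e) = T x := by simp [he]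
  rw [h1, inner_sub_right, inner_smul_right, sa_symm hT x e, he]; simp

theorem inner_Yee {Y : H →L[ℂ] H} (hY : 0 ≤ Y) {e : H} (he : (⟪e, Y e⟫_ℂ).re = 1) : ⟪Y e, e⟫_ℂ = 1 := by
  have h := inner_apply_self_nonneg hY e
  apply Complex.ext
  · rw [← inner_conj_symm, Complex.conj_re, he]; simp
  · have := (Complex.nonneg_iff.1 h).2
    simpa using this.symm

theorem le_sub_rank {X Y : H →L[ℂ] H} (hX : 0 ≤ X) (hXY : X ≤ Y) {e : H} (he : (⟪e, Y e⟫_ℂ).re = 1)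
    (hXe : X e = 0) : X ≤ Y - rankOne ℂ (Y e) (Y e) := by
  have hY := hX.trans hXY
  have hS := sub_rank_nonneg hY he
  have hSe := sub_rank_apply_self hY he
  rw [le_iff_re hX.isSelfAdjoint hS.isSelfAdjoint]
  intro x
  set c := ⟪Y e, x⟫_ℂ with hc
  rw [← inner_shift hX.isSelfAdjoint hXe x c, ← inner_shift hS.isSelfAdjoint hSe x c]
  have : (Y - rankOne ℂ (Y e) (Y e)) (x - c • e) = Y (x - c • e) := by
    have : ⟪Y e, x - c • e⟫_ℂ = 0 := by
      rw [inner_sub_right, inner_smul_right, inner_Yee hY he, ← hc]; simp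
    rw [ContinuousLinearMap.sub_apply, InnerProductSpace.rankOne_apply, this]; simp
  rw [this]
  exact (le_iff_re hX.isSelfAdjoint hY.isSelfAdjoint).1 hXY _

theorem sub_rank_le (Y : H →L[ℂ] H) (e : H) : Y - rankOne ℂ (Y e) (Y e) ≤ Y := by
  refine sub_le_self _ ?_
  rw [ContinuousLinearMap.nonneg_iff_isPositive]
  exact isPositive_rankOne_self _

theorem ker_lt_sub_rank {Y : H →L[ℂ] H} (hY : 0 ≤ Y) {e : H} (he : (⟪e, Y e⟫_ℂ).re = 1) :
    kr Y < kr (Y - rankOne ℂ (Y e) (Y e)) := by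
  have hS := sub_rank_nonneg hY he
  refine lt_of_le_of_ne (fun x hx => ker_le_of_le hS (sub_rank_le Y e) hx) fun h => ?_
  have h1 : e ∈ kr (Y - rankOne ℂ (Y e) (Y e)) := sub_rank_apply_self hY he
  rw [← h, mem_kr] at h1
  rw [h1] at he
  simp at he

theorem ker_sub_rank_fd {Y : H →L[ℂ] H} {e : H} (hf : FiniteDimensional ℂ (kr Y)) :
    FiniteDimensional ℂ (kr (Y - rankOne ℂ (Y e) (Y e))) := by
  have h : kr (Y - rankOne ℂ (Y e) (Y e)) ≤ kr Y ⊔ Submodule.span ℂ {e} := by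
    intro x hx
    rw [mem_kr, ContinuousLinearMap.sub_apply, InnerProductSpace.rankOne_apply, sub_eq_zero] at hx
    have h1 : x - ⟪Y e, x⟫_ℂ • e ∈ kr Y := by
      rw [mem_kr, map_sub, map_smul, ← hx, sub_self]
    have h2 := Submodule.add_mem_sup h1 (Submodule.smul_mem _ ⟪Y e, x⟫_ℂ (Submodule.mem_span_singleton_self (R := ℂ) e))
    rwa [sub_add_cancel] at h2
  exact Submodule.finiteDimensional_of_le h

theorem sqDom_sub_rank {Y : H →L[ℂ] H} (hY : 0 ≤ Y) {e : H} (he : (⟪e, Y e⟫_ℂ).re = 1)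
    (hk : ∀ k, Y k = 0 → ⟪k, e⟫_ℂ = 0) : SqDom (Y - rankOne ℂ (Y e) (Y e)) Y := by
  obtain ⟨V, _, hV, _⟩ := onestep hY he hk rfl
  exact ⟨V, hV⟩

theorem beta_aux (n : ℕ) {X : H →L[ℂ] H} (hX : 0 ≤ X) (hf : FiniteDimensional ℂ (kr X)) :
    ∀ Y : H →L[ℂ] H, X ≤ Y → Module.finrank ℂ (kr X) ≤ Module.finrank ℂ (kr Y) + n → SqDom X Y := by
  induction n with
  | zero =>
    intro Y hXY hn
    refine sqDom_of_ker_eq hX hXY fun x hx => ?_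
    have hle : kr Y ≤ kr X := fun x hx => ker_le_of_le hX hXY hx
    have := Submodule.eq_of_le_of_finrank_le hle (by simpa using hn)
    have hx' : x ∈ kr X := hx
    rw [← this] at hx'
    exact hx'
  | succ n ih =>
    intro Y hXY hn
    have hY := hX.trans hXY
    by_cases hker : ∀ x, X x = 0 → Y x = 0
    · exact sqDom_of_ker_eq hX hXY hker
    push Not at hker
    obtain ⟨e0, h0, h1⟩ := hker
    have hle : kr Y ≤ kr X := fun x hx => ker_le_of_le hX hXY hx
    let P : H →L[ℂ] H := (kr Y).starProjection
    have hP : Y (P e0) = 0 := (kr Y).starProjection_apply_mem e0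
    set e1 := e0 - P e0 with he1
    have hXe1 : X e1 = 0 := by
      rw [he1, map_sub, h0, ker_le_of_le hX hXY hP, sub_zero]
    have hYe1 : Y e1 ≠ 0 := by rw [he1, map_sub, hP, sub_zero]; exact h1
    have hk1 : ∀ k, Y k = 0 → ⟪k, e1⟫_ℂ = 0 := fun k hk => by
      have := (kr Y).starProjection_inner_eq_zero e0 k hk
      rw [← inner_conj_symm, this, map_zero]
    have hs : CFC.sqrt Y e1 ≠ 0 := fun h => hYe1 ((sqrt_apply_eq_zero hY).1 h)
    set a := ‖CFC.sqrt Y e1‖ with ha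
    have hap : 0 < a := norm_pos_iff.2 hs
    set e : H := ((a⁻¹ : ℝ) : ℂ) • e1 with he
    have hee : (⟪e, Y e⟫_ℂ).re = 1 := by
      rw [← inner_conj_symm, Complex.conj_re, ← norm_sqrt_apply hY, he, map_smul, norm_smul, ← ha]
      simp [abs_of_pos hap, hap.ne']
    have hXe : X e = 0 := by rw [he, map_smul, hXe1, smul_zero]
    have hke : ∀ k, Y k = 0 → ⟪k, e⟫_ℂ = 0 := fun k hk => by
      rw [he, inner_smul_right, hk1 k hk, mul_zero]
    have hXS := le_sub_rank hX hXY hee hXe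
    have hlt := ker_lt_sub_rank hY hee
    have hfS : FiniteDimensional ℂ (kr (Y - rankOne ℂ (Y e) (Y e))) :=
      Submodule.finiteDimensional_of_le (show _ ≤ kr X from fun x hx => ker_le_of_le hX hXS hx)
    have hlt2 := Submodule.finrank_lt_finrank_of_lt hlt
    exact (ih _ hXS (by omega)).trans (sqDom_sub_rank hY hee hke)

theorem sqDom_beta {X Y : H →L[ℂ] H} (hX : 0 ≤ X) (hXY : X ≤ Y) (hf : FiniteDimensional ℂ (kr X)) :
    SqDom X Y :=
  beta_aux _ hX hf Y hXY (Nat.le_add_left _ _)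

theorem exists_orthonormal_seq {X Y : H →L[ℂ] H} (hX : 0 ≤ X) (hXY : X ≤ Y)
    (hfY : FiniteDimensional ℂ (kr Y)) (hfX : ¬ FiniteDimensional ℂ (kr X)) :
    ∃ e : ℕ → H, (∀ m, X (e m) = 0) ∧ (∀ m, ∀ k, Y k = 0 → ⟪k, e m⟫_ℂ = 0) ∧
      Orthonormal ℂ fun m => CFC.sqrt Y (e m) := by
  have hY := hX.trans hXY
  let N : Submodule ℂ H := kr X ⊓ (kr Y)ᗮ
  have hN : ¬ FiniteDimensional ℂ N := fun h => hfX <| by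
    have hle : kr X ≤ N ⊔ kr Y := fun x hx => by
      have h1 : x - (kr Y).starProjection x ∈ N := by
        refine ⟨?_, ?_⟩
        · refine Submodule.sub_mem _ hx (ker_le_of_le hX hXY ((kr Y).starProjection_apply_mem x))
        · rw [SetLike.mem_coe, Submodule.mem_orthogonal]
          intro k hk
          have := (kr Y).starProjection_inner_eq_zero x k hk
          rw [← inner_conj_symm, this, map_zero]
      have h2 := Submodule.add_mem_sup h1 ((kr Y).starProjection_apply_mem x)
      rwa [sub_add_cancel] at h2
    exact Submodule.finiteDimensional_of_le hle
  let R : N →ₗ[ℂ] H := (CFC.sqrt Y).toLinearMap ∘ₗ N.subtype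
  have hR : R.ker = ⊥ := by
    rw [LinearMap.ker_eq_bot']
    intro x hx
    have h1 : CFC.sqrt Y (x : H) = 0 := hx
    have h2 : (x : H) ∈ kr Y := (sqrt_apply_eq_zero hY).1 h1
    have h3 := (Submodule.mem_orthogonal _ _).1 x.2.2 _ h2
    rw [inner_self_eq_zero] at h3
    exact Subtype.ext h3
  let b := Module.Basis.ofVectorSpace ℂ N
  have hinf : Infinite (Module.Basis.ofVectorSpaceIndex ℂ N) := by
    rw [← not_finite_iff_infinite]
    intro h
    exact hN (Module.Finite.of_basis b)
  let em := Infinite.natEmbedding (Module.Basis.ofVectorSpaceIndex ℂ N)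
  let f : ℕ → H := fun n => R (b (em n))
  have hf : LinearIndependent ℂ f := (b.linearIndependent.comp em em.injective).map' R hR
  have hon := gramSchmidtNormed_orthonormal hf
  have hmem : ∀ n, gramSchmidtNormed ℂ f n ∈ R.range := fun n => by
    have h1 : gramSchmidt ℂ f n ∈ R.range := by
      have := gramSchmidt_mem_span ℂ f (le_refl n)
      refine Submodule.span_le.2 ?_ this
      rintro _ ⟨k, _, rfl⟩
      exact ⟨_, rfl⟩
    exact Submodule.smul_mem _ _ h1
  choose e he using hmem
  refine ⟨fun m => (e m : H), fun m => (e m).2.1, fun m k hk => (Submodule.mem_orthogonal _ _).1 (e m).2.2 k hk, ?_⟩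
  have : (fun m => CFC.sqrt Y (e m : H)) = gramSchmidtNormed ℂ f := funext he
  rw [this]
  exact hon

theorem gamma_step {X Y : H →L[ℂ] H} (hX : 0 ≤ X) (hXY : X ≤ Y)
    (hfY : FiniteDimensional ℂ (kr Y)) (hfX : ¬ FiniteDimensional ℂ (kr X)) (F : Finset H) {ε : ℝ} (hε : 0 < ε) :
    ∃ (S : H →L[ℂ] H) (V : H ≃ₗᵢ[ℂ] H), X ≤ S ∧ S ≤ Y ∧ kr Y < kr S ∧ FiniteDimensional ℂ (kr S) ∧
      (∀ x, ‖S x‖ ≤ ‖Y (V x)‖) ∧ ∀ φ ∈ F, ‖V φ - φ‖ ≤ ε ∧ ‖S φ - Y φ‖ ≤ ε := by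
  have hY := hX.trans hXY
  obtain ⟨e, he1, he2, he3⟩ := exists_orthonormal_seq hX hXY hfY hfX
  have sR : IsSelfAdjoint (CFC.sqrt Y) := (CFC.sqrt_nonneg Y).isSelfAdjoint
  have he : ∀ m, (⟪e m, Y (e m)⟫_ℂ).re = 1 := fun m => by
    rw [← inner_conj_symm, Complex.conj_re, ← norm_sqrt_apply hY]
    have := he3.1 m
    rw [this]; norm_num
  have hw : ∀ z, Tendsto (fun m => ⟪Y (e m), z⟫_ℂ) atTop (𝓝 0) := fun z => by
    have h1 := (he3.inner_products_summable (CFC.sqrt Y z)).tendsto_atTop_zero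
    rw [tendsto_zero_iff_norm_tendsto_zero]
    have h2 := (Real.continuous_sqrt.tendsto 0).comp h1
    rw [Real.sqrt_zero] at h2
    refine h2.congr fun m => ?_
    change √(‖_‖ ^ 2) = _
    rw [Real.sqrt_sq (norm_nonneg _), ← sa_symm sR, ← ContinuousLinearMap.mul_apply, CFC.sqrt_mul_sqrt_self Y]
  obtain ⟨V, hV1, hV2⟩ := closeness hY he he2 hw
  have hS : ∀ x, Tendsto (fun m => (Y - rankOne ℂ (Y (e m)) (Y (e m))) x - Y x) atTop (𝓝 0) := fun x => by
    rw [tendsto_zero_iff_norm_tendsto_zero]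
    have h1 : Tendsto (fun m => ‖⟪Y (e m), x⟫_ℂ‖ * ‖CFC.sqrt Y‖) atTop (𝓝 0) := by
      have := (hw x).norm.mul_const ‖CFC.sqrt Y‖
      simpa using this
    refine squeeze_zero (fun _ => norm_nonneg _) (fun m => ?_) h1
    rw [ContinuousLinearMap.sub_apply, sub_sub_cancel_left, norm_neg, InnerProductSpace.rankOne_apply, norm_smul]
    exact mul_le_mul_of_nonneg_left (norm_v_le hY (he m)) (norm_nonneg _)
  have ev : ∀ᶠ m in atTop, ∀ φ ∈ F, ‖V m φ - φ‖ ≤ ε ∧ ‖(Y - rankOne ℂ (Y (e m)) (Y (e m))) φ - Y φ‖ ≤ ε := by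
    rw [Filter.eventually_all_finset]
    intro φ _
    have h1 := (tendsto_iff_norm_sub_tendsto_zero.1 (hV2 φ)).eventually (gt_mem_nhds hε)
    have h2 := (tendsto_zero_iff_norm_tendsto_zero.1 (hS φ)).eventually (gt_mem_nhds hε)
    filter_upwards [h1, h2] with m a b using ⟨a.le, b.le⟩
  obtain ⟨m, hm⟩ := ev.exists
  exact ⟨_, V m, le_sub_rank hX hXY (he m) (he1 m), sub_rank_le _ _, ker_lt_sub_rank hY (he m),
    ker_sub_rank_fd hfY, hV1 m, hm⟩

end P14
end Leu
end F14

section F15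
open Filter Topology ComplexOrder InnerProductSpace
open scoped ContinuousLinearMap
namespace Leu
section P15
variable {H : Type*} [NormedAddCommGroup H] [InnerProductSpace ℂ H] [CompleteSpace H]

theorem exists_st_lim {T : ℕ → H →L[ℂ] H} {C : ℝ} (hC : ∀ k, ‖T k‖ ≤ C) {φ : ℕ → H} (hφ : DenseRange φ)
    (h : ∀ k, ∀ j ≤ k, ‖T (k + 1) (φ j) - T k (φ j)‖ ≤ (1 / 2) ^ k) :
    ∃ T0 : H →L[ℂ] H, ∀ x, Tendsto (fun k => T k x) atTop (𝓝 (T0 x)) := by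
  have hC0 : 0 ≤ C := (norm_nonneg _).trans (hC 0)
  have h1 : ∀ j, CauchySeq fun k => T k (φ j) := fun j => by
    have h2 : CauchySeq fun k => T (k + j) (φ j) := by
      refine cauchySeq_of_le_geometric (1 / 2) 1 (by norm_num) fun k => ?_
      rw [dist_comm, dist_eq_norm, show k + 1 + j = (k + j) + 1 by ring, one_mul]
      refine (h (k + j) j (Nat.le_add_left _ _)).trans ?_
      exact pow_le_pow_of_le_one (by norm_num) (by norm_num) (Nat.le_add_right _ _)
    obtain ⟨y, hy⟩ := cauchySeq_tendsto_of_complete h2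
    exact ((tendsto_add_atTop_iff_nat (f := fun k => T k (φ j)) j).1 hy).cauchySeq
  have h2 : ∀ x, CauchySeq fun k => T k x := fun x => by
    rw [Metric.cauchySeq_iff']
    intro ε hε
    obtain ⟨j, hj⟩ := Metric.denseRange_iff.1 hφ x (ε / (4 * (C + 1))) (by positivity)
    obtain ⟨N, hN⟩ := Metric.cauchySeq_iff'.1 (h1 j) (ε / 2) (by positivity)
    refine ⟨N, fun n hn => ?_⟩
    have h3 := hN n hn
    rw [dist_eq_norm] at h3 hj ⊢
    have h4 : ∀ k, ‖T k (x - φ j)‖ ≤ ε / 4 := fun k => by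
      refine ((T k).le_of_opNorm_le (hC k) _).trans ?_
      have h5 : (C + 1) * ‖x - φ j‖ ≤ (C + 1) * (ε / (4 * (C + 1))) :=
        mul_le_mul_of_nonneg_left hj.le (by positivity)
      have h6 : (C + 1) * (ε / (4 * (C + 1))) = ε / 4 := by field_simp
      nlinarith [norm_nonneg (x - φ j)]
    have e : T n x - T N x = T n (x - φ j) + (T n (φ j) - T N (φ j)) - T N (x - φ j) := by
      rw [map_sub, map_sub]; abel
    rw [e]
    have a1 := norm_sub_le (T n (x - φ j) + (T n (φ j) - T N (φ j))) (T N (x - φ j))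
    have a2 := norm_add_le (T n (x - φ j)) (T n (φ j) - T N (φ j))
    have := h4 n
    have := h4 N
    linarith
  choose g hg using fun x => cauchySeq_tendsto_of_complete (h2 x)
  exact ⟨continuousLinearMapOfTendsto T (f := g) (tendsto_pi_nhds.2 hg), hg⟩

set_option maxHeartbeats 1000000 in
theorem sqDom_gamma [TopologicalSpace.SeparableSpace H] {X Y : H →L[ℂ] H} (hX : 0 ≤ X) (hXY : X ≤ Y)
    (hfY : FiniteDimensional ℂ (kr Y)) (hfX : ¬ FiniteDimensional ℂ (kr X)) : SqDom X Y := by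
  classical
  have hY := hX.trans hXY
  let φ := TopologicalSpace.denseSeq H
  have hφ : DenseRange φ := TopologicalSpace.denseRange_denseSeq H
  let Q := {p : H →L[ℂ] H // X ≤ p ∧ FiniteDimensional ℂ (kr p)}
  have step : ∀ (k : ℕ) (p : Q), ∃ (p' : Q) (V : H ≃ₗᵢ[ℂ] H), p'.1 ≤ p.1 ∧ kr p.1 < kr p'.1 ∧
      (∀ x, ‖p'.1 x‖ ≤ ‖p.1 (V x)‖) ∧
      ∀ j ≤ k, ‖V (φ j) - φ j‖ ≤ (1 / 2) ^ k ∧ ‖p'.1 (φ j) - p.1 (φ j)‖ ≤ (1 / 2) ^ k := by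
    intro k p
    obtain ⟨S, V, a1, a2, a3, a4, a5, a6⟩ := gamma_step hX p.2.1 p.2.2 hfX ((Finset.range (k + 1)).image φ)
      (ε := (1 / 2) ^ k) (by positivity)
    refine ⟨⟨S, a1, a4⟩, V, a2, a3, a5, fun j hj => a6 _ ?_⟩
    exact Finset.mem_image_of_mem _ (Finset.mem_range.2 (Nat.lt_succ_of_le hj))
  choose nx V n1 n2 n3 n4 using step
  let p : ℕ → Q := fun n => Nat.rec ⟨Y, hXY, hfY⟩ (fun k q => nx k q) n
  have ps : ∀ k, p (k + 1) = nx k (p k) := fun k => rfl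
  let W : ℕ → H ≃ₗᵢ[ℂ] H := fun n => Nat.rec (LinearIsometryEquiv.refl ℂ H) (fun k w => (V k (p k)).trans w) n
  have p0 : (p 0).1 = Y := rfl
  have W0 : ∀ x, W 0 x = x := fun x => rfl
  have Ws : ∀ k x, W (k + 1) x = W k (V k (p k) x) := fun k x => rfl
  clear_value W
  clear_value p
  have pn : ∀ n, 0 ≤ (p n).1 := fun n => hX.trans (p n).2.1
  have hpW : ∀ n x, ‖(p n).1 x‖ ≤ ‖Y (W n x)‖ := by
    intro n
    induction n with
    | zero => intro x; rw [W0, p0]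
    | succ k ih =>
      intro x
      rw [Ws, ps]
      exact (n3 k (p k) x).trans (ih _)
  have hanti : Antitone fun n => (p n).1 := antitone_nat_of_succ_le fun k => by
    change (p (k + 1)).1 ≤ _
    rw [ps]; exact n1 k (p k)
  have hpY : ∀ n, ‖(p n).1‖ ≤ ‖Y‖ := fun n =>
    CStarAlgebra.norm_le_norm_of_nonneg_of_le (pn n) ((hanti (Nat.zero_le n)).trans_eq p0)
  obtain ⟨Z, hZ⟩ := exists_st_lim hpY hφ fun k j hj => by
    rw [ps]; exact (n4 k (p k) j hj).2
  let Wc : ℕ → H →L[ℂ] H := fun n => (W n).toLinearIsometry.toContinuousLinearMap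
  have hWc : ∀ n, ‖Wc n‖ ≤ 1 := fun n => LinearIsometry.norm_toContinuousLinearMap_le _
  obtain ⟨V0, hV0⟩ := exists_st_lim hWc hφ fun k j hj => by
    change ‖W (k + 1) (φ j) - W k (φ j)‖ ≤ _
    rw [Ws, ← map_sub, LinearIsometryEquiv.norm_map]
    exact (n4 k (p k) j hj).1
  have hV0' : ∀ x, Tendsto (fun n => W n x) atTop (𝓝 (V0 x)) := hV0
  have sZ : IsSelfAdjoint Z := by
    rw [ContinuousLinearMap.isSelfAdjoint_iff_isSymmetric]
    intro x y
    have h1 : Tendsto (fun n => ⟪(p n).1 x, y⟫_ℂ) atTop (𝓝 ⟪Z x, y⟫_ℂ) := (hZ x).inner tendsto_const_nhds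
    have h2 : Tendsto (fun n => ⟪x, (p n).1 y⟫_ℂ) atTop (𝓝 ⟪x, Z y⟫_ℂ) := tendsto_const_nhds.inner (hZ y)
    refine tendsto_nhds_unique h1 (h2.congr fun n => ?_)
    rw [sa_symm (pn n).isSelfAdjoint]
  have hre : ∀ x, Tendsto (fun n => (⟪(p n).1 x, x⟫_ℂ).re) atTop (𝓝 (⟪Z x, x⟫_ℂ).re) := fun x =>
    (Complex.continuous_re.tendsto _).comp ((hZ x).inner tendsto_const_nhds)
  have hXZ : X ≤ Z := by
    rw [le_iff_re hX.isSelfAdjoint sZ]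
    intro x
    exact ge_of_tendsto' (hre x) fun n => (le_iff_re hX.isSelfAdjoint (pn n).isSelfAdjoint).1 (p n).2.1 x
  have hZ0 := hX.trans hXZ
  have hZp : ∀ n, Z ≤ (p n).1 := fun n => by
    rw [le_iff_re sZ (pn n).isSelfAdjoint]
    intro x
    refine le_of_tendsto (hre x) ?_
    filter_upwards [eventually_ge_atTop n] with k hk
    exact (le_iff_re (pn k).isSelfAdjoint (pn n).isSelfAdjoint).1 (hanti hk) x
  have hker : ¬ FiniteDimensional ℂ (kr Z) := by
    intro hfd
    have h1 : ∀ n, n ≤ Module.finrank ℂ (kr (p n).1) := by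
      intro n
      induction n with
      | zero => exact Nat.zero_le _
      | succ k ih =>
        have h2 : kr (p k).1 < kr (p (k + 1)).1 := by rw [ps]; exact n2 k (p k)
        have := (p (k + 1)).2.2
        have := Submodule.finrank_lt_finrank_of_lt h2
        omega
    have h2 : ∀ n, Module.finrank ℂ (kr (p n).1) ≤ Module.finrank ℂ (kr Z) := fun n =>
      Submodule.finrank_mono fun x hx => ker_le_of_le hZ0 (hZp n) hx
    have h3 := (h1 (Module.finrank ℂ (kr Z) + 1)).trans (h2 _)
    exact Nat.not_succ_le_self _ h3
  have nV0 : ∀ x, ‖V0 x‖ = ‖x‖ := fun x => by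
    refine tendsto_nhds_unique (hV0' x).norm ?_
    simp only [LinearIsometryEquiv.norm_map]
    exact tendsto_const_nhds
  refine sqDom_of_isometry hX hXZ V0 ?_ ?_ hker
  · exact (ContinuousLinearMap.norm_map_iff_adjoint_comp_self V0).1 nV0
  · intro ψ
    have key : ∀ x, ‖⟪Z (star V0 ψ), x⟫_ℂ‖ ≤ ‖Y ψ‖ * ‖x‖ := fun x => by
      have h1 : Tendsto (fun n => W n ((p n).1 x)) atTop (𝓝 (V0 (Z x))) := st_mul hWc hV0 hZ x
      have h2 : Tendsto (fun n => ‖⟪ψ, W n ((p n).1 x)⟫_ℂ‖) atTop (𝓝 ‖⟪ψ, V0 (Z x)⟫_ℂ‖) :=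
        (tendsto_const_nhds.inner h1).norm
      have h3 : ⟪Z (star V0 ψ), x⟫_ℂ = ⟪ψ, V0 (Z x)⟫_ℂ := by
        rw [sa_symm sZ, ContinuousLinearMap.star_eq_adjoint, ContinuousLinearMap.adjoint_inner_left]
      rw [h3]
      refine le_of_tendsto' h2 fun n => ?_
      have h4 : ⟪ψ, W n ((p n).1 x)⟫_ℂ = ⟪(p n).1 ((W n).symm ψ), x⟫_ℂ := by
        rw [sa_symm (pn n).isSelfAdjoint, ← LinearIsometryEquiv.inner_map_map (W n) ((W n).symm ψ),
          LinearIsometryEquiv.apply_symm_apply]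
      rw [h4]
      refine (norm_inner_le_norm _ _).trans (mul_le_mul_of_nonneg_right ?_ (norm_nonneg _))
      have := hpW n ((W n).symm ψ)
      rwa [LinearIsometryEquiv.apply_symm_apply] at this
    have h5 := key (Z (star V0 ψ))
    rw [inner_self_eq_norm_sq_to_K] at h5
    simp only [Complex.coe_algebraMap, norm_pow, Complex.norm_real, norm_norm] at h5
    by_contra hlt
    push Not at hlt
    nlinarith [norm_nonneg (Y ψ), norm_nonneg (Z (star V0 ψ))]

theorem sqDom_separable [TopologicalSpace.SeparableSpace H] {X Y : H →L[ℂ] H} (hX : 0 ≤ X) (hXY : X ≤ Y) :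
    SqDom X Y := by
  by_cases h1 : FiniteDimensional ℂ (kr X)
  · exact sqDom_beta hX hXY h1
  by_cases h2 : FiniteDimensional ℂ (kr Y)
  · exact sqDom_gamma hX hXY h2 h1
  · exact sqDom_of_infinite_ker hX hXY h2

end P15
end Leu
end F15

section F16
open Filter Topology ComplexOrder InnerProductSpace
open scoped ContinuousLinearMap
namespace Leu
section P16
variable {H : Type*} [NormedAddCommGroup H] [InnerProductSpace ℂ H] [CompleteSpace H]

/-- restriction of an operator to an invariant subspace -/
noncomputable def rst (X : H →L[ℂ] H) (K : Submodule ℂ H) (h : ∀ x ∈ K, X x ∈ K) : K →L[ℂ] K :=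
  (X.comp K.subtypeL).codRestrict K fun x => h x x.2

theorem rst_coe (X : H →L[ℂ] H) (K : Submodule ℂ H) (h : ∀ x ∈ K, X x ∈ K) (x : K) :
    ((rst X K h x : K) : H) = X x := rfl

theorem rst_sa {X : H →L[ℂ] H} (hX : IsSelfAdjoint X) (K : Submodule ℂ H) [CompleteSpace K]
    (h : ∀ x ∈ K, X x ∈ K) : IsSelfAdjoint (rst X K h) := by
  rw [ContinuousLinearMap.isSelfAdjoint_iff_isSymmetric]
  intro x y
  exact sa_symm hX (x : H) (y : H)

theorem rst_mono {X Y : H →L[ℂ] H} (hX : IsSelfAdjoint X) (hY : IsSelfAdjoint Y) (hXY : X ≤ Y)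
    (K : Submodule ℂ H) [CompleteSpace K]
    (h : ∀ x ∈ K, X x ∈ K) (h' : ∀ x ∈ K, Y x ∈ K) : rst X K h ≤ rst Y K h' := by
  rw [le_iff_re (rst_sa hX K h) (rst_sa hY K h')]
  intro x
  exact (le_iff_re hX hY).1 hXY (x : H)

theorem rst_nonneg {X : H →L[ℂ] H} (hX : 0 ≤ X) (K : Submodule ℂ H) [CompleteSpace K]
    (h : ∀ x ∈ K, X x ∈ K) : 0 ≤ rst X K h := by
  rw [le_iff_re (IsSelfAdjoint.zero _) (rst_sa hX.isSelfAdjoint K h)]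
  intro x
  have := (Complex.nonneg_iff.1 (inner_apply_self_nonneg hX (x : H))).1
  simp only [ContinuousLinearMap.zero_apply, inner_zero_left, Complex.zero_re]
  exact this

/-- separable closed reducing subspaces -/
def Good (X Y : H →L[ℂ] H) (K : Submodule ℂ H) : Prop :=
  IsClosed (K : Set H) ∧ TopologicalSpace.IsSeparable (K : Set H) ∧ (∀ x ∈ K, X x ∈ K) ∧ ∀ x ∈ K, Y x ∈ K

theorem exists_good (X Y : H →L[ℂ] H) (hX : IsSelfAdjoint X) (hY : IsSelfAdjoint Y) (e : H) (N : Submodule ℂ H)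
    (hNX : ∀ x ∈ N, X x ∈ N) (hNY : ∀ x ∈ N, Y x ∈ N) (he : e ∈ N) (hN : IsClosed (N : Set H)) :
    ∃ K, Good X Y K ∧ e ∈ K ∧ K ≤ N := by
  let o : List Bool → H := fun l => l.foldr (fun b x => if b then X x else Y x) e
  let K := (Submodule.span ℂ (Set.range o)).topologicalClosure
  have oN : ∀ l, o l ∈ N := by
    intro l
    induction l with
    | nil => exact he
    | cons b l ih =>
      change (if b then X (o l) else Y (o l)) ∈ N
      split_ifs
      · exact hNX _ ih
      · exact hNY _ ih
  have inv : ∀ T : H →L[ℂ] H, (∀ l, T (o l) ∈ Set.range o) → ∀ x ∈ K, T x ∈ K := by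
    intro T hT x hx
    have h1 : ∀ y ∈ Submodule.span ℂ (Set.range o), T y ∈ Submodule.span ℂ (Set.range o) := by
      intro y hy
      have : Submodule.span ℂ (Set.range o) ≤ (Submodule.span ℂ (Set.range o)).comap T.toLinearMap := by
        rw [Submodule.span_le]
        rintro _ ⟨l, rfl⟩
        exact Submodule.subset_span (hT l)
      exact this hy
    exact map_mem_closure T.continuous hx h1
  refine ⟨K, ⟨Submodule.isClosed_topologicalClosure _, ?_, ?_, ?_⟩, ?_, ?_⟩
  · exact ((Set.countable_range o).isSeparable.span (R := ℂ)).closure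
  · exact inv X fun l => ⟨true :: l, by simp [o]⟩
  · exact inv Y fun l => ⟨false :: l, by simp [o]⟩
  · exact Submodule.le_topologicalClosure _ (Submodule.subset_span ⟨[], rfl⟩)
  · refine Submodule.topologicalClosure_minimal _ ?_ hN
    rw [Submodule.span_le]
    rintro _ ⟨l, rfl⟩
    exact oN l

theorem exists_family (X Y : H →L[ℂ] H) (hX : IsSelfAdjoint X) (hY : IsSelfAdjoint Y) :
    ∃ S : Set (Submodule ℂ H), (∀ K ∈ S, Good X Y K) ∧ (∀ K ∈ S, ∀ L ∈ S, K ≠ L → K ⟂ L) ∧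
      ⊤ ≤ (⨆ i : S, (i : Submodule ℂ H)).topologicalClosure := by
  obtain ⟨S, hS⟩ := zorn_subset {S : Set (Submodule ℂ H) | (∀ K ∈ S, Good X Y K) ∧
      ∀ K ∈ S, ∀ L ∈ S, K ≠ L → K ⟂ L} (by
    intro c hc hch
    refine ⟨⋃₀ c, ⟨?_, ?_⟩, fun s hs => Set.subset_sUnion_of_mem hs⟩
    · rintro K ⟨s, hs, hK⟩
      exact (hc hs).1 K hK
    · rintro K ⟨s, hs, hK⟩ L ⟨t, ht, hL⟩ hne
      rcases hch.total hs ht with h | h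
      · exact (hc ht).2 K (h hK) L hL hne
      · exact (hc hs).2 K hK L (h hL) hne)
  refine ⟨S, hS.prop.1, hS.prop.2, ?_⟩
  set M := (⨆ i : S, (i : Submodule ℂ H)).topologicalClosure with hM
  have hKM : ∀ K ∈ S, K ≤ M := fun K hK =>
    (le_iSup (fun i : S => (i : Submodule ℂ H)) ⟨K, hK⟩).trans (Submodule.le_topologicalClosure _)
  have hbot : Mᗮ = ⊥ := by
    by_contra hne
    obtain ⟨e, he, he0⟩ := Submodule.exists_mem_ne_zero_of_ne_bot hne
    have invM : ∀ T : H →L[ℂ] H, IsSelfAdjoint T → (∀ K ∈ S, ∀ x ∈ K, T x ∈ K) → ∀ x ∈ Mᗮ, T x ∈ Mᗮ := by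
      intro T hT hTK x hx
      have h1 : M ≤ (Submodule.span ℂ {T x})ᗮ := by
        refine Submodule.topologicalClosure_minimal _ (iSup_le ?_) (Submodule.isClosed_orthogonal _)
        rintro ⟨K, hK⟩ y hy
        rw [Submodule.mem_orthogonal_singleton_iff_inner_right, sa_symm hT]
        rw [Submodule.mem_orthogonal'] at hx
        exact hx _ (hKM K hK (hTK K hK y hy))
      rw [Submodule.mem_orthogonal]
      intro u hu
      exact Submodule.mem_orthogonal_singleton_iff_inner_left.1 (h1 hu)
    obtain ⟨K, hK1, hK2, hK3⟩ := exists_good X Y hX hY e Mᗮ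
      (invM X hX fun K hK => (hS.prop.1 K hK).2.2.1) (invM Y hY fun K hK => (hS.prop.1 K hK).2.2.2) he
      (Submodule.isClosed_orthogonal _)
    have horth : ∀ L ∈ S, K ⟂ L := fun L hL => by
      rw [Submodule.isOrtho_iff_le]
      exact hK3.trans (Submodule.orthogonal_le (hKM L hL))
    have hins : insert K S ∈ {S : Set (Submodule ℂ H) | (∀ K ∈ S, Good X Y K) ∧
      ∀ K ∈ S, ∀ L ∈ S, K ≠ L → K ⟂ L} := by
      refine ⟨?_, ?_⟩
      · rintro L (rfl | hL)
        · exact hK1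
        · exact hS.prop.1 L hL
      · rintro L (rfl | hL) L' (rfl | hL') hne
        · exact absurd rfl hne
        · exact horth L' hL'
        · exact (horth L hL).symm
        · exact hS.prop.2 L hL L' hL' hne
    have hmem : K ∈ S := hS.le_of_ge hins (Set.subset_insert K S) (Set.mem_insert K S)
    have h1 : e ∈ M := hKM K hmem hK2
    have h2 := (Submodule.mem_orthogonal _ _).1 he e h1
    exact he0 (inner_self_eq_zero.1 h2)
  have : CompleteSpace M := (Submodule.isClosed_topologicalClosure _).completeSpace_coe
  rw [Submodule.orthogonal_eq_bot_iff] at hbot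
  exact hbot.ge

theorem sqDom_of_le {X Y : H →L[ℂ] H} (hX : 0 ≤ X) (hXY : X ≤ Y) : SqDom X Y := by
  classical
  have hY := hX.trans hXY
  obtain ⟨S, hS1, hS2, hS3⟩ := exists_family X Y hX.isSelfAdjoint hY.isSelfAdjoint
  let K : S → Submodule ℂ H := fun i => i.1
  have hX' : ∀ i : S, ∀ x ∈ K i, X x ∈ K i := fun i => (hS1 i.1 i.2).2.2.1
  have hY' : ∀ i : S, ∀ x ∈ K i, Y x ∈ K i := fun i => (hS1 i.1 i.2).2.2.2
  haveI : ∀ i, CompleteSpace (K i) := fun i => (hS1 i.1 i.2).1.completeSpace_coe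
  haveI : ∀ i, TopologicalSpace.SeparableSpace (K i) := fun i => (hS1 i.1 i.2).2.1.separableSpace
  have hloc : ∀ i, SqDom (rst X (K i) (hX' i)) (rst Y (K i) (hY' i)) := fun i =>
    sqDom_separable (rst_nonneg hX (K i) (hX' i))
      (rst_mono hX.isSelfAdjoint hY.isSelfAdjoint hXY (K i) (hX' i) (hY' i))
  choose U hU using hloc
  have hon : OrthogonalFamily ℂ (fun i => K i) fun i => (K i).subtypeₗᵢ := by
    intro i j hij v w
    have := hS2 i.1 i.2 j.1 j.2 (fun h => hij (Subtype.ext h))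
    exact this.inner_eq v.2 w.2
  have hon2 : OrthogonalFamily ℂ (fun i => K i) fun i => (K i).subtypeₗᵢ.comp (U i).toLinearIsometry := by
    intro i j hij v w
    exact hon hij (U i v) (U j w)
  have h1 := IsHilbertSum.mkInternal K hon hS3
  have h2 : IsHilbertSum ℂ (fun i => K i) fun i => (K i).subtypeₗᵢ.comp (U i).toLinearIsometry := by
    refine IsHilbertSum.mk hon2 (hS3.trans (Submodule.topologicalClosure_mono (iSup_mono fun i => ?_)))
    intro x hx
    exact ⟨(U i).symm ⟨x, hx⟩, by simp⟩
  let W : H ≃ₗᵢ[ℂ] H := h1.linearIsometryEquiv.trans h2.linearIsometryEquiv.symm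
  have hW : ∀ i (x : K i), W (x : H) = (U i x : H) := fun i x => by
    have e1 := h1.linearIsometryEquiv_symm_apply_single x
    have e2 := h2.linearIsometryEquiv_symm_apply_single x
    have e3 : h1.linearIsometryEquiv (x : H) = lp.single 2 i x := by
      have e4 : h1.linearIsometryEquiv (h1.linearIsometryEquiv.symm (lp.single 2 i x)) =
        h1.linearIsometryEquiv (x : H) := congrArg _ e1
      rw [← e4, LinearIsometryEquiv.apply_symm_apply]
    change h2.linearIsometryEquiv.symm (h1.linearIsometryEquiv (x : H)) = _
    rw [e3, e2]
    rfl
  refine ⟨W, fun x => ?_⟩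
  have hcl : IsClosed {x : H | ‖X x‖ ≤ ‖Y (W x)‖} := isClosed_le (by fun_prop)
    ((Y.continuous.comp W.continuous).norm)
  have hx : x ∈ closure ((⨆ i : S, (i : Submodule ℂ H) : Submodule ℂ H) : Set H) := hS3 trivial
  refine closure_minimal (fun y hy => ?_) hcl hx
  obtain ⟨f, hf, rfl⟩ := (Submodule.mem_iSup_iff_exists_finsupp _ _).1 hy
  change ‖X (∑ i ∈ f.support, f i)‖ ≤ ‖Y (W (∑ i ∈ f.support, f i))‖
  rw [map_sum, map_sum, map_sum]
  have n1 := hon.norm_sum (fun i => rst X (K i) (hX' i) ⟨f i, hf i⟩) f.support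
  have n2 := hon.norm_sum (fun i => rst Y (K i) (hY' i) (U i ⟨f i, hf i⟩)) f.support
  have e1 : ∀ i, (K i).subtypeₗᵢ (rst X (K i) (hX' i) ⟨f i, hf i⟩) = X (f i) := fun i => rfl
  have e2 : ∀ i, (K i).subtypeₗᵢ (rst Y (K i) (hY' i) (U i ⟨f i, hf i⟩)) = Y (W (f i)) := fun i => by
    rw [hW i ⟨f i, hf i⟩]; rfl
  simp only [e1] at n1
  simp only [e2] at n2
  refine le_of_sq_le_sq ?_ (norm_nonneg _)
  rw [n1, n2]
  refine Finset.sum_le_sum fun i _ => ?_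
  exact pow_le_pow_left₀ (norm_nonneg _) (hU i _) 2

end P16
end Leu
end F16

section F17
open Filter Topology ComplexOrder InnerProductSpace
open scoped ContinuousLinearMap
namespace Leu
section P17
variable {H : Type*} [NormedAddCommGroup H] [InnerProductSpace ℂ H] [CompleteSpace H]

theorem intertw0 {Y S T : H →L[ℂ] H} (hY : 0 ≤ Y) (hS : 0 ≤ S)
    (h : Y * T = T * S) {f : ℝ → ℝ} (hf : ContinuousOn f (Set.Ici 0)) :
    cfc f Y * T = T * cfc f S := by
  refine intertw hY.isSelfAdjoint hS.isSelfAdjoint h (a := 0) (b := max ‖Y‖ ‖S‖) ?_ ?_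
    (hf.mono fun x hx => hx.1)
  · intro x hx; exact spec_Icc hY (le_max_left _ _) hx
  · intro x hx; exact spec_Icc hS (le_max_right _ _) hx

theorem spec0 {S : H →L[ℂ] H} (hS : 0 ≤ S) : spectrum ℝ S ⊆ Set.Ici 0 :=
  fun _ hx => spectrum_nonneg_of_nonneg hS hx

/-- operator convexity on all of `B(H)` -/
def OpCvx (H : Type*) [NormedAddCommGroup H] [InnerProductSpace ℂ H] [CompleteSpace H] (f : ℝ → ℝ) : Prop :=
  ∀ (X Y : H →L[ℂ] H) (t : ℝ), 0 ≤ X → 0 ≤ Y → t ∈ Set.Icc (0 : ℝ) 1 →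
      cfc f (t • X + (1 - t) • Y) ≤ t • cfc f X + (1 - t) • cfc f Y

/-- operator monotonicity on all of `B(H)` -/
def OpMon (H : Type*) [NormedAddCommGroup H] [InnerProductSpace ℂ H] [CompleteSpace H] (f : ℝ → ℝ) : Prop :=
  ∀ (X Y : H →L[ℂ] H), 0 ≤ X → X ≤ Y → cfc f X ≤ cfc f Y

theorem jensen_iso {f : ℝ → ℝ} (hf : ContinuousOn f (Set.Ici 0)) (hc : OpCvx H f)
    {K X : H →L[ℂ] H} (hK : star K * K = 1) (hX : 0 ≤ X) :
    cfc f (star K * X * K) ≤ star K * cfc f X * K := by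
  set W : H →L[ℂ] H := (2 : ℝ) • (K * star K) - 1 with hW
  have WK : W * K = K := by
    rw [hW, sub_mul, smul_mul_assoc, mul_assoc, hK, mul_one, one_mul, two_smul]; abel
  have sW : star W = W := by
    rw [hW]; simp
  have WW : W * W = 1 := by
    conv_lhs => rhs; rw [hW]
    rw [mul_sub, mul_smul_comm, ← mul_assoc, WK, mul_one, hW]; abel
  have KW : star K * W = star K := by
    have := congrArg star WK
    rwa [star_mul, sW] at this
  have hX' : 0 ≤ W * X * W := by
    have := star_left_conjugate_nonneg hX W
    rwa [sW] at this
  set Z : H →L[ℂ] H := (1/2 : ℝ) • X + (1 - 1/2 : ℝ) • (W * X * W) with hZ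
  have Z0 : 0 ≤ Z := add_nonneg (smul_nonneg (by norm_num) hX) (smul_nonneg (by norm_num) hX')
  have hKX : 0 ≤ star K * X * K := star_left_conjugate_nonneg hX K
  have ZK : Z * K = K * (star K * X * K) := by
    rw [hZ, add_mul, smul_mul_assoc, smul_mul_assoc, mul_assoc (W * X), WK, mul_assoc W, hW, sub_mul,
      one_mul, smul_mul_assoc]
    have : K * star K * (X * K) = K * (star K * X * K) := by simp only [mul_assoc]
    rw [this]
    module
  have h1 := intertw0 Z0 hKX ZK hf
  have h2 : cfc f (W * X * W) = W * cfc f X * W := by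
    have h3 : (W * X * W) * W = W * X := by rw [mul_assoc, WW, mul_one]
    have h4 := intertw0 hX' hX h3 hf
    rw [← h4, mul_assoc (cfc f _), WW, mul_one]
  have h5 : cfc f (star K * X * K) = star K * cfc f Z * K := by
    rw [mul_assoc (star K) (cfc f Z), h1, ← mul_assoc (star K) K, hK, one_mul]
  have h6 := star_left_conjugate_le_conjugate (hc X (W * X * W) (1/2) hX hX' (by constructor <;> norm_num)) K
  rw [h5]
  refine h6.trans (le_of_eq ?_)
  rw [h2, mul_add, add_mul, mul_smul_comm, mul_smul_comm, smul_mul_assoc, smul_mul_assoc]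
  have : star K * (W * cfc f X * W) * K = star K * cfc f X * K := by
    rw [← mul_assoc, ← mul_assoc, KW, mul_assoc, WK]
  rw [this]
  module

theorem one_sub_nonneg {C : H →L[ℂ] H} (hC : star C * C ≤ 1) : 0 ≤ 1 - star C * C := sub_nonneg.2 hC

theorem dil_iso {s1 s2 C : H →L[ℂ] H} (h1 : star s1 * s1 = 1) (h2 : star s2 * s2 = 1)
    (h12 : star s1 * s2 = 0) (hC : star C * C ≤ 1) :
    let D := CFC.sqrt (1 - star C * C)
    let K := s1 * C + s2 * D
    star D = D ∧ D * D = 1 - star C * C ∧ star s1 * K = C ∧ star s2 * K = D ∧ star K * K = 1 := by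
  intro D K
  have h21 : star s2 * s1 = 0 := by
    have := congrArg star h12
    simpa using this
  have sD : star D = D := (CFC.sqrt_nonneg _).isSelfAdjoint.star_eq
  have DD : D * D = 1 - star C * C := CFC.sqrt_mul_sqrt_self _ (one_sub_nonneg hC)
  have k1 : star s1 * K = C := by
    simp only [K]; rw [mul_add, ← mul_assoc, ← mul_assoc, h1, h12]; simp
  have k2 : star s2 * K = D := by
    simp only [K]; rw [mul_add, ← mul_assoc, ← mul_assoc, h2, h21]; simp
  refine ⟨sD, DD, k1, k2, ?_⟩
  have : star K = star C * star s1 + D * star s2 := by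
    simp only [K]; rw [star_add, star_mul, star_mul, sD]
  rw [this, add_mul, mul_assoc, mul_assoc, k1, k2, DD]; abel

theorem dil_cfc {f : ℝ → ℝ} (hf : ContinuousOn f (Set.Ici 0)) {s1 s2 C T : H →L[ℂ] H} (h1 : star s1 * s1 = 1) (h2 : star s2 * s2 = 1)
    (h12 : star s1 * s2 = 0) (hC : star C * C ≤ 1) (hT : 0 ≤ T) :
    ∃ K X : H →L[ℂ] H, star K * K = 1 ∧ 0 ≤ X ∧ star K * X * K = star C * T * C ∧
      star K * cfc f X * K = star C * cfc f T * C + f 0 • (1 - star C * C) := by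
  obtain ⟨sD, DD, k1, k2, kk⟩ := dil_iso h1 h2 h12 hC
  set D := CFC.sqrt (1 - star C * C) with hD
  set K := s1 * C + s2 * D with hK
  have X0 : 0 ≤ s1 * T * star s1 := star_right_conjugate_nonneg hT s1
  refine ⟨K, s1 * T * star s1, kk, X0, ?_, ?_⟩
  · have : star K * s1 = star C := by
      have := congrArg star k1
      simpa using this
    calc star K * (s1 * T * star s1) * K = (star K * s1) * T * (star s1 * K) := by simp only [mul_assoc]
      _ = _ := by rw [k1, this]
  · have a1 : cfc f (s1 * T * star s1) * s1 = s1 * cfc f T :=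
      intertw0 X0 hT (by rw [mul_assoc, h1, mul_one]) hf
    have a2 : cfc f (s1 * T * star s1) * s2 = s2 * cfc f (0 : H →L[ℂ] H) :=
      intertw0 X0 le_rfl (by rw [mul_assoc, h12]; simp) hf
    rw [cfc_apply_zero, Algebra.algebraMap_eq_smul_one, mul_smul_comm, mul_one] at a2
    have a3 : cfc f (s1 * T * star s1) * K = s1 * (cfc f T * C) + f 0 • (s2 * D) := by
      rw [hK, mul_add, ← mul_assoc, ← mul_assoc, a1, a2, smul_mul_assoc, mul_assoc]
    have b1 : star K * s1 = star C := by
      have := congrArg star k1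
      simpa using this
    have b2 : star K * s2 = D := by
      have := congrArg star k2
      simpa [sD] using this
    rw [mul_assoc, a3, mul_add, ← mul_assoc, b1, mul_smul_comm, ← mul_assoc (star K), b2, DD, mul_assoc]

theorem jensen_con {f : ℝ → ℝ} (hf : ContinuousOn f (Set.Ici 0)) (hc : OpCvx H f) (f0 : f 0 = 0)
    {s1 s2 C T : H →L[ℂ] H} (h1 : star s1 * s1 = 1) (h2 : star s2 * s2 = 1)
    (h12 : star s1 * s2 = 0) (hC : star C * C ≤ 1) (hT : 0 ≤ T) :
    cfc f (star C * T * C) ≤ star C * cfc f T * C := by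
  obtain ⟨K, X, kk, X0, e1, e2⟩ := dil_cfc hf h1 h2 h12 hC hT
  rw [f0, zero_smul, add_zero] at e2
  rw [← e1, ← e2]
  exact jensen_iso hf hc kk X0

theorem tend_shift {φ : ℝ → ℝ} (hφ : ContinuousOn φ (Set.Ici 0)) {Y : H →L[ℂ] H} (hY : 0 ≤ Y) :
    Tendsto (fun t : ℝ => cfc φ (Y + algebraMap ℝ (H →L[ℂ] H) t)) (𝓝[>] 0) (𝓝 (cfc φ Y)) := by
  have hF : Continuous (Function.uncurry fun (t y : ℝ) => φ (max (y + t) 0)) := by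
    refine hφ.comp_continuous (f := fun p : ℝ × ℝ => max (p.2 + p.1) 0) (by fun_prop) ?_
    intro p; exact le_max_right (p.2 + p.1) (0 : ℝ)
  have h := (cfc_tendsto_joint Y _ hF).mono_left (nhdsWithin_le_nhds (s := Set.Ioi 0))
  have e0 : cfc (fun y : ℝ => φ (max (y + 0) 0)) Y = cfc φ Y := by
    apply cfc_congr
    intro y hy
    have : 0 ≤ y := spec0 hY hy
    simp [this]
  rw [e0] at h
  refine h.congr' ?_
  filter_upwards [self_mem_nhdsWithin] with t ht
  have ht : 0 < t := ht
  rw [cfc_shift hY.isSelfAdjoint t]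
  · apply cfc_congr
    intro y hy
    have h0 : 0 ≤ y := spec0 hY hy
    have : 0 ≤ y + t := by linarith
    simp [this]
  · apply hφ.mono
    rintro _ ⟨y, hy, rfl⟩
    have h0 : 0 ≤ y := spec0 hY hy
    change 0 ≤ y + t
    linarith

theorem algMap_nonneg {t : ℝ} (ht : 0 ≤ t) : 0 ≤ algebraMap ℝ (H →L[ℂ] H) t := by
  rw [Algebra.algebraMap_eq_smul_one]; exact smul_nonneg ht zero_le_one

theorem block_bound {X p : H →L[ℂ] H} (hX : 0 ≤ X) (hp : IsSelfAdjoint p) (pp : p * p = p) {t : ℝ} (ht : 0 < t) :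
    X ≤ p * X * p + t • p + (‖X‖^2 / t + ‖X‖) • (1 - p) := by
  have s1 : IsSelfAdjoint (p * X * p) := by
    have := (star_left_conjugate_nonneg hX p).isSelfAdjoint
    rwa [hp.star_eq] at this
  have s2 : IsSelfAdjoint ((1 : H →L[ℂ] H) - p) := (IsSelfAdjoint.one _).sub hp
  rw [le_iff_re hX.isSelfAdjoint ((s1.add ((IsSelfAdjoint.all t).smul hp)).add ((IsSelfAdjoint.all (‖X‖^2 / t + ‖X‖)).smul s2))]
  intro x
  set u := p x with hu
  set v := x - p x with hv
  have hxuv : x = u + v := by simp [hu, hv]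
  have ppx : p (p x) = p x := by
    rw [← ContinuousLinearMap.mul_apply, pp]
  have e1 : ⟪p (X (p x)), x⟫_ℂ = ⟪X u, u⟫_ℂ := sa_symm hp _ _
  have e2 : ⟪p x, x⟫_ℂ = ⟪u, u⟫_ℂ := by
    rw [hu, ← sa_symm hp, ppx]
  have e3 : ⟪v, x⟫_ℂ = ⟪v, v⟫_ℂ := by
    have : ⟪v, p x⟫_ℂ = 0 := by
      rw [← sa_symm hp, hv, map_sub, ppx, sub_self, inner_zero_left]
    conv_rhs => rw [hv, inner_sub_right]
    rw [← hv, this, sub_zero]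
  have nu : (⟪u, u⟫_ℂ).re = ‖u‖^2 := by
    have := inner_self_eq_norm_sq (𝕜 := ℂ) u; simpa using this
  have nv : (⟪v, v⟫_ℂ).re = ‖v‖^2 := by
    have := inner_self_eq_norm_sq (𝕜 := ℂ) v; simpa using this
  have rhs : (⟪(p * X * p + t • p + (‖X‖^2 / t + ‖X‖) • (1 - p)) x, x⟫_ℂ).re
      = (⟪X u, u⟫_ℂ).re + t * ‖u‖^2 + (‖X‖^2 / t + ‖X‖) * ‖v‖^2 := by
    have : (p * X * p + t • p + (‖X‖^2 / t + ‖X‖) • (1 - p)) x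
        = p (X (p x)) + t • p x + (‖X‖^2 / t + ‖X‖) • v := by
      simp [hv]
    rw [this, inner_add_left, inner_add_left, e1, ← Complex.coe_smul, ← Complex.coe_smul, inner_smul_left, inner_smul_left, e2, e3]
    simp only [Complex.add_re, Complex.conj_ofReal, Complex.re_ofReal_mul, nu, nv]
  rw [rhs]
  have lhs : (⟪X x, x⟫_ℂ).re = (⟪X u, u⟫_ℂ).re + 2 * (⟪X u, v⟫_ℂ).re + (⟪X v, v⟫_ℂ).re := by
    have c : (⟪X v, u⟫_ℂ).re = (⟪X u, v⟫_ℂ).re := by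
      rw [sa_symm hX.isSelfAdjoint, ← inner_conj_symm, Complex.conj_re]
    conv_lhs => rw [hxuv]
    rw [map_add, inner_add_left, inner_add_right, inner_add_right]
    simp only [Complex.add_re, c]; ring
  rw [lhs]
  have b1 : (⟪X u, v⟫_ℂ).re ≤ ‖X‖ * ‖u‖ * ‖v‖ :=
    (Complex.re_le_norm _).trans ((norm_inner_le_norm _ _).trans (by gcongr; exact X.le_opNorm u))
  have b2 : (⟪X v, v⟫_ℂ).re ≤ ‖X‖ * ‖v‖ * ‖v‖ :=
    (Complex.re_le_norm _).trans ((norm_inner_le_norm _ _).trans (by gcongr; exact X.le_opNorm v))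
  have b3 : 2 * (‖X‖ * ‖u‖ * ‖v‖) ≤ t * ‖u‖^2 + ‖X‖^2 / t * ‖v‖^2 := by
    have : t * ‖u‖^2 + ‖X‖^2 / t * ‖v‖^2 - 2 * (‖X‖ * ‖u‖ * ‖v‖) = (t * ‖u‖ - ‖X‖ * ‖v‖)^2 / t := by
      field_simp; ring
    have : 0 ≤ (t * ‖u‖ - ‖X‖ * ‖v‖)^2 / t := by positivity
    linarith
  nlinarith

theorem hansen_iso {φ : ℝ → ℝ} (hf : ContinuousOn φ (Set.Ici 0)) (hc : OpMon H φ)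
    {K X : H →L[ℂ] H} (hK : star K * K = 1) (hX : 0 ≤ X) :
    star K * cfc φ X * K ≤ cfc φ (star K * X * K) := by
  have hKX : 0 ≤ star K * X * K := star_left_conjugate_nonneg hX K
  refine ge_of_tendsto (tend_shift hf hKX) ?_
  filter_upwards [self_mem_nhdsWithin] with t ht
  have ht : 0 < t := ht
  set p := K * star K with hp
  have sp : IsSelfAdjoint p := by simp [hp, IsSelfAdjoint]
  have pK : p * K = K := by rw [hp, mul_assoc, hK, mul_one]
  have pp : p * p = p := by
    conv_lhs => rhs; rw [hp]
    rw [← mul_assoc, pK]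
  have hb := block_bound hX sp pp ht
  set Z := p * X * p + t • p + (‖X‖^2 / t + ‖X‖) • (1 - p) with hZ
  have Z0 : 0 ≤ Z := hX.trans hb
  have ZK : Z * K = K * (star K * X * K + algebraMap ℝ (H →L[ℂ] H) t) := by
    rw [hZ, add_mul, add_mul, mul_assoc, pK, smul_mul_assoc, pK, smul_mul_assoc, sub_mul, pK, one_mul, sub_self,
      smul_zero, add_zero, Algebra.algebraMap_eq_smul_one, mul_add, mul_smul_comm, mul_one, hp]
    simp only [mul_assoc]
  have h1 := intertw0 Z0 (add_nonneg hKX (algMap_nonneg ht.le)) ZK hf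
  have h2 := star_left_conjugate_le_conjugate (hc X Z hX hb) K
  rwa [mul_assoc (star K) (cfc φ Z), h1, ← mul_assoc, hK, one_mul] at h2

theorem hansen_con {φ : ℝ → ℝ} (hf : ContinuousOn φ (Set.Ici 0)) (hc : OpMon H φ) (f0 : 0 ≤ φ 0)
    {s1 s2 C T : H →L[ℂ] H} (h1 : star s1 * s1 = 1) (h2 : star s2 * s2 = 1)
    (h12 : star s1 * s2 = 0) (hC : star C * C ≤ 1) (hT : 0 ≤ T) :
    star C * cfc φ T * C ≤ cfc φ (star C * T * C) := by
  obtain ⟨K, X, kk, X0, e1, e2⟩ := dil_cfc hf h1 h2 h12 hC hT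
  have := hansen_iso hf hc kk X0
  rw [e1, e2] at this
  exact (le_add_of_nonneg_right (smul_nonneg f0 (one_sub_nonneg hC))).trans this

end P17
end Leu
end F17

section F18
open Filter Topology ComplexOrder InnerProductSpace
open scoped ContinuousLinearMap
namespace Leu
section P18
variable {H : Type*} [NormedAddCommGroup H] [InnerProductSpace ℂ H] [CompleteSpace H]

/-- strictly positive operators -/
def SPos (a : H →L[ℂ] H) : Prop := 0 ≤ a ∧ spectrum ℝ a ⊆ Set.Ioi 0

theorem SPos.sa {a : H →L[ℂ] H} (ha : SPos a) : IsSelfAdjoint a := ha.1.isSelfAdjoint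

theorem spos_shift {a : H →L[ℂ] H} (ha : 0 ≤ a) {t : ℝ} (ht : 0 < t) :
    SPos (a + algebraMap ℝ (H →L[ℂ] H) t) := by
  have h0 := add_nonneg ha (algMap_nonneg (H := H) ht.le)
  refine ⟨h0, fun x hx => ?_⟩
  have h1 : algebraMap ℝ (H →L[ℂ] H) t ≤ a + algebraMap ℝ (H →L[ℂ] H) t := le_add_of_nonneg_left ha
  exact lt_of_lt_of_le ht ((algebraMap_le_iff_le_spectrum h0.isSelfAdjoint).1 h1 x hx)

theorem spos_cfc {a : H →L[ℂ] H} (ha : SPos a) {φ : ℝ → ℝ} (hφ : ContinuousOn φ (Set.Ioi 0))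
    (hp : ∀ x, 0 < x → 0 < φ x) : SPos (cfc φ a) := by
  refine ⟨cfc_nonneg fun x hx => (hp x (ha.2 hx)).le, ?_⟩
  rw [cfc_map_spectrum φ a ha.sa (hφ.mono ha.2)]
  rintro _ ⟨x, hx, rfl⟩
  exact hp x (ha.2 hx)

theorem SPos.isUnit {a : H →L[ℂ] H} (ha : SPos a) : IsUnit a := by
  have := (isUnit_cfc_iff (fun x : ℝ => x) a (by fun_prop) ha.sa).2 (fun x hx => (ha.2 hx).ne')
  rwa [cfc_id' ℝ a ha.sa] at this

theorem SPos.cfc_mul {a : H →L[ℂ] H} (ha : SPos a) {φ ψ : ℝ → ℝ} (hφ : ContinuousOn φ (Set.Ioi 0))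
    (hψ : ContinuousOn ψ (Set.Ioi 0)) : cfc φ a * cfc ψ a = cfc (fun x => φ x * ψ x) a :=
  (_root_.cfc_mul φ ψ a (hφ.mono ha.2) (hψ.mono ha.2)).symm

theorem cont_inv : ContinuousOn (fun x : ℝ => x⁻¹) (Set.Ioi 0) :=
  continuousOn_inv₀.mono fun x hx => (ne_of_gt hx)

theorem SPos.inv_mul {a : H →L[ℂ] H} (ha : SPos a) : cfc (fun x : ℝ => x⁻¹) a * a = 1 := by
  conv_lhs => rhs; rw [← cfc_id' ℝ a ha.sa]
  rw [ha.cfc_mul cont_inv (ψ := fun x => x) continuousOn_id, ← cfc_one ℝ a ha.sa]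
  apply cfc_congr
  intro x hx
  exact inv_mul_cancel₀ (ne_of_gt (ha.2 hx))

theorem SPos.mul_inv {a : H →L[ℂ] H} (ha : SPos a) : a * cfc (fun x : ℝ => x⁻¹) a = 1 := by
  conv_lhs => lhs; rw [← cfc_id' ℝ a ha.sa]
  rw [ha.cfc_mul (φ := fun x => x) continuousOn_id cont_inv, ← cfc_one ℝ a ha.sa]
  apply cfc_congr
  intro x hx
  exact mul_inv_cancel₀ (ne_of_gt (ha.2 hx))

theorem inv_cmp {a b : H →L[ℂ] H} (ha : SPos a) (hb : SPos b) {φ ψ : ℝ → ℝ}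
    (hφ : ContinuousOn φ (Set.Ioi 0)) (hψ : ContinuousOn ψ (Set.Ioi 0))
    (hp : ∀ x, 0 < x → 0 < φ x) (hq : ∀ x, 0 < x → 0 < ψ x) (h : cfc φ b ≤ cfc ψ a) :
    cfc (fun x => (ψ x)⁻¹) a ≤ cfc (fun x => (φ x)⁻¹) b := by
  rw [cfc_inv ψ a (fun x hx => (hq x (ha.2 hx)).ne') (hψ.mono ha.2) ha.sa,
    cfc_inv φ b (fun x hx => (hp x (hb.2 hx)).ne') (hφ.mono hb.2) hb.sa]
  have h1 := spos_cfc hb hφ hp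
  exact CStarAlgebra.ringInverse_le_ringInverse h ⟨h1.1, h1.isUnit⟩

theorem con_swap {C : H →L[ℂ] H} (h : C * star C ≤ 1) : star C * C ≤ 1 := by
  have h1 : ‖C * star C‖ ≤ 1 := by
    have := CStarAlgebra.norm_le_norm_of_nonneg_of_le (mul_star_self_nonneg C) h
    exact this.trans ContinuousLinearMap.norm_id_le
  rw [CStarRing.norm_self_mul_star, ← CStarRing.norm_star_mul_self] at h1
  have h2 := IsSelfAdjoint.le_algebraMap_norm_self (a := star C * C) (star_mul_self_nonneg C).isSelfAdjoint
  refine h2.trans ?_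
  rw [Algebra.algebraMap_eq_smul_one]
  have := smul_le_smul_of_nonneg_right h1 (zero_le_one (α := H →L[ℂ] H))
  simpa using this

theorem cmp_con {a b : H →L[ℂ] H} (ha : SPos a) (hb : SPos b) (hab : a * a ≤ b * b) :
    star (cfc (fun x : ℝ => x⁻¹) b * a) * (cfc (fun x : ℝ => x⁻¹) b * a) ≤ 1 := by
  apply con_swap
  have sb : IsSelfAdjoint (cfc (fun x : ℝ => x⁻¹) b) := cfc_predicate _ _
  rw [star_mul, sb.star_eq, ha.sa.star_eq]
  have h := sb.conjugate_le_conjugate hab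
  have e1 : cfc (fun x : ℝ => x⁻¹) b * (b * b) * cfc (fun x : ℝ => x⁻¹) b = 1 := by
    rw [← mul_assoc, hb.inv_mul, one_mul, hb.mul_inv]
  rw [e1] at h
  simpa only [mul_assoc] using h

theorem conj_cfc {a b : H →L[ℂ] H} (ha : SPos a) (hb : SPos b) {ω : ℝ → ℝ} (hω : ContinuousOn ω (Set.Ioi 0)) :
    star (cfc (fun x : ℝ => x⁻¹) b * a) * cfc ω b * (cfc (fun x : ℝ => x⁻¹) b * a)
      = a * cfc (fun x => ω x / x ^ 2) b * a := by
  have sb : IsSelfAdjoint (cfc (fun x : ℝ => x⁻¹) b) := cfc_predicate _ _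
  rw [star_mul, sb.star_eq, ha.sa.star_eq]
  have e : cfc (fun x : ℝ => x⁻¹) b * cfc ω b * cfc (fun x : ℝ => x⁻¹) b = cfc (fun x => ω x / x ^ 2) b := by
    rw [hb.cfc_mul cont_inv hω, hb.cfc_mul (φ := fun x => x⁻¹ * ω x) (cont_inv.mul hω) cont_inv]
    apply cfc_congr
    intro x hx
    have : x ≠ 0 := ne_of_gt (hb.2 hx)
    simp only; field_simp
  rw [← e]
  simp only [mul_assoc]

theorem self_cfc {a : H →L[ℂ] H} (ha : SPos a) {ω : ℝ → ℝ} (hω : ContinuousOn ω (Set.Ioi 0)) :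
    cfc ω a = a * cfc (fun x => ω x / x ^ 2) a * a := by
  rw [← conj_cfc ha ha hω, ha.inv_mul]; simp

theorem conj_cancel {a X Y : H →L[ℂ] H} (ha : SPos a) (h : a * X * a ≤ a * Y * a) : X ≤ Y := by
  have sb : IsSelfAdjoint (cfc (fun x : ℝ => x⁻¹) a) := cfc_predicate _ _
  have h1 := sb.conjugate_le_conjugate h
  have e : ∀ X, cfc (fun x : ℝ => x⁻¹) a * (a * X * a) * cfc (fun x : ℝ => x⁻¹) a = X := by
    intro X
    rw [mul_assoc, mul_assoc _ a, ha.mul_inv, mul_one, ← mul_assoc, ha.inv_mul, one_mul]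
  rwa [e, e] at h1

theorem spos_sqrt {a : H →L[ℂ] H} (ha : SPos a) : SPos (cfc Real.sqrt a) :=
  spos_cfc ha Real.continuous_sqrt.continuousOn fun x hx => Real.sqrt_pos.2 hx

theorem sqrt_mul {a : H →L[ℂ] H} (ha : SPos a) : cfc Real.sqrt a * cfc Real.sqrt a = a := by
  rw [ha.cfc_mul Real.continuous_sqrt.continuousOn Real.continuous_sqrt.continuousOn]
  conv_rhs => rw [← cfc_id' ℝ a ha.sa]
  apply cfc_congr
  intro x hx
  exact Real.mul_self_sqrt (le_of_lt (ha.2 hx))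

/-- functions of `b * b` -/
theorem cfc_sq {b : H →L[ℂ] H} (hb : SPos b) {ω : ℝ → ℝ} (hω : ContinuousOn ω (Set.Ioi 0)) :
    cfc ω (b * b) = cfc (fun x => ω (x ^ 2)) b := by
  have : b * b = cfc (fun x : ℝ => x ^ 2) b := by
    rw [cfc_pow_id b 2 hb.sa, pow_two]
  have hc : ContinuousOn ω (Set.image (fun x : ℝ => x ^ 2) (spectrum ℝ b)) := by
    apply hω.mono
    rintro _ ⟨x, hx, rfl⟩
    exact pow_pos (Set.mem_Ioi.1 (hb.2 hx)) 2
  rw [this, ← cfc_comp' ω (fun x : ℝ => x ^ 2) b hc (by fun_prop) hb.sa]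

/-- functions of the square root -/
theorem cfc_sqrt_sq {a : H →L[ℂ] H} (ha : SPos a) {ω : ℝ → ℝ} (hω : ContinuousOn ω (Set.Ioi 0)) :
    cfc (fun x => ω (x ^ 2) / x ^ 2) (cfc Real.sqrt a) = cfc (fun x => ω x / x) a := by
  have h := cfc_sq (spos_sqrt ha) (ω := fun x => ω x / x)
    (hω.div continuousOn_id fun x hx => ne_of_gt hx)
  rw [sqrt_mul ha] at h
  exact h.symm

theorem cont_sq {ω : ℝ → ℝ} (hω : ContinuousOn ω (Set.Ioi 0)) : ContinuousOn (fun x => ω (x ^ 2)) (Set.Ioi 0) :=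
  hω.comp (by fun_prop) fun x hx => Set.mem_Ioi.2 (pow_pos (Set.mem_Ioi.1 hx) 2)

section steps
variable {s1 s2 : H →L[ℂ] H}

theorem step1 (h1 : star s1 * s1 = 1) (h2 : star s2 * s2 = 1) (h12 : star s1 * s2 = 0)
    {f : ℝ → ℝ} (hf : ContinuousOn f (Set.Ici 0)) (hc : OpCvx H f) (f0 : f 0 = 0)
    {A B : H →L[ℂ] H} (hA : SPos A) (hB : SPos B) (hAB : A ≤ B) :
    cfc (fun x => f x / x) A ≤ cfc (fun x => f x / x) B := by
  have hf' : ContinuousOn f (Set.Ioi 0) := hf.mono Set.Ioi_subset_Ici_self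
  rw [← cfc_sqrt_sq hA hf', ← cfc_sqrt_sq hB hf']
  have ha := spos_sqrt hA
  have hb := spos_sqrt hB
  have eA := sqrt_mul hA
  have eB := sqrt_mul hB
  set a := cfc Real.sqrt A
  set b := cfc Real.sqrt B
  have hab : a * a ≤ b * b := by rwa [eA, eB]
  have h := jensen_con hf hc f0 h1 h2 h12 (cmp_con ha hb hab) (T := b * b) (by rw [eB]; exact hB.1)
  have e1 : star (cfc (fun x : ℝ => x⁻¹) b * a) * (b * b) * (cfc (fun x : ℝ => x⁻¹) b * a) = a * a := by
    have sb : IsSelfAdjoint (cfc (fun x : ℝ => x⁻¹) b) := cfc_predicate _ _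
    rw [star_mul, sb.star_eq, ha.sa.star_eq]
    calc a * cfc (fun x : ℝ => x⁻¹) b * (b * b) * (cfc (fun x : ℝ => x⁻¹) b * a)
        = a * (cfc (fun x : ℝ => x⁻¹) b * b) * (b * cfc (fun x : ℝ => x⁻¹) b) * a := by simp only [mul_assoc]
      _ = a * a := by rw [hb.inv_mul, hb.mul_inv]; simp
  rw [e1, cfc_sq ha hf', cfc_sq hb hf', conj_cfc ha hb (cont_sq hf'), self_cfc ha (cont_sq hf')] at h
  exact conj_cancel ha h

theorem step2 (h1 : star s1 * s1 = 1) (h2 : star s2 * s2 = 1) (h12 : star s1 * s2 = 0)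
    {φ : ℝ → ℝ} (hf : ContinuousOn φ (Set.Ici 0)) (hc : OpMon H φ) (f0 : ∀ x, 0 ≤ x → 0 < φ x)
    {A B : H →L[ℂ] H} (hA : SPos A) (hB : SPos B) (hAB : A ≤ B) :
    cfc (fun x => x / φ x) A ≤ cfc (fun x => x / φ x) B := by
  have hf' : ContinuousOn φ (Set.Ioi 0) := hf.mono Set.Ioi_subset_Ici_self
  have key : cfc (fun x => φ x / x) B ≤ cfc (fun x => φ x / x) A := by
    rw [← cfc_sqrt_sq hA hf', ← cfc_sqrt_sq hB hf']
    have ha := spos_sqrt hA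
    have hb := spos_sqrt hB
    have eA := sqrt_mul hA
    have eB := sqrt_mul hB
    set a := cfc Real.sqrt A
    set b := cfc Real.sqrt B
    have hab : a * a ≤ b * b := by rwa [eA, eB]
    have h := hansen_con hf hc (f0 0 le_rfl).le h1 h2 h12 (cmp_con ha hb hab) (T := b * b) (by rw [eB]; exact hB.1)
    have e1 : star (cfc (fun x : ℝ => x⁻¹) b * a) * (b * b) * (cfc (fun x : ℝ => x⁻¹) b * a) = a * a := by
      have sb : IsSelfAdjoint (cfc (fun x : ℝ => x⁻¹) b) := cfc_predicate _ _
      rw [star_mul, sb.star_eq, ha.sa.star_eq]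
      calc a * cfc (fun x : ℝ => x⁻¹) b * (b * b) * (cfc (fun x : ℝ => x⁻¹) b * a)
          = a * (cfc (fun x : ℝ => x⁻¹) b * b) * (b * cfc (fun x : ℝ => x⁻¹) b) * a := by simp only [mul_assoc]
        _ = a * a := by rw [hb.inv_mul, hb.mul_inv]; simp
    rw [e1, cfc_sq ha hf', cfc_sq hb hf', conj_cfc ha hb (cont_sq hf'), self_cfc ha (cont_sq hf')] at h
    exact conj_cancel ha h
  have cq : ContinuousOn (fun x => φ x / x) (Set.Ioi 0) := hf'.div continuousOn_id fun x hx => ne_of_gt hx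
  have pq : ∀ x, 0 < x → 0 < φ x / x := fun x hx => div_pos (f0 x hx.le) hx
  have := inv_cmp hA hB cq cq pq pq key
  simpa only [inv_div] using this

theorem step2' (h1 : star s1 * s1 = 1) (h2 : star s2 * s2 = 1) (h12 : star s1 * s2 = 0)
    {φ : ℝ → ℝ} (hf : ContinuousOn φ (Set.Ici 0)) (hc : OpMon H φ) (f0 : ∀ x, 0 ≤ x → 0 < φ x) :
    OpMon H (fun x => x / φ x) := by
  intro A B hA hAB
  have hB := hA.trans hAB
  have ck : ContinuousOn (fun x => x / φ x) (Set.Ici 0) := continuousOn_id.div hf fun x hx => (f0 x hx).ne'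
  refine le_of_tendsto_of_tendsto (tend_shift ck hA) (tend_shift ck hB) ?_
  filter_upwards [self_mem_nhdsWithin] with t ht
  exact step2 h1 h2 h12 hf hc f0 (spos_shift hA ht) (spos_shift hB ht) (add_le_add_left hAB _)

theorem step3 (h1 : star s1 * s1 = 1) (h2 : star s2 * s2 = 1) (h12 : star s1 * s2 = 0)
    {k : ℝ → ℝ} (hf : ContinuousOn k (Set.Ici 0)) (hc : OpMon H k) (f0 : 0 ≤ k 0) (fp : ∀ x, 0 < x → 0 < k x)
    {a b : H →L[ℂ] H} (ha : SPos a) (hb : SPos b) (hab : a * a ≤ b * b) :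
    cfc (fun x => x ^ 2 / k x) a ≤ cfc (fun x => x ^ 2 / k x) b := by
  have hf' : ContinuousOn k (Set.Ioi 0) := hf.mono Set.Ioi_subset_Ici_self
  have h := hansen_con hf hc f0 h1 h2 h12 (cmp_con ha hb hab) (T := b) hb.1
  have le : a ≤ b := by
    have h3 := CFC.sqrt_le_sqrt _ _ hab
    rwa [CFC.sqrt_mul_self a ha.1, CFC.sqrt_mul_self b hb.1] at h3
  have e1 : star (cfc (fun x : ℝ => x⁻¹) b * a) * b * (cfc (fun x : ℝ => x⁻¹) b * a) ≤ a := by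
    have sb : IsSelfAdjoint (cfc (fun x : ℝ => x⁻¹) b) := cfc_predicate _ _
    rw [star_mul, sb.star_eq, ha.sa.star_eq]
    calc a * cfc (fun x : ℝ => x⁻¹) b * b * (cfc (fun x : ℝ => x⁻¹) b * a)
        = a * (cfc (fun x : ℝ => x⁻¹) b * b) * cfc (fun x : ℝ => x⁻¹) b * a := by simp only [mul_assoc]
      _ = a * cfc (fun x : ℝ => x⁻¹) b * a := by rw [hb.inv_mul]; simp
      _ ≤ a * cfc (fun x : ℝ => x⁻¹) a * a := by
        apply ha.sa.conjugate_le_conjugate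
        have := inv_cmp hb ha (φ := fun x => x) (ψ := fun x => x) continuousOn_id continuousOn_id
          (fun x hx => hx) (fun x hx => hx) (by rwa [cfc_id' ℝ a ha.sa, cfc_id' ℝ b hb.sa])
        exact this
      _ = a := by rw [ha.mul_inv, one_mul]
  have n1 : 0 ≤ star (cfc (fun x : ℝ => x⁻¹) b * a) * b * (cfc (fun x : ℝ => x⁻¹) b * a) :=
    star_left_conjugate_nonneg hb.1 _
  have h' := h.trans (hc _ _ n1 e1)
  rw [conj_cfc ha hb hf', self_cfc ha hf'] at h'
  have key := conj_cancel ha h'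
  have cq : ContinuousOn (fun x => k x / x ^ 2) (Set.Ioi 0) :=
    hf'.div (by fun_prop) fun x hx => ne_of_gt (pow_pos (Set.mem_Ioi.1 hx) 2)
  have pq : ∀ x, 0 < x → 0 < k x / x ^ 2 := fun x hx => div_pos (fp x hx) (pow_pos hx 2)
  have := inv_cmp ha hb cq cq pq pq key
  simpa only [inv_div] using this
end steps

end P18
end Leu
end F18

section F19
open Filter Topology ComplexOrder InnerProductSpace
open scoped ContinuousLinearMap
namespace Leu
section P19
variable {H : Type*} [NormedAddCommGroup H] [InnerProductSpace ℂ H] [CompleteSpace H]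

theorem exists_isometries (h : ¬ FiniteDimensional ℂ H) :
    ∃ s1 s2 : H →L[ℂ] H, star s1 * s1 = 1 ∧ star s2 * s2 = 1 ∧ star s1 * s2 = 0 := by
  obtain ⟨w, b, hb⟩ := exists_hilbertBasis ℂ H
  have := hilbertBasis_infinite b h
  obtain ⟨e⟩ : Nonempty (w ⊕ w ≃ w) := by
    rw [← Cardinal.eq, Cardinal.mk_sum]
    simp
  have key : ∀ j : w → w, Function.Injective j → ∃ s : H →L[ℂ] H, star s * s = 1 ∧ ∀ i, s (b i) = b (j i) := by
    intro j hj
    have ho : Orthonormal ℂ (b ∘ j) := b.orthonormal.comp _ hj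
    let s : H →ₗᵢ[ℂ] H := ho.orthogonalFamily.linearIsometry.comp b.repr.toLinearIsometry
    refine ⟨s.toContinuousLinearMap, ?_, ?_⟩
    · rw [ContinuousLinearMap.star_eq_adjoint]
      exact (ContinuousLinearMap.norm_map_iff_adjoint_comp_self _).1 fun x => s.norm_map x
    · intro i
      change ho.orthogonalFamily.linearIsometry (b.repr (b i)) = _
      classical
      rw [b.repr_self, OrthogonalFamily.linearIsometry_apply_single]
      simp
  obtain ⟨s1, a1, c1⟩ := key (fun i => e (Sum.inl i)) (e.injective.comp Sum.inl_injective)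
  obtain ⟨s2, a2, c2⟩ := key (fun i => e (Sum.inr i)) (e.injective.comp Sum.inr_injective)
  refine ⟨s1, s2, a1, a2, ?_⟩
  have z : ∀ j, (star s1 * s2) (b j) = 0 := by
    intro j
    apply b.repr.injective
    ext i
    rw [b.repr_apply_apply, map_zero, ContinuousLinearMap.mul_apply, ContinuousLinearMap.star_eq_adjoint,
      ContinuousLinearMap.adjoint_inner_right, c1, c2, b.orthonormal.inner_eq_zero]
    · rfl
    · intro h; have := e.injective h; simp at this
  apply ContinuousLinearMap.ext_on (s := Set.range b)
  · have := b.dense_span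
    rw [← Submodule.dense_iff_topologicalClosure_eq_top] at this
    exact this
  · rintro _ ⟨j, rfl⟩
    rw [z j]; rfl

theorem m_lim {f : ℝ → ℝ} (hf : ContinuousOn f (Set.Ici 0)) {a : H →L[ℂ] H} {ε : ℝ} (hε : 0 < ε)
    (ha : ∀ x ∈ spectrum ℝ a, ε ≤ x) :
    Tendsto (fun δ : ℝ => cfc (fun x => x * (f (x + δ) / (x + δ))) a) (𝓝[>] 0) (𝓝 (cfc f a)) := by
  have hF : Continuous (Function.uncurry fun (δ y : ℝ) =>
      max y ε * (f (max y ε + max δ 0) / (max y ε + max δ 0))) := by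
    have hp : ∀ p : ℝ × ℝ, 0 < max p.2 ε + max p.1 0 := fun p =>
      add_pos_of_pos_of_nonneg (lt_of_lt_of_le hε (le_max_right p.2 ε)) (le_max_right p.1 (0:ℝ))
    have h1 : Continuous fun p : ℝ × ℝ => f (max p.2 ε + max p.1 0) :=
      hf.comp_continuous (f := fun p : ℝ × ℝ => max p.2 ε + max p.1 0) (by fun_prop) fun p => (hp p).le
    have h2 : Continuous fun p : ℝ × ℝ => f (max p.2 ε + max p.1 0) / (max p.2 ε + max p.1 0) :=
      h1.div (by fun_prop) fun p => (hp p).ne'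
    exact Continuous.mul (f := fun p : ℝ × ℝ => max p.2 ε) (by fun_prop) h2
  have h := (cfc_tendsto_joint a _ hF).mono_left (nhdsWithin_le_nhds (s := Set.Ioi 0))
  have e0 : cfc (fun y : ℝ => max y ε * (f (max y ε + max 0 0) / (max y ε + max 0 0))) a = cfc f a := by
    apply cfc_congr
    intro y hy
    have h1 := ha y hy
    have : y ≠ 0 := by linarith
    simp only [max_eq_left h1, max_self, add_zero]
    field_simp
  rw [e0] at h
  refine h.congr' ?_
  filter_upwards [self_mem_nhdsWithin] with t ht
  have ht : 0 < t := ht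
  apply cfc_congr
  intro y hy
  simp only [max_eq_left (ha y hy), max_eq_left ht.le]

section steps
variable {s1 s2 : H →L[ℂ] H}

theorem m6_pos (h1 : star s1 * s1 = 1) (h2 : star s2 * s2 = 1) (h12 : star s1 * s2 = 0)
    {f : ℝ → ℝ} (hf : ContinuousOn f (Set.Ici 0)) (hc : OpCvx H f) (f0 : f 0 = 0) (fp : ∀ x, 0 < x → 0 < f x)
    {a b : H →L[ℂ] H} (ha : SPos a) (hb : SPos b) {ε : ℝ} (hε : 0 < ε)
    (hae : ∀ x ∈ spectrum ℝ a, ε ≤ x) (hbe : ∀ x ∈ spectrum ℝ b, ε ≤ x)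
    (hab : a * a ≤ b * b) : cfc f a ≤ cfc f b := by
  refine le_of_tendsto_of_tendsto (m_lim hf hε hae) (m_lim hf hε hbe) ?_
  filter_upwards [self_mem_nhdsWithin] with δ hδ
  have hδ : 0 < δ := hδ
  have pd : ∀ x : ℝ, 0 ≤ x → 0 < x + δ := fun x hx => by linarith
  have c1 : ContinuousOn (fun x => f (x + δ) / (x + δ)) (Set.Ici 0) := by
    refine ContinuousOn.div ?_ (by fun_prop) fun x hx => (pd x hx).ne'
    exact hf.comp (by fun_prop) fun x hx => (pd x hx).le
  have p1 : ∀ x, 0 ≤ x → 0 < f (x + δ) / (x + δ) := fun x hx => div_pos (fp _ (pd x hx)) (pd x hx)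
  have m1 : OpMon H (fun x => f (x + δ) / (x + δ)) := by
    intro X Y hX hXY
    have hY := hX.trans hXY
    have e : ∀ X : H →L[ℂ] H, 0 ≤ X → cfc (fun x => f (x + δ) / (x + δ)) X
        = cfc (fun x => f x / x) (X + algebraMap ℝ (H →L[ℂ] H) δ) := by
      intro X hX
      rw [cfc_shift hX.isSelfAdjoint δ]
      refine ContinuousOn.mono (s := Set.Ioi 0) ?_ ?_
      · exact (hf.mono Set.Ioi_subset_Ici_self).div continuousOn_id fun x hx => ne_of_gt hx
      · rintro _ ⟨x, hx, rfl⟩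
        exact pd x (spec0 hX hx)
    rw [e X hX, e Y hY]
    exact step1 h1 h2 h12 hf hc f0 (spos_shift hX hδ) (spos_shift hY hδ) (add_le_add_left hXY _)
  have m2 := step2' h1 h2 h12 c1 m1 p1
  have c2 : ContinuousOn (fun x => x / (f (x + δ) / (x + δ))) (Set.Ici 0) :=
    continuousOn_id.div c1 fun x hx => (p1 x hx).ne'
  have m3 := step3 h1 h2 h12 c2 m2 (by simp) (fun x hx => div_pos hx (p1 x hx.le)) ha hb hab
  have e : ∀ a : H →L[ℂ] H, SPos a → cfc (fun x => x ^ 2 / (x / (f (x + δ) / (x + δ)))) a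
      = cfc (fun x => x * (f (x + δ) / (x + δ))) a := by
    intro a ha
    apply cfc_congr
    intro x hx
    have hx : 0 < x := ha.2 hx
    have := (p1 x hx.le).ne'
    simp only
    field_simp
  rwa [e a ha, e b hb] at m3

theorem cfc_affine {f : ℝ → ℝ} (hf : ContinuousOn f (Set.Ici 0)) (η c : ℝ) {X : H →L[ℂ] H} (hX : 0 ≤ X) :
    cfc (fun x => f x + (η * x + c)) X = cfc f X + (η • X + algebraMap ℝ (H →L[ℂ] H) c) := by
  have hs := hf.mono (spec0 hX)
  have c1 : ContinuousOn (fun x : ℝ => η * x + c) (spectrum ℝ X) := by fun_prop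
  have c2 : ContinuousOn (fun x : ℝ => η * x) (spectrum ℝ X) := by fun_prop
  rw [cfc_add X f (fun x => η * x + c) hs c1, cfc_add_const c (fun x => η * x) X c2 hX.isSelfAdjoint,
    cfc_const_mul_id η X hX.isSelfAdjoint]

theorem cvx_affine {f : ℝ → ℝ} (hf : ContinuousOn f (Set.Ici 0)) (η c : ℝ) (hc : OpCvx H f) :
    OpCvx H (fun x => f x + (η * x + c)) := by
  intro X Y t hX hY ht
  have h := hc X Y t hX hY ht
  have hZ : 0 ≤ t • X + (1 - t) • Y :=
    add_nonneg (smul_nonneg ht.1 hX) (smul_nonneg (by linarith [ht.2]) hY)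
  rw [cfc_affine hf η c hX, cfc_affine hf η c hY, cfc_affine hf η c hZ]
  refine (add_le_add_left h _).trans (le_of_eq ?_)
  rw [Algebra.algebraMap_eq_smul_one]
  module

theorem m6 (hinf : ¬ FiniteDimensional ℂ H)
    {f : ℝ → ℝ} (hf : ContinuousOn f (Set.Ici 0)) (hm : MonotoneOn f (Set.Ici 0)) (hc : OpCvx H f)
    {a b : H →L[ℂ] H} (ha : 0 ≤ a) (hb : 0 ≤ b)
    (hab : a * a ≤ b * b) : cfc f a ≤ cfc f b := by
  obtain ⟨s1, s2, h1, h2, h12⟩ := exists_isometries hinf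
  have le : a ≤ b := by
    have h3 := CFC.sqrt_le_sqrt _ _ hab
    rwa [CFC.sqrt_mul_self a ha, CFC.sqrt_mul_self b hb] at h3
  have key : ∀ η : ℝ, 0 < η → cfc f a + (η • a + algebraMap ℝ (H →L[ℂ] H) (- f 0)) ≤
      cfc f b + (η • b + algebraMap ℝ (H →L[ℂ] H) (- f 0)) := by
    intro η hη
    rw [← cfc_affine hf η _ ha, ← cfc_affine hf η _ hb]
    have hF : ContinuousOn (fun x => f x + (η * x + - f 0)) (Set.Ici 0) := hf.add (by fun_prop)
    refine le_of_tendsto_of_tendsto (tend_shift hF ha) (tend_shift hF hb) ?_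
    filter_upwards [self_mem_nhdsWithin] with t ht
    have ht : 0 < t := ht
    have low : ∀ a : H →L[ℂ] H, 0 ≤ a → ∀ x ∈ spectrum ℝ (a + algebraMap ℝ (H →L[ℂ] H) t), t ≤ x := by
      intro a ha
      exact (algebraMap_le_iff_le_spectrum (spos_shift ha ht).sa).1 (le_add_of_nonneg_left ha)
    refine m6_pos h1 h2 h12 hF (cvx_affine hf _ _ hc) (by simp) ?_ (spos_shift ha ht) (spos_shift hb ht) ht
      (low a ha) (low b hb) ?_
    · intro x hx
      have := hm (Set.mem_Ici.2 le_rfl) (Set.mem_Ici.2 hx.le) hx.le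
      have := mul_pos hη hx
      linarith
    · have e : ∀ a : H →L[ℂ] H, (a + algebraMap ℝ (H →L[ℂ] H) t) * (a + algebraMap ℝ (H →L[ℂ] H) t)
          = a * a + (2 * t) • a + (t * t) • (1 : H →L[ℂ] H) := by
        intro a
        rw [Algebra.algebraMap_eq_smul_one, mul_add, add_mul, add_mul, smul_mul_assoc, one_mul, mul_smul_comm,
          mul_smul_comm, smul_mul_assoc, mul_one, one_mul]
        module
      rw [e, e]
      have := smul_le_smul_of_nonneg_left le (show 0 ≤ 2 * t by linarith)
      gcongr
  have lim : ∀ a : H →L[ℂ] H, Tendsto (fun η : ℝ => cfc f a + (η • a + algebraMap ℝ (H →L[ℂ] H) (- f 0)))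
      (𝓝[>] 0) (𝓝 (cfc f a + algebraMap ℝ (H →L[ℂ] H) (- f 0))) := by
    intro a
    have : Continuous (fun η : ℝ => cfc f a + (η • a + algebraMap ℝ (H →L[ℂ] H) (- f 0))) := by fun_prop
    have h := (this.tendsto 0).mono_left (nhdsWithin_le_nhds (s := Set.Ioi 0))
    simpa using h
  have := le_of_tendsto_of_tendsto (lim a) (lim b) (by
    filter_upwards [self_mem_nhdsWithin] with η hη using key η hη)
  exact le_of_add_le_add_right this
end steps

end P19
end Leu
end F19

section F20
open Filter Topology ComplexOrder InnerProductSpace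
open scoped ContinuousLinearMap
namespace Leu
section P20
variable {H : Type*} [NormedAddCommGroup H] [InnerProductSpace ℂ H] [CompleteSpace H]

/-- domination up to unitary conjugation -/
def LeU (X Y : H →L[ℂ] H) : Prop := ∃ V ∈ unitary (H →L[ℂ] H), X ≤ star V * Y * V

theorem LeU.of_le {X Y : H →L[ℂ] H} (h : X ≤ Y) : LeU X Y :=
  ⟨1, one_mem _, by simpa using h⟩

theorem LeU.trans {X Y Z : H →L[ℂ] H} (h1 : LeU X Y) (h2 : LeU Y Z) : LeU X Z := by
  obtain ⟨U, hU, h1⟩ := h1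
  obtain ⟨V, hV, h2⟩ := h2
  refine ⟨V * U, mul_mem hV hU, h1.trans ?_⟩
  have := star_left_conjugate_le_conjugate h2 U
  simpa only [star_mul, mul_assoc] using this

theorem cfc_conj {V Y : H →L[ℂ] H} (hV : V ∈ unitary (H →L[ℂ] H)) (hY : 0 ≤ Y) {f : ℝ → ℝ}
    (hf : ContinuousOn f (Set.Ici 0)) : cfc f (star V * Y * V) = star V * cfc f Y * V := by
  have h1 : star V * V = 1 := Unitary.star_mul_self_of_mem hV
  have h2 : V * star V = 1 := Unitary.mul_star_self_of_mem hV
  have h := intertw0 hY (star_left_conjugate_nonneg hY V) (T := V)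
    (by rw [← mul_assoc, ← mul_assoc, h2, one_mul]) hf
  rw [mul_assoc (star V) (cfc f Y), h, ← mul_assoc (star V) V, h1, one_mul]

theorem leU_of_equiv {X Y : H →L[ℂ] H} (hX : IsSelfAdjoint X) (hY : IsSelfAdjoint Y) (U : H ≃ₗᵢ[ℂ] H)
    (h : ∀ x, (⟪X x, x⟫_ℂ).re ≤ (⟪Y (U x), U x⟫_ℂ).re) : LeU X Y := by
  let V := Unitary.linearIsometryEquiv.symm U
  refine ⟨V, V.2, ?_⟩
  have hV : ∀ x, (V : H →L[ℂ] H) x = U x := fun x => rfl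
  rw [le_iff_re hX (IsSelfAdjoint.conjugate' hY _)]
  intro x
  refine (h x).trans (le_of_eq ?_)
  rw [ContinuousLinearMap.mul_apply, ContinuousLinearMap.mul_apply, ContinuousLinearMap.star_eq_adjoint,
    ContinuousLinearMap.adjoint_inner_left, hV]

theorem leU_sq {X Y : H →L[ℂ] H} (hX : 0 ≤ X) (hXY : X ≤ Y) : LeU (X * X) (Y * Y) := by
  have hY := hX.trans hXY
  obtain ⟨U, hU⟩ := sqDom_of_le hX hXY
  have sq : ∀ X : H →L[ℂ] H, 0 ≤ X → ∀ x, (⟪(X * X) x, x⟫_ℂ).re = ‖X x‖ ^ 2 := by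
    intro X hX x
    rw [ContinuousLinearMap.mul_apply, sa_symm hX.isSelfAdjoint]
    have := inner_self_eq_norm_sq (𝕜 := ℂ) (X x); simpa using this
  have ss : ∀ X : H →L[ℂ] H, 0 ≤ X → IsSelfAdjoint (X * X) := by
    intro X hX
    have := hX.isSelfAdjoint
    rw [IsSelfAdjoint, star_mul, this.star_eq]
  refine leU_of_equiv (ss X hX) (ss Y hY) U fun x => ?_
  rw [sq X hX, sq Y hY]
  have := hU x
  gcongr

/-- functions monotone for the unitary preorder -/
def UMon (H : Type*) [NormedAddCommGroup H] [InnerProductSpace ℂ H] [CompleteSpace H] (φ : ℝ → ℝ) : Prop :=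
  ∀ X Y : H →L[ℂ] H, 0 ≤ X → X ≤ Y → LeU (cfc φ X) (cfc φ Y)

theorem UMon.leU {φ : ℝ → ℝ} (h : UMon H φ) (hφ : ContinuousOn φ (Set.Ici 0)) {X Y : H →L[ℂ] H} (hX : 0 ≤ X)
    (hY : 0 ≤ Y) (hXY : LeU X Y) : LeU (cfc φ X) (cfc φ Y) := by
  obtain ⟨V, hV, hle⟩ := hXY
  have h1 := h X _ hX hle
  refine h1.trans ⟨V, hV, ?_⟩
  rw [cfc_conj hV hY hφ]

theorem UMon.comp {φ ψ χ : ℝ → ℝ} (h : UMon H φ) (hφ : ContinuousOn φ (Set.Ici 0))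
    (h' : UMon H ψ) (hψ : ContinuousOn ψ (Set.Ici 0)) (p : ∀ x, 0 ≤ x → 0 ≤ ψ x)
    (e : ∀ x, 0 ≤ x → χ x = φ (ψ x)) : UMon H χ := by
  intro X Y hX hXY
  have key : ∀ X : H →L[ℂ] H, 0 ≤ X → 0 ≤ cfc ψ X ∧ cfc χ X = cfc φ (cfc ψ X) := by
    intro X hX
    refine ⟨cfc_nonneg fun x hx => p x (spec0 hX hx), ?_⟩
    have hc : ContinuousOn φ (Set.image ψ (spectrum ℝ X)) := by
      apply hφ.mono
      rintro _ ⟨x, hx, rfl⟩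
      exact p x (spec0 hX hx)
    rw [← cfc_comp' φ ψ X hc (hψ.mono (spec0 hX)) hX.isSelfAdjoint]
    exact cfc_congr fun x hx => e x (spec0 hX hx)
  have hY := hX.trans hXY
  rw [(key X hX).2, (key Y hY).2]
  exact h.leU hφ (key X hX).1 (key Y hY).1 (h' X Y hX hXY)

theorem uMon_sq : UMon H (fun x => x ^ 2) := by
  intro X Y hX hXY
  rw [cfc_pow_id X 2 hX.isSelfAdjoint, cfc_pow_id Y 2 (hX.trans hXY).isSelfAdjoint, pow_two, pow_two]
  exact leU_sq hX hXY

theorem uMon_pow (n : ℕ) : UMon H (fun x => x ^ (2 ^ n)) := by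
  induction n with
  | zero =>
    intro X Y hX hXY
    simp only [pow_zero, pow_one]
    rw [cfc_id' ℝ X hX.isSelfAdjoint, cfc_id' ℝ Y (hX.trans hXY).isSelfAdjoint]
    exact LeU.of_le hXY
  | succ n ih =>
    refine uMon_sq.comp (by fun_prop) ih (by fun_prop) (fun x hx => by positivity) fun x hx => ?_
    rw [← pow_mul, pow_succ]

theorem uMon_small {s : ℝ} (h0 : 0 ≤ s) (h1 : s ≤ 1) : UMon H (fun x => x ^ s) := by
  intro X Y hX hXY
  have hY := hX.trans hXY
  rw [← CFC.rpow_eq_cfc_real hX, ← CFC.rpow_eq_cfc_real hY]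
  exact LeU.of_le (CFC.rpow_le_rpow ⟨h0, h1⟩ hXY)

theorem cont_rpow {r : ℝ} (hr : 0 ≤ r) (s : Set ℝ) : ContinuousOn (fun x : ℝ => x ^ r) s :=
  (Real.continuous_rpow_const hr).continuousOn

theorem uMon_rpow {r : ℝ} (hr : 0 ≤ r) : UMon H (fun x => x ^ r) := by
  obtain ⟨n, hn⟩ := pow_unbounded_of_one_lt r (one_lt_two)
  have hp : (0:ℝ) < 2 ^ n := by positivity
  have h0 : 0 ≤ r / 2 ^ n := by positivity
  have h1 : r / 2 ^ n ≤ 1 := (div_le_one hp).2 hn.le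
  refine (uMon_small h0 h1).comp (cont_rpow h0 _) (uMon_pow n) (by fun_prop) (fun x hx => by positivity) fun x hx => ?_
  rw [← Real.rpow_natCast, ← Real.rpow_mul hx]
  congr 1
  push_cast
  field_simp

theorem cfc_apply_eigen {X : H →L[ℂ] H} (hX : 0 ≤ X) {u : H} {l : ℝ} (hl : 0 ≤ l) (hu : ‖u‖ = 1) (h : X u = (l : ℂ) • u) {f : ℝ → ℝ}
    (hf : ContinuousOn f (Set.Ici 0)) : cfc f X u = (f l : ℂ) • u := by
  have h1 : X * InnerProductSpace.rankOne ℂ u u = InnerProductSpace.rankOne ℂ u u * algebraMap ℝ (H →L[ℂ] H) l := by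
    ext x
    simp [h, Algebra.algebraMap_eq_smul_one, clm_rsmul, ← Complex.coe_smul, smul_smul, inner_smul_right, mul_comm]
  have h2 := intertw0 hX (algMap_nonneg hl) h1 hf
  have h3 := congrArg (fun T : H →L[ℂ] H => T u) h2
  rw [cfc_algebraMap] at h3
  simpa [hu, Algebra.algebraMap_eq_smul_one, ← Complex.coe_smul, inner_self_eq_norm_sq_to_K, inner_smul_right] using h3

theorem quad_basis {n : ℕ} (u : OrthonormalBasis (Fin n) ℂ H) {X : H →L[ℂ] H} (hX : IsSelfAdjoint X) {l : Fin n → ℝ}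
    (h : ∀ i, X (u i) = (l i : ℂ) • u i) (z : H) : (⟪X z, z⟫_ℂ).re = ∑ i, l i * ‖⟪u i, z⟫_ℂ‖ ^ 2 := by
  rw [← u.sum_inner_mul_inner (X z) z, Complex.re_sum]
  apply Finset.sum_congr rfl
  intro i _
  rw [sa_symm hX, h, inner_smul_right, ← inner_conj_symm, mul_assoc, Complex.conj_mul', Complex.re_ofReal_mul]
  norm_cast

theorem weyl [FiniteDimensional ℂ H] {n : ℕ} (hn : Module.finrank ℂ H = n) (u w : OrthonormalBasis (Fin n) ℂ H) {X Y : H →L[ℂ] H} (hX : IsSelfAdjoint X)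
    (hY : IsSelfAdjoint Y) {l m : Fin n → ℝ} (hl : Antitone l) (hm : Antitone m)
    (h : ∀ i, X (u i) = (l i : ℂ) • u i) (h' : ∀ i, Y (w i) = (m i : ℂ) • w i) (hXY : X ≤ Y) (k : Fin n) : l k ≤ m k := by
  let L : H →ₗ[ℂ] (Fin n → ℂ) := LinearMap.pi fun j =>
    if j < k then (innerSL ℂ (w j)).toLinearMap else if k < j then (innerSL ℂ (u j)).toLinearMap else 0
  have hL : ∀ z j, L z j = if j < k then ⟪w j, z⟫_ℂ else if k < j then ⟪u j, z⟫_ℂ else 0 := by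
    intro z j
    simp only [L, LinearMap.pi_apply]
    split_ifs <;> simp
  have ns : ¬ Function.Surjective L := by
    intro hs
    obtain ⟨z, hz⟩ := hs (fun _ => 1)
    have := congrFun hz k
    rw [hL] at this
    simp at this
  rw [← LinearMap.injective_iff_surjective_of_finrank_eq_finrank (by simp [hn]), injective_iff_map_eq_zero] at ns
  push Not at ns
  obtain ⟨z, hz, z0⟩ := ns
  have q1 := quad_basis u hX h z
  have q2 := quad_basis w hY h' z
  have n1 := u.sum_sq_norm_inner_right z
  have n2 := w.sum_sq_norm_inner_right z
  have z1 : ∀ j, k < j → ⟪u j, z⟫_ℂ = 0 := by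
    intro j hj
    have := congrFun hz j
    rw [hL, if_neg (not_lt.2 hj.le), if_pos hj] at this
    exact this
  have z2 : ∀ j, j < k → ⟪w j, z⟫_ℂ = 0 := by
    intro j hj
    have := congrFun hz j
    rw [hL, if_pos hj] at this
    exact this
  have b1 : l k * ‖z‖ ^ 2 ≤ (⟪X z, z⟫_ℂ).re := by
    rw [q1, ← n1, Finset.mul_sum]
    apply Finset.sum_le_sum
    intro j _
    rcases lt_or_ge k j with hj | hj
    · simp [z1 j hj]
    · have := hl hj
      gcongr
  have b2 : (⟪Y z, z⟫_ℂ).re ≤ m k * ‖z‖ ^ 2 := by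
    rw [q2, ← n2, Finset.mul_sum]
    apply Finset.sum_le_sum
    intro j _
    rcases lt_or_ge j k with hj | hj
    · simp [z2 j hj]
    · have := hm hj
      gcongr
  have b3 := (le_iff_re hX hY).1 hXY z
  have : 0 < ‖z‖ ^ 2 := by positivity
  exact le_of_mul_le_mul_right (b1.trans (b3.trans b2)) this

theorem uMon_fin [FiniteDimensional ℂ H]
    {f : ℝ → ℝ} (hf : ContinuousOn f (Set.Ici 0)) (hm : MonotoneOn f (Set.Ici 0)) : UMon H f := by
  intro X Y hX hXY
  have hY := hX.trans hXY
  have sX : (X : H →ₗ[ℂ] H).IsSymmetric := ContinuousLinearMap.isSelfAdjoint_iff_isSymmetric.1 hX.isSelfAdjoint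
  have sY : (Y : H →ₗ[ℂ] H).IsSymmetric := ContinuousLinearMap.isSelfAdjoint_iff_isSymmetric.1 hY.isSelfAdjoint
  let u := sX.eigenvectorBasis rfl
  let w := sY.eigenvectorBasis rfl
  let l := sX.eigenvalues rfl
  let m := sY.eigenvalues rfl
  have hu : ∀ i, X (u i) = (l i : ℂ) • u i := fun i => sX.apply_eigenvectorBasis rfl i
  have hw : ∀ i, Y (w i) = (m i : ℂ) • w i := fun i => sY.apply_eigenvectorBasis rfl i
  have hlm := weyl rfl u w hX.isSelfAdjoint hY.isSelfAdjoint (sX.eigenvalues_antitone rfl) (sY.eigenvalues_antitone rfl) hu hw hXY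
  have pos : ∀ (X : H →L[ℂ] H), 0 ≤ X → ∀ (v : H) (c : ℝ), ‖v‖ = 1 → X v = (c : ℂ) • v → 0 ≤ c := by
    intro X hX v c hv h
    have := (Complex.nonneg_iff.1 (inner_apply_self_nonneg hX v)).1
    rw [h, inner_smul_left, inner_self_eq_norm_sq_to_K, hv] at this
    simpa using this
  have lp : ∀ i, 0 ≤ l i := fun i => pos X hX _ _ (u.orthonormal.1 i) (hu i)
  have mp : ∀ i, 0 ≤ m i := fun i => pos Y hY _ _ (w.orthonormal.1 i) (hw i)
  refine leU_of_equiv (cfc_predicate _ _) (cfc_predicate _ _) (u.repr.trans w.repr.symm) fun z => ?_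
  rw [quad_basis u (cfc_predicate f X) (l := fun i => f (l i)) (fun i => cfc_apply_eigen hX (lp i) (u.orthonormal.1 i) (hu i) hf),
    quad_basis w (cfc_predicate f Y) (l := fun i => f (m i)) (fun i => cfc_apply_eigen hY (mp i) (w.orthonormal.1 i) (hw i) hf)]
  apply Finset.sum_le_sum
  intro i _
  have e : ⟪w i, (u.repr.trans w.repr.symm) z⟫_ℂ = ⟪u i, z⟫_ℂ := by
    rw [← w.repr_apply_apply, ← u.repr_apply_apply]
    simp
  rw [e]
  have := hm (lp i) (mp i) (hlm i)
  gcongr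

theorem uMon_inf (hinf : ¬ FiniteDimensional ℂ H)
    {f : ℝ → ℝ} (hf : ContinuousOn f (Set.Ici 0)) (hm : MonotoneOn f (Set.Ici 0)) (hc : OpCvx H f) : UMon H f := by
  intro X Y hX hXY
  have hY := hX.trans hXY
  obtain ⟨V, hV, hle⟩ := leU_sq hX hXY
  refine ⟨V, hV, ?_⟩
  rw [← cfc_conj hV hY hf]
  apply m6 hinf hf hm hc hX (star_left_conjugate_nonneg hY V)
  have h2 : V * star V = 1 := Unitary.mul_star_self_of_mem hV
  have e : star V * Y * V * (star V * Y * V) = star V * (Y * Y) * V := by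
    calc star V * Y * V * (star V * Y * V) = star V * Y * (V * star V) * Y * V := by simp only [mul_assoc]
      _ = _ := by rw [h2, mul_one]; simp only [mul_assoc]
  rwa [e]

theorem uMon_any {f : ℝ → ℝ} (hf : ContinuousOn f (Set.Ici 0)) (hm : MonotoneOn f (Set.Ici 0)) (hc : OpCvx H f) : UMon H f := by
  by_cases h : FiniteDimensional ℂ H
  · exact uMon_fin hf hm
  · exact uMon_inf h hf hm hc

theorem main (A B : H →L[ℂ] H) (hA : 0 ≤ A) (hB : 0 ≤ B)
    (hAB : LeU A B)
    (g : ℝ → ℝ) (hg_cont : ContinuousOn g (Set.Ici 0))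
    (hg_nonneg : ∀ x : ℝ, 0 ≤ x → 0 ≤ g x)
    (hg_opMonotone : ∀ X Y : H →L[ℂ] H, 0 ≤ X → 0 ≤ Y → X ≤ Y → cfc g X ≤ cfc g Y)
    (f : ℝ → ℝ) (hf_cont : ContinuousOn f (Set.Ici 0))
    (hf_mono : MonotoneOn f (Set.Ici 0))
    (hf_opConvex : OpCvx H f)
    (r : ℝ) (hr : 0 < r) :
    LeU (cfc f (cfc (fun x : ℝ => x ^ r) (cfc g A))) (cfc f (cfc (fun x : ℝ => x ^ r) (cfc g B))) := by
  have mg : UMon H g := fun X Y hX hXY => LeU.of_le (hg_opMonotone X Y hX (hX.trans hXY) hXY)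
  have pg : ∀ X : H →L[ℂ] H, 0 ≤ X → 0 ≤ cfc g X := fun X hX => cfc_nonneg fun x hx => hg_nonneg x (spec0 hX hx)
  have pr : ∀ X : H →L[ℂ] H, 0 ≤ X → 0 ≤ cfc (fun x : ℝ => x ^ r) X := fun X hX =>
    cfc_nonneg fun x hx => Real.rpow_nonneg (spec0 hX hx) r
  have s1 := mg.leU hg_cont hA hB hAB
  have s2 := (uMon_rpow hr.le).leU (cont_rpow hr.le _) (pg A hA) (pg B hB) s1
  exact (uMon_any hf_cont hf_mono hf_opConvex).leU hf_cont (pr _ (pg A hA)) (pr _ (pg B hB)) s2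

end P20
end Leu
end F20

variable {H : Type*} [NormedAddCommGroup H] [InnerProductSpace ℂ H] [CompleteSpace H]

/-- Theorem 2.8 (main direction): if `A ≤ᵤ B` (i.e. `A ≤ U*BU` for some unitary `U`) for
positive `A, B`, then `f(g(A)^r) ≤ᵤ f(g(B)^r)` for any increasing operator convex `f`,
any operator monotone `g : [0,∞) → [0,∞)`, and any `r > 0`. -/
theorem leu_cfc_of_leu (A B : H →L[ℂ] H) (hA : 0 ≤ A) (hB : 0 ≤ B)
    (hAB : ∃ U ∈ unitary (H →L[ℂ] H), A ≤ star U * B * U)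
    (g : ℝ → ℝ) (hg_cont : ContinuousOn g (Set.Ici 0))
    (hg_nonneg : ∀ x : ℝ, 0 ≤ x → 0 ≤ g x)
    (hg_opMonotone : ∀ X Y : H →L[ℂ] H, 0 ≤ X → 0 ≤ Y → X ≤ Y → cfc g X ≤ cfc g Y)
    (f : ℝ → ℝ) (hf_cont : ContinuousOn f (Set.Ici 0))
    (hf_mono : MonotoneOn f (Set.Ici 0))
    (hf_opConvex : ∀ (X Y : H →L[ℂ] H) (t : ℝ), 0 ≤ X → 0 ≤ Y → t ∈ Set.Icc (0 : ℝ) 1 →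
      cfc f (t • X + (1 - t) • Y) ≤ t • cfc f X + (1 - t) • cfc f Y)
    (r : ℝ) (hr : 0 < r) :
    ∃ V ∈ unitary (H →L[ℂ] H),
      cfc f (cfc (fun x : ℝ => x ^ r) (cfc g A)) ≤
        star V * (cfc f (cfc (fun x : ℝ => x ^ r) (cfc g B))) * V := by
  exact Leu.main A B hA hB hAB g hg_cont hg_nonneg hg_opMonotone f hf_cont hf_mono hf_opConvex r hr
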